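/- arXiv:2108.12316 — 3 statements merged into one kernel-verified Lean document; each statement's English description precedes it below -/
import Mathlib

section
/- Let f, g : ℝ^n → ℝ be C^∞ functions such that ρ = e^{−f}·β and ν = e^{−g}·β are probability measures with ∫|∇f|² dρ < ∞ and ∫|∇g|² dν < ∞. Let φ : ℝ^n → ℝ be a C^∞ function such that x ↦ |x|²/2 + φ(x) is convex, the matrix I + Hess φ(x) is invertible for every x, the map T = id + ∇φ pushes ρ forward to ν, and ∫|∇φ|² dρ < ∞. Then for every compactly supported C^∞ vector field ξ : ℝ^n → ℝ^n, ∫ ⟨∇φ(x) + ∇g(T(x)) − ∇f(x), ξ(x)⟩ dρ(x) = ∫ ⟨(I + Hess φ(x))⁻¹ − I, Dξ(x)⟩_F dρ(x), where ⟨A, B⟩_F = trace(Aᵀ·B) is the Frobenius (Hilbert–Schmidt) inner product and Dξ is the Jacobian matrix of ξ. (This is the weak formulation of the identity ∇φ + ∇g∘T − ∇f = δ_ρ[(I + ∇²φ)⁻¹ − I] of Proposition 3.1.) -/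
open MeasureTheory Real Filter Topology

/-- The standard Gaussian measure on `ℝ^n`, i.e. the measure with density
`(2π)^(-n/2) exp(-|x|²/2)` with respect to Lebesgue measure. -/
noncomputable def stdGaussian (n : ℕ) : Measure (Fin n → ℝ) :=
  volume.withDensity fun x =>
    ENNReal.ofReal ((2 * π) ^ (-(n : ℝ) / 2) * Real.exp (-(∑ i, x i ^ 2) / 2))

/-- The gradient of `f : ℝ^n → ℝ`, given coordinatewise by `(∇f)(x)ᵢ = ∂ᵢf(x)`. -/
noncomputable def grad {n : ℕ} (f : (Fin n → ℝ) → ℝ) (x : Fin n → ℝ) : Fin n → ℝ :=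
  fun i => fderiv ℝ f x (Pi.single i 1)

/-- The Hessian matrix of `f : ℝ^n → ℝ`. -/
noncomputable def hess {n : ℕ} (f : (Fin n → ℝ) → ℝ) (x : Fin n → ℝ) :
    Matrix (Fin n) (Fin n) ℝ :=
  Matrix.of fun i j => fderiv ℝ (fun y => grad f y j) x (Pi.single i 1)

/-- The Jacobian matrix of a vector field `ξ : ℝ^n → ℝ^n`:
`(Dξ)(x)ᵢⱼ = ∂ⱼξᵢ(x)`. -/
noncomputable def jac {n : ℕ} (ξ : (Fin n → ℝ) → Fin n → ℝ) (x : Fin n → ℝ) :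
    Matrix (Fin n) (Fin n) ℝ :=
  Matrix.of fun i j => fderiv ℝ (fun y => ξ y i) x (Pi.single j 1)

/-- A differentiable function that is convex and has equal derivatives at two points has that same
derivative along the whole segment between them. -/
theorem ConvexOn.fderiv_eq_of_mem_segment {E : Type*} [NormedAddCommGroup E] [NormedSpace ℝ E]
    {u : E → ℝ} (hu : ConvexOn ℝ Set.univ u) (hd : Differentiable ℝ u) {x y z : E}
    (hxy : fderiv ℝ u x = fderiv ℝ u y) (hz : z ∈ segment ℝ x y) :
    fderiv ℝ u z = fderiv ℝ u x := by
  have tangent_le : ∀ a b, fderiv ℝ u a (b - a) ≤ u b - u a := by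
    intro a b
    have hk : ConvexOn ℝ Set.univ (u ∘ AffineMap.lineMap (k := ℝ) a b) := by
      simpa using hu.comp_affineMap (AffineMap.lineMap (k := ℝ) a b)
    have hk' : HasDerivAt (u ∘ AffineMap.lineMap (k := ℝ) a b) (fderiv ℝ u a (b - a)) 0 := by
      refine HasFDerivAt.comp_hasDerivAt (0 : ℝ) ?_ AffineMap.hasDerivAt_lineMap
      simpa using (hd a).hasFDerivAt
    simpa [slope] using
      hk.le_slope_of_hasDerivAt (Set.mem_univ 0) (Set.mem_univ 1) zero_lt_one hk'
  have hmin : ∀ w, u z - fderiv ℝ u x z ≤ u w - fderiv ℝ u x w := by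
    intro w
    obtain ⟨a, b, ha, hb, hab, rfl⟩ := hz
    have hx := tangent_le x w
    have hy := tangent_le y w
    have hc := hu.2 (Set.mem_univ x) (Set.mem_univ y) ha hb hab
    rw [← hxy] at hy
    simp only [map_sub, map_add, map_smul, smul_eq_mul] at *
    obtain rfl : b = 1 - a := by linarith
    nlinarith [mul_le_mul_of_nonneg_left hx ha, mul_le_mul_of_nonneg_left hy hb]
  have hloc : IsLocalMin (fun w => u w - fderiv ℝ u x w) z := Eventually.of_forall hmin
  have hzero := hloc.hasFDerivAt_eq_zero
    ((hd z).hasFDerivAt.sub (fderiv ℝ u x).hasFDerivAt)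
  exact sub_eq_zero.mp hzero

theorem jac_eq_toMatrix' {n : ℕ} {η : (Fin n → ℝ) → Fin n → ℝ} {x : Fin n → ℝ}
    (hη : DifferentiableAt ℝ η x) :
    jac η x = LinearMap.toMatrix' (fderiv ℝ η x : (Fin n → ℝ) →ₗ[ℝ] Fin n → ℝ) := by
  ext i j
  simp [jac, fderiv_apply hη, LinearMap.toMatrix'_apply]

theorem fderiv_eq_jac_mulVec {n : ℕ} {η : (Fin n → ℝ) → Fin n → ℝ} {x : Fin n → ℝ}
    (hη : DifferentiableAt ℝ η x) (v : Fin n → ℝ) :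
    fderiv ℝ η x v = (jac η x).mulVec v := by
  rw [jac_eq_toMatrix' hη, LinearMap.toMatrix'_mulVec]
  rfl

theorem jac_comp {n : ℕ} {η T : (Fin n → ℝ) → Fin n → ℝ} {x : Fin n → ℝ}
    (hη : DifferentiableAt ℝ η (T x)) (hT : DifferentiableAt ℝ T x) :
    jac (fun y => η (T y)) x = jac η (T x) * jac T x := by
  rw [jac_eq_toMatrix' (η := fun y => η (T y)) (hη.comp x hT), jac_eq_toMatrix' hη, jac_eq_toMatrix' hT,
    ← LinearMap.toMatrix'_comp]
  congr 1
  rw [show (fun y => η (T y)) = η ∘ T from rfl, fderiv_comp x hη hT]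
  rfl

theorem fderiv_eq_sum_grad {n : ℕ} (u : (Fin n → ℝ) → ℝ) (x v : Fin n → ℝ) :
    fderiv ℝ u x v = ∑ i, v i * grad u x i := by
  conv_lhs => rw [pi_eq_sum_univ' v]
  simp [grad]

theorem contDiff_grad {n : ℕ} {u : (Fin n → ℝ) → ℝ} (hu : ContDiff ℝ (⊤ : ℕ∞) u) :
    ContDiff ℝ (⊤ : ℕ∞) (grad u) := by
  refine contDiff_pi.2 fun i => ?_
  exact (hu.fderiv_right (m := (⊤ : ℕ∞)) (by simp)).clm_apply contDiff_const

theorem trace_jac_eq {n : ℕ} (η : (Fin n → ℝ) → Fin n → ℝ) (x : Fin n → ℝ) :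
    (jac η x).trace = ∑ i, fderiv ℝ (fun y => η y i) x (Pi.single i 1) := rfl

theorem hasFDerivAt_sum_sq {n : ℕ} (x : Fin n → ℝ) :
    HasFDerivAt (fun x : Fin n → ℝ => ∑ i, x i ^ 2)
      (∑ i, (2 * x i) • ContinuousLinearMap.proj (R := ℝ) (φ := fun _ : Fin n => ℝ) i) x := by
  refine HasFDerivAt.fun_sum fun i _ => ?_
  simpa using (hasFDerivAt_apply (𝕜 := ℝ) i x).pow 2

theorem integral_withDensity_stdGaussian {n : ℕ} {g : (Fin n → ℝ) → ℝ} (hg : Continuous g)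
    (F : (Fin n → ℝ) → ℝ) :
    ∫ x, F x ∂((stdGaussian n).withDensity fun x => ENNReal.ofReal (Real.exp (-g x))) =
      ∫ x, ((2 * π) ^ (-(n : ℝ) / 2) * Real.exp (-(∑ i, x i ^ 2) / 2 - g x)) * F x := by
  rw [integral_withDensity_eq_integral_toReal_smul (by fun_prop) (by simp), stdGaussian,
    integral_withDensity_eq_integral_toReal_smul (by fun_prop) (by simp)]
  congr 1 with x
  rw [ENNReal.toReal_ofReal (by positivity), ENNReal.toReal_ofReal (by positivity), sub_eq_add_neg,
    Real.exp_add]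
  simp only [smul_eq_mul]
  ring

/-- Gaussian integration by parts against the measure `e^{-g}·β`. -/
theorem integral_sum_add_grad_mul {n : ℕ} {g : (Fin n → ℝ) → ℝ} (hg : ContDiff ℝ (⊤ : ℕ∞) g)
    {η : (Fin n → ℝ) → Fin n → ℝ} (hη : ContDiff ℝ (⊤ : ℕ∞) η) (hηc : HasCompactSupport η) :
    ∫ x, (∑ i, (x i + grad g x i) * η x i)
        ∂((stdGaussian n).withDensity fun x => ENNReal.ofReal (Real.exp (-g x))) =
      ∫ x, (jac η x).trace
        ∂((stdGaussian n).withDensity fun x => ENNReal.ofReal (Real.exp (-g x))) := by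
  rw [integral_withDensity_stdGaussian hg.continuous, integral_withDensity_stdGaussian hg.continuous]
  set q : (Fin n → ℝ) → ℝ := fun x =>
    (2 * π) ^ (-(n : ℝ) / 2) * Real.exp (-(∑ i, x i ^ 2) / 2 - g x) with hq
  have hq_smooth : ContDiff ℝ (⊤ : ℕ∞) q := by fun_prop
  have hgd : Differentiable ℝ g := hg.differentiable (by simp)
  have hq_deriv : ∀ x i, fderiv ℝ q x (Pi.single i 1) = -(q x * (x i + grad g x i)) := by
    intro x i
    have h : HasFDerivAt q _ x :=
      ((((hasFDerivAt_sum_sq x).neg.mul_const (2 : ℝ)⁻¹).sub (hgd x).hasFDerivAt).exp).const_mul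
        ((2 * π) ^ (-(n : ℝ) / 2))
    rw [h.fderiv]
    simp [hq, grad, Pi.single_apply, div_eq_mul_inv]
    ring
  have hηi : ∀ i, ContDiff ℝ (⊤ : ℕ∞) fun x => η x i := fun i => contDiff_pi.1 hη i
  have hηic : ∀ i, HasCompactSupport fun x => η x i := fun i =>
    hηc.comp_left (g := fun v : Fin n → ℝ => v i) rfl
  have hgrad := (contDiff_grad hg).continuous
  have hηd : ∀ i, Continuous fun x => fderiv ℝ (fun y => η y i) x (Pi.single i 1) := fun i =>
    ((hηi i).continuous_fderiv (by simp)).clm_apply continuous_const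
  have hηdc : ∀ i, HasCompactSupport fun x => fderiv ℝ (fun y => η y i) x (Pi.single i 1) :=
    fun i => (hηic i).fderiv_apply ℝ _
  have hint1 : ∀ i, Integrable fun x => q x * fderiv ℝ (fun y => η y i) x (Pi.single i 1) :=
    fun i => (hq_smooth.continuous.mul (hηd i)).integrable_of_hasCompactSupport (hηdc i).mul_left
  have hint2 : ∀ i, Integrable fun x => q x * ((x i + grad g x i) * η x i) := fun i => by
    have := (hηi i).continuous
    have := hq_smooth.continuous
    refine Continuous.integrable_of_hasCompactSupport (by fun_prop) ?_
    exact (hηic i).mul_left.mul_left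
  simp only [trace_jac_eq, Finset.mul_sum]
  rw [integral_finsetSum _ fun i _ => hint2 i, integral_finsetSum _ fun i _ => hint1 i]
  refine Finset.sum_congr rfl fun i _ => ?_
  have hneg : ∀ x, fderiv ℝ q x (Pi.single i 1) * η x i =
      -(q x * ((x i + grad g x i) * η x i)) := fun x => by rw [hq_deriv]; ring
  rw [integral_mul_fderiv_eq_neg_fderiv_mul_of_integrable]
  · simp only [hneg, integral_neg, neg_neg]
  · simp only [hneg]
    exact (hint2 i).neg
  · exact hint1 i
  · exact (hq_smooth.continuous.mul (hηi i).continuous).integrable_of_hasCompactSupport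
      (hηic i).mul_left
  · exact fun x _ => hq_smooth.differentiable (by simp) x
  · exact fun x _ => (hηi i).differentiable (by simp) x

theorem integrable_trace_jac {n : ℕ} {μ : Measure (Fin n → ℝ)} [IsFiniteMeasureOnCompacts μ]
    {η : (Fin n → ℝ) → Fin n → ℝ} (hη : ContDiff ℝ (⊤ : ℕ∞) η) (hηc : HasCompactSupport η) :
    Integrable (fun x => (jac η x).trace) μ := by
  simp only [trace_jac_eq]
  refine integrable_finsetSum _ fun i _ => ?_
  refine Continuous.integrable_of_hasCompactSupport ?_ ?_
  · exact ((contDiff_pi.1 hη i).continuous_fderiv (by simp)).clm_apply continuous_const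
  · exact (hηc.comp_left (g := fun v : Fin n → ℝ => v i) rfl).fderiv_apply ℝ _

/-- The extension by zero of a compactly supported smooth map along an injective smooth map with
invertible derivatives is smooth and compactly supported. -/
theorem contDiff_extend_of_injective {E F : Type*} [NormedAddCommGroup E] [NormedSpace ℝ E]
    [FiniteDimensional ℝ E] [NormedAddCommGroup F] [NormedSpace ℝ F]
    {T : E → E} (hT : ContDiff ℝ (⊤ : ℕ∞) T) (hTinj : Function.Injective T)
    (hD : ∀ x, Function.Injective (fderiv ℝ T x)) {ξ : E → F} (hξ : ContDiff ℝ (⊤ : ℕ∞) ξ)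
    (hξc : HasCompactSupport ξ) :
    ContDiff ℝ (⊤ : ℕ∞) (Function.extend T ξ 0) ∧ HasCompactSupport (Function.extend T ξ 0) := by
  have := FiniteDimensional.complete ℝ E
  have hK : IsCompact (T '' tsupport ξ) := IsCompact.image hξc hT.continuous
  have hzero : ∀ y ∉ T '' tsupport ξ, Function.extend T ξ 0 y = 0 := by
    intro y hy
    by_cases hyT : ∃ x, T x = y
    · obtain ⟨x, rfl⟩ := hyT
      rw [hTinj.extend_apply]
      exact image_eq_zero_of_notMem_tsupport fun hx => hy ⟨x, hx, rfl⟩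
    · rw [Function.extend_apply' _ _ _ hyT, Pi.zero_apply]
  refine ⟨contDiff_iff_contDiffAt.2 fun y => ?_, HasCompactSupport.intro hK hzero⟩
  by_cases hy : y ∈ T '' tsupport ξ
  · obtain ⟨x, -, rfl⟩ := hy
    let e : E ≃L[ℝ] E := (LinearEquiv.ofInjectiveEndo
      (fderiv ℝ T x : E →ₗ[ℝ] E) (hD x)).toContinuousLinearEquiv
    have he : (e : E →L[ℝ] E) = fderiv ℝ T x := by ext v; rfl
    have hstrict : HasStrictFDerivAt T (e : E →L[ℝ] E) x := by
      rw [he]; exact hT.contDiffAt.hasStrictFDerivAt (by simp)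
    have hinv := hT.contDiffAt.to_localInverse hstrict.hasFDerivAt (by simp)
    refine (hξ.contDiffAt.comp (T x) hinv).congr_of_eventuallyEq ?_
    filter_upwards [hstrict.eventually_right_inverse] with y hy
    conv_lhs => rw [← hy]
    rw [hTinj.extend_apply]
    rfl
  · refine contDiffAt_const (c := (0 : F)) |>.congr_of_eventuallyEq ?_
    filter_upwards [hK.isClosed.isOpen_compl.mem_nhds hy] with z hz using hzero z hz

/-- The gradient of `|x|²/2 + φ` is injective when this function is convex and its Hessian is
everywhere nondegenerate. -/
theorem injective_id_add_grad {n : ℕ} {φ : (Fin n → ℝ) → ℝ} (hφ : ContDiff ℝ (⊤ : ℕ∞) φ)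
    (hconv : ConvexOn ℝ Set.univ fun x => (∑ i, x i ^ 2) / 2 + φ x)
    (hD : ∀ x, Function.Injective (fderiv ℝ (fun x => x + grad φ x) x)) :
    Function.Injective fun x => x + grad φ x := by
  have hφd : Differentiable ℝ φ := hφ.differentiable (by simp)
  set u : (Fin n → ℝ) → ℝ := fun x => (∑ i, x i ^ 2) / 2 + φ x
  have hu : Differentiable ℝ u := by fun_prop
  have hgrad : ∀ x, grad u x = x + grad φ x := by
    intro x
    have h : HasFDerivAt u _ x := ((hasFDerivAt_sum_sq x).mul_const (2 : ℝ)⁻¹).add (hφd x).hasFDerivAt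
    ext i
    simp only [grad, h.fderiv]
    simp [grad, Pi.single_apply]
  intro x y hxy
  have hfd : ∀ {a b}, a + grad φ a = b + grad φ b → fderiv ℝ u a = fderiv ℝ u b := by
    intro a b hab
    ext v
    rw [fderiv_eq_sum_grad, fderiv_eq_sum_grad, hgrad, hgrad, hab]
  have hconst : ∀ z ∈ segment ℝ x y, z + grad φ z = x + grad φ x := by
    intro z hz
    rw [← hgrad, ← hgrad]
    unfold grad
    rw [hconv.fderiv_eq_of_mem_segment hu (hfd hxy) hz]
  have hT : Differentiable ℝ fun x => x + grad φ x :=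
    differentiable_id.add ((contDiff_grad hφ).differentiable (by simp))
  have hderiv : HasDerivAt ((fun x => x + grad φ x) ∘ AffineMap.lineMap (k := ℝ) x y)
      (fderiv ℝ (fun x => x + grad φ x) x (y - x)) 0 := by
    refine HasFDerivAt.comp_hasDerivAt (0 : ℝ) ?_ AffineMap.hasDerivAt_lineMap
    simpa using (hT x).hasFDerivAt
  have hderiv0 : HasDerivWithinAt ((fun x => x + grad φ x) ∘ AffineMap.lineMap (k := ℝ) x y)
      0 (Set.Icc 0 1) 0 := by
    refine (hasDerivWithinAt_const (0 : ℝ) (Set.Icc 0 1) (x + grad φ x)).congr ?_ (by simp)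
    intro t ht
    exact hconst _ (by rw [segment_eq_image_lineMap]; exact ⟨t, ht, rfl⟩)
  have hdir := (uniqueDiffOn_Icc (zero_lt_one (α := ℝ)) 0 (by simp)).eq_deriv _
    hderiv.hasDerivWithinAt hderiv0
  exact (sub_eq_zero.mp (hD x (hdir.trans (map_zero _).symm))).symm

theorem jac_id_add_grad {n : ℕ} {φ : (Fin n → ℝ) → ℝ} (hφ : ContDiff ℝ (⊤ : ℕ∞) φ) (x : Fin n → ℝ) :
    jac (fun x => x + grad φ x) x = (1 + hess φ x).transpose := by
  have hd : ∀ i, DifferentiableAt ℝ (fun y => grad φ y i) x := fun i =>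
    (contDiff_pi.1 (contDiff_grad hφ) i).differentiable (by simp) x
  ext i j
  have h : HasFDerivAt (fun y : Fin n → ℝ => y i + grad φ y i) _ x :=
    (hasFDerivAt_apply (𝕜 := ℝ) i x).add (hd i).hasFDerivAt
  simp only [jac, hess, Matrix.of_apply, Pi.add_apply, h.fderiv]
  simp [Matrix.one_apply, Pi.single_apply, eq_comm]

/-- Weak formulation of the identity
`∇φ + ∇g∘T − ∇f = δ_ρ[(I + ∇²φ)⁻¹ − I]` (Proposition 3.1): for every compactly
supported smooth vector field `ξ`,
`∫ ⟨∇φ + ∇g∘T − ∇f, ξ⟩ dρ = ∫ ⟨(I + Hess φ)⁻¹ − I, Dξ⟩_F dρ`. -/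
theorem monge_potential_identity_weak (n : ℕ)
    (f g φ : (Fin n → ℝ) → ℝ)
    (hf : ContDiff ℝ (⊤ : ℕ∞) f) (hg : ContDiff ℝ (⊤ : ℕ∞) g) (hφ : ContDiff ℝ (⊤ : ℕ∞) φ)
    (ρ ν : Measure (Fin n → ℝ))
    (hρ : ρ = (stdGaussian n).withDensity fun x => ENNReal.ofReal (Real.exp (-f x)))
    (hν : ν = (stdGaussian n).withDensity fun x => ENNReal.ofReal (Real.exp (-g x)))
    (hρprob : IsProbabilityMeasure ρ) (hνprob : IsProbabilityMeasure ν)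
    (hfint : Integrable (fun x => ∑ i, grad f x i ^ 2) ρ)
    (hgint : Integrable (fun x => ∑ i, grad g x i ^ 2) ν)
    (hconv : ConvexOn ℝ Set.univ fun x => (∑ i, x i ^ 2) / 2 + φ x)
    (hinv : ∀ x, IsUnit (1 + hess φ x))
    (hpush : Measure.map (fun x => x + grad φ x) ρ = ν)
    (hφint : Integrable (fun x => ∑ i, grad φ x i ^ 2) ρ)
    (ξ : (Fin n → ℝ) → Fin n → ℝ) (hξ : ContDiff ℝ (⊤ : ℕ∞) ξ) (hξc : HasCompactSupport ξ) :
    ∫ x, (∑ i, (grad φ x i + grad g (x + grad φ x) i - grad f x i) * ξ x i) ∂ρ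
      = ∫ x, Matrix.trace (Matrix.transpose ((1 + hess φ x)⁻¹ - 1) * jac ξ x) ∂ρ := by
  have hT : ContDiff ℝ (⊤ : ℕ∞) fun x => x + grad φ x := contDiff_id.add (contDiff_grad hφ)
  have hTd : Differentiable ℝ fun x => x + grad φ x := hT.differentiable (by simp)
  have hD : ∀ x, Function.Injective (fderiv ℝ (fun x => x + grad φ x) x) := by
    intro x v w hvw
    rw [fderiv_eq_jac_mulVec (hTd x), fderiv_eq_jac_mulVec (hTd x), jac_id_add_grad hφ] at hvw
    exact Matrix.mulVec_injective_of_isUnit (Matrix.isUnit_transpose _ |>.2 (hinv x)) hvw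
  have hTinj := injective_id_add_grad hφ hconv hD
  obtain ⟨hη, hηc⟩ := contDiff_extend_of_injective hT hTinj hD hξ hξc
  set η := Function.extend (fun x => x + grad φ x) ξ 0
  have hηT : ∀ x, η (x + grad φ x) = ξ x := hTinj.extend_apply ξ 0
  have htrace : ∀ x, (Matrix.transpose ((1 + hess φ x)⁻¹ - 1) * jac ξ x).trace =
      (jac η (x + grad φ x)).trace - (jac ξ x).trace := by
    intro x
    have hξη : jac ξ x = jac η (x + grad φ x) * (1 + hess φ x).transpose := by
      rw [← jac_id_add_grad hφ, ← jac_comp (hη.differentiable (by simp) _) (hTd x)]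
      simp only [hηT]
    have hdet : IsUnit (1 + hess φ x).transpose.det :=
      (Matrix.isUnit_iff_isUnit_det _).1 ((Matrix.isUnit_transpose _).2 (hinv x))
    rw [Matrix.transpose_sub, Matrix.transpose_one, sub_mul, one_mul, Matrix.trace_sub,
      Matrix.trace_mul_comm, Matrix.transpose_nonsing_inv]
    congr 2
    rw [hξη, Matrix.mul_assoc, Matrix.mul_nonsing_inv _ hdet, Matrix.mul_one]
  have hTm : AEMeasurable (fun x => x + grad φ x) ρ := hT.continuous.aemeasurable
  have htrace_int : Integrable (fun x => (jac η (x + grad φ x)).trace) ρ := by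
    refine Integrable.comp_aemeasurable (f := fun x => x + grad φ x)
      (g := fun y => (jac η y).trace) ?_ hTm
    rw [hpush]
    exact integrable_trace_jac hη hηc
  have hsum : ∀ {A : (Fin n → ℝ) → Fin n → ℝ}, Continuous A →
      Integrable (fun x => ∑ i, A x i * ξ x i) ρ := by
    intro A hA
    have := hξ.continuous
    refine integrable_finsetSum _ fun i _ => ?_
    exact Continuous.integrable_of_hasCompactSupport (by fun_prop)
      (hξc.comp_left (g := fun v : Fin n → ℝ => v i) rfl).mul_left
  have hgc := (contDiff_grad hg).continuous
  have hfc := (contDiff_grad hf).continuous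
  have hTc := hT.continuous
  have hηcont := hη.continuous
  have htarget : ∫ x, (∑ i, ((x + grad φ x) i + grad g (x + grad φ x) i) * ξ x i) ∂ρ =
      ∫ x, (jac η (x + grad φ x)).trace ∂ρ := by
    have hibp := integral_sum_add_grad_mul hg hη hηc
    rw [← hν, ← hpush, integral_map hTm, integral_map hTm] at hibp
    · simpa only [hηT] using hibp
    · rw [hpush]
      exact (integrable_trace_jac hη hηc).aestronglyMeasurable
    · exact Continuous.aestronglyMeasurable (by fun_prop)
  have hsource : ∫ x, (∑ i, (x i + grad f x i) * ξ x i) ∂ρ = ∫ x, (jac ξ x).trace ∂ρ := by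
    rw [hρ]
    exact integral_sum_add_grad_mul hf hξ hξc
  simp only [htrace]
  rw [integral_sub htrace_int (integrable_trace_jac hξ hξc), ← htarget, ← hsource, ← integral_sub]
  · congr 1 with x
    rw [← Finset.sum_sub_distrib]
    refine Finset.sum_congr rfl fun i _ => ?_
    rw [Pi.add_apply]
    ring
  · exact hsum (A := fun x => x + grad φ x + grad g (x + grad φ x)) (by fun_prop)
  · exact hsum (A := fun x => x + grad f x) (by fun_prop)
end

section
/- Let c ∈ (0,1) and let f, g : ℝ^n → ℝ be C^∞ functions such that ρ = e^{−f}·β and ν = e^{−g}·β are probability measures, ∫|∇f|² dρ < ∞, ∫|∇g|² dν < ∞, and f is (1−c)-convex, i.e. x ↦ f(x) + ((1−c)/2)|x|² is convex. Let φ, ψ : ℝ^n → ℝ be C^∞ functions such that x ↦ |x|²/2 + φ(x) is convex, I + Hess φ(x) is invertible for every x, the map T = id + ∇φ pushes ρ forward to ν, S = id + ∇ψ satisfies S(T(x)) = x for all x, and ∫|∇φ|² dρ < ∞. Then c·∫ ‖Hess ψ‖_F² dν ≤ 3·( ∫|∇φ|² dρ + ∫|∇g|² dν + ∫|∇f|²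 dρ ), where ‖·‖_F denotes the Frobenius (Hilbert–Schmidt) norm of a matrix. -/
open MeasureTheory Real Filter Topology

/-- A smooth (`C^∞`) map between normed spaces. -/
abbrev Smooth {E F : Type*} [NormedAddCommGroup E] [NormedSpace ℝ E] [NormedAddCommGroup F]
    [NormedSpace ℝ F] (u : E → F) : Prop := ContDiff ℝ (⊤ : ℕ∞) u

/-- The partial derivative `∂ₖF`. -/
noncomputable def partialDeriv {n : ℕ} (k : Fin n) (F : (Fin n → ℝ) → ℝ) (x : Fin n → ℝ) : ℝ :=
  fderiv ℝ F x (Pi.single k 1)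

section PartialDeriv

variable {n : ℕ} {F G : (Fin n → ℝ) → ℝ}

theorem Smooth.differentiableAt {E F : Type*} [NormedAddCommGroup E] [NormedSpace ℝ E]
    [NormedAddCommGroup F] [NormedSpace ℝ F] {u : E → F} (hu : Smooth u) (x : E) :
    DifferentiableAt ℝ u x :=
  (ContDiff.differentiable hu (by simp)) x

theorem Smooth.partialDeriv (hF : Smooth F) (k : Fin n) : Smooth (partialDeriv k F) := by
  unfold _root_.partialDeriv
  have h : Smooth (fderiv ℝ F) := ContDiff.fderiv_right hF (by simp)
  exact ContDiff.clm_apply h contDiff_const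

theorem partialDeriv_const (k : Fin n) (a : ℝ) (x : Fin n → ℝ) :
    partialDeriv k (fun _ => a) x = 0 := by
  simp [partialDeriv]

theorem partialDeriv_coord (k i : Fin n) (x : Fin n → ℝ) :
    partialDeriv k (fun y => y i) x = (1 : Matrix (Fin n) (Fin n) ℝ) i k := by
  have h : HasFDerivAt (fun y : Fin n → ℝ => y i)
    (ContinuousLinearMap.proj i : (Fin n → ℝ) →L[ℝ] ℝ) x := hasFDerivAt_apply i x
  rw [partialDeriv, h.fderiv]
  simp [Pi.single_apply, Matrix.one_apply]

theorem partialDeriv_add (hF : Smooth F) (hG : Smooth G) (k : Fin n) (x : Fin n → ℝ) :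
    partialDeriv k (fun y => F y + G y) x = partialDeriv k F x + partialDeriv k G x := by
  simp only [partialDeriv]
  rw [fderiv_fun_add (hF.differentiableAt x) (hG.differentiableAt x)]
  rfl

theorem partialDeriv_sub (hF : Smooth F) (hG : Smooth G) (k : Fin n) (x : Fin n → ℝ) :
    partialDeriv k (fun y => F y - G y) x = partialDeriv k F x - partialDeriv k G x := by
  simp only [partialDeriv]
  rw [fderiv_fun_sub (hF.differentiableAt x) (hG.differentiableAt x)]
  rfl

theorem partialDeriv_mul (hF : Smooth F) (hG : Smooth G) (k : Fin n) (x : Fin n → ℝ) :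
    partialDeriv k (fun y => F y * G y) x
      = partialDeriv k F x * G x + F x * partialDeriv k G x := by
  simp only [partialDeriv]
  rw [fderiv_fun_mul (hF.differentiableAt x) (hG.differentiableAt x)]
  simp only [add_apply, smul_apply, smul_eq_mul]
  ring

theorem partialDeriv_const_mul (hF : Smooth F) (a : ℝ) (k : Fin n) (x : Fin n → ℝ) :
    partialDeriv k (fun y => a * F y) x = a * partialDeriv k F x := by
  rw [partialDeriv_mul (contDiff_const) hF, partialDeriv_const]
  ring

theorem partialDeriv_sum {ι : Type*} (s : Finset ι) {u : ι → (Fin n → ℝ) → ℝ}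
    (hu : ∀ i ∈ s, Smooth (u i)) (k : Fin n) (x : Fin n → ℝ) :
    partialDeriv k (fun y => ∑ i ∈ s, u i y) x = ∑ i ∈ s, partialDeriv k (u i) x := by
  simp only [partialDeriv]
  rw [fderiv_fun_sum fun i hi => (hu i hi).differentiableAt x]
  simp

theorem partialDeriv_comm (hF : Smooth F) (i j : Fin n) (x : Fin n → ℝ) :
    partialDeriv i (partialDeriv j F) x = partialDeriv j (partialDeriv i F) x := by
  have hsymm : IsSymmSndFDerivAt ℝ F x :=
    ContDiffAt.isSymmSndFDerivAt (n := (⊤ : ℕ∞)) (ContDiff.contDiffAt hF) (by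
      simp only [minSmoothness_of_isRCLikeNormedField]; exact WithTop.coe_le_coe.2 (le_top : (2 : ℕ∞) ≤ ⊤))
  have h : Smooth (fderiv ℝ F) := ContDiff.fderiv_right hF (by simp)
  have key : ∀ a b : Fin n, partialDeriv a (partialDeriv b F) x
      = fderiv ℝ (fderiv ℝ F) x (Pi.single a 1) (Pi.single b 1) := by
    intro a b
    have h1 : HasFDerivAt (fun y => fderiv ℝ F y (Pi.single b 1))
        ((fderiv ℝ (fderiv ℝ F) x).flip (Pi.single b 1)) x := by
      have := (h.differentiableAt x).hasFDerivAt.clm_apply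
        (hasFDerivAt_const (Pi.single b 1 : Fin n → ℝ) x)
      simpa using this
    change fderiv ℝ (fun y => fderiv ℝ F y (Pi.single b 1)) x (Pi.single a 1) = _
    rw [h1.fderiv]
    rfl
  rw [key, key, hsymm.eq]

theorem sum_smul_single (v : Fin n → ℝ) : v = ∑ i, v i • (Pi.single i 1 : Fin n → ℝ) := by
  ext j
  simp [Finset.sum_apply, Pi.single_apply]

theorem fderiv_apply_eq_sum (F : (Fin n → ℝ) → ℝ) (x v : Fin n → ℝ) :
    fderiv ℝ F x v = ∑ i, v i * partialDeriv i F x := by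
  conv_lhs => rw [sum_smul_single v]
  simp [partialDeriv]

theorem partialDeriv_comp {T : (Fin n → ℝ) → Fin n → ℝ} (hF : Smooth F) (hT : Smooth T)
    (k : Fin n) (x : Fin n → ℝ) :
    partialDeriv k (fun y => F (T y)) x
      = ∑ i, partialDeriv i F (T x) * partialDeriv k (fun y => T y i) x := by
  have h1 : fderiv ℝ (fun y => F (T y)) x = (fderiv ℝ F (T x)).comp (fderiv ℝ T x) :=
    fderiv_comp x (hF.differentiableAt _) (hT.differentiableAt _)
  rw [partialDeriv, h1, ContinuousLinearMap.comp_apply, fderiv_apply_eq_sum]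
  refine Finset.sum_congr rfl fun i _ => ?_
  have h2 : HasFDerivAt (fun y => T y i)
      ((ContinuousLinearMap.proj i : (Fin n → ℝ) →L[ℝ] ℝ).comp (fderiv ℝ T x)) x :=
    hasFDerivAt_pi'.1 (hT.differentiableAt x).hasFDerivAt i
  rw [mul_comm]
  congr 1
  rw [partialDeriv, h2.fderiv]
  rfl

theorem HasCompactSupport.partialDeriv (hF : HasCompactSupport F) (k : Fin n) :
    HasCompactSupport (partialDeriv k F) :=
  HasCompactSupport.fderiv_apply (𝕜 := ℝ) hF _

theorem hess_apply (F : (Fin n → ℝ) → ℝ) (x : Fin n → ℝ) (i j : Fin n) :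
    hess F x i j = _root_.partialDeriv i (_root_.partialDeriv j F) x := rfl

theorem grad_apply (F : (Fin n → ℝ) → ℝ) (x : Fin n → ℝ) (i : Fin n) :
    grad F x i = _root_.partialDeriv i F x := rfl

end PartialDeriv

section Score

variable {n : ℕ}

/-- `V` is the score of `ρ`: the field `V` satisfies `∫ ∂ₖF dρ = ∫ F Vₖ dρ` for all smooth
compactly supported test functions `F`. -/
def IsScore (ρ : Measure (Fin n → ℝ)) (V : (Fin n → ℝ) → Fin n → ℝ) : Prop :=
  ∀ (k : Fin n) (F : (Fin n → ℝ) → ℝ), Smooth F → HasCompactSupport F →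
    ∫ x, partialDeriv k F x ∂ρ = ∫ x, F x * V x k ∂ρ

theorem partialDeriv_sq_norm (k : Fin n) (x : Fin n → ℝ) :
    partialDeriv k (fun y => ∑ i, y i ^ 2) x = 2 * x k := by
  have hc : ∀ i : Fin n, Smooth fun y : Fin n → ℝ => y i := fun i => contDiff_apply ℝ ℝ i
  rw [partialDeriv_sum _ fun i _ => (hc i).pow 2]
  have h : ∀ i, partialDeriv k (fun y : Fin n → ℝ => y i ^ 2) x
      = 2 * ((1 : Matrix (Fin n) (Fin n) ℝ) i k * x i) := by
    intro i
    simp only [pow_two]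
    rw [partialDeriv_mul (hc i) (hc i), partialDeriv_coord]
    ring
  simp [h, Matrix.one_apply]

theorem isScore_gibbs {f : (Fin n → ℝ) → ℝ} (hf : Smooth f) :
    IsScore ((stdGaussian n).withDensity fun x => ENNReal.ofReal (Real.exp (-f x)))
      (fun x => x + grad f x) := by
  intro k F hF hFc
  have hc : ∀ i : Fin n, Smooth fun y : Fin n → ℝ => y i := fun i => contDiff_apply ℝ ℝ i
  set C : ℝ := (2 * π) ^ (-(n : ℝ) / 2) with hC
  have hC0 : 0 ≤ C := by positivity
  have hq : Smooth fun x : Fin n → ℝ => ∑ i, x i ^ 2 := ContDiff.sum fun i _ => (hc i).pow 2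
  set E : (Fin n → ℝ) → ℝ := fun x => (-1 / 2) * (∑ i, x i ^ 2) - f x with hE
  have hEs : Smooth E := (contDiff_const.mul hq).sub hf
  set w : (Fin n → ℝ) → ℝ := fun x => C * Real.exp (E x) with hw
  have hws : Smooth w := contDiff_const.mul hEs.exp
  have hwd : ∀ x, partialDeriv k w x = -(w x * (x k + partialDeriv k f x)) := by
    intro x
    have h1 : partialDeriv k (fun y => Real.exp (E y)) x
        = Real.exp (E x) * partialDeriv k E x := by
      simp only [partialDeriv]
      rw [fderiv_exp (hEs.differentiableAt x)]
      simp
    rw [hw, partialDeriv_const_mul hEs.exp, h1, hE,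
      partialDeriv_sub (contDiff_const.mul hq) hf, partialDeriv_const_mul hq,
      partialDeriv_sq_norm]
    ring
  have hmeas : (stdGaussian n).withDensity (fun x => ENNReal.ofReal (Real.exp (-f x)))
      = volume.withDensity fun x => ENNReal.ofReal (w x) := by
    have hm1 : Measurable fun x : Fin n → ℝ =>
        ENNReal.ofReal (C * Real.exp (-(∑ i, x i ^ 2) / 2)) := by fun_prop
    have hm2 : Measurable fun x : Fin n → ℝ => ENNReal.ofReal (Real.exp (-f x)) := by
      have := hf.continuous.measurable
      fun_prop
    rw [stdGaussian, ← withDensity_mul _ hm1 hm2]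
    congr 1
    ext x
    rw [Pi.mul_apply, ← ENNReal.ofReal_mul (by positivity), hw, hE]
    simp only
    rw [mul_assoc, ← Real.exp_add]
    ring_nf
  have hint : ∀ u : (Fin n → ℝ) → ℝ,
      ∫ x, u x ∂(volume.withDensity fun x => ENNReal.ofReal (w x)) = ∫ x, w x * u x := by
    intro u
    rw [integral_withDensity_eq_integral_toReal_smul
      (hws.continuous.measurable.ennreal_ofReal) (by simp)]
    refine integral_congr_ae (Eventually.of_forall fun x => ?_)
    simp only [smul_eq_mul]
    rw [ENNReal.toReal_ofReal (by positivity)]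
  rw [hmeas, hint, hint]
  have hwc := hws.continuous
  have hFcont := hF.continuous
  have hdF := (hF.partialDeriv k).continuous
  have hdw := (hws.partialDeriv k).continuous
  have key := integral_mul_fderiv_eq_neg_fderiv_mul_of_integrable (μ := (volume : Measure (Fin n → ℝ)))
    (f := w) (g := F) (v := Pi.single k 1)
    ((hdw.mul hFcont).integrable_of_hasCompactSupport hFc.mul_left)
    ((hwc.mul hdF).integrable_of_hasCompactSupport (hFc.partialDeriv k).mul_left)
    ((hwc.mul hFcont).integrable_of_hasCompactSupport hFc.mul_left)
    (fun x _ => hws.differentiableAt x) (fun x _ => hF.differentiableAt x)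
  change ∫ x, w x * partialDeriv k F x = - ∫ x, partialDeriv k w x * F x at key
  rw [key, ← integral_neg]
  refine integral_congr_ae (Eventually.of_forall fun x => ?_)
  simp only [hwd, Pi.add_apply, grad_apply]
  ring

theorem ConvexOn.sum_hess_nonneg {q : (Fin n → ℝ) → ℝ} (hq : Smooth q)
    (hconv : ConvexOn ℝ Set.univ q) (x v : Fin n → ℝ) :
    0 ≤ ∑ i, v i * ∑ j, v j * hess q x i j := by
  have hline : ∀ (G : (Fin n → ℝ) → ℝ), Smooth G → ∀ t : ℝ,
      HasDerivAt (fun s : ℝ => G (x + s • v)) (∑ i, v i * partialDeriv i G (x + t • v)) t := by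
    intro G hG t
    rw [← fderiv_apply_eq_sum]
    have h1 : HasDerivAt (fun s : ℝ => x + s • v) v t := by
      simpa using ((hasDerivAt_id t).smul_const v).const_add x
    exact (hG.differentiableAt (x + t • v)).hasFDerivAt.comp_hasDerivAt t h1
  have h1 : ConvexOn ℝ Set.univ fun s : ℝ => q (x + s • v) := by
    have h := hconv.comp_affineMap (AffineMap.lineMap x (x + v))
    refine (by simpa using h : ConvexOn ℝ Set.univ _).congr fun s _ => ?_
    simp [AffineMap.lineMap_apply, add_comm]
  have hmono := h1.monotoneOn_deriv fun t _ => (hline q hq t).differentiableAt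
  have hd : deriv (fun s : ℝ => q (x + s • v))
      = fun t => (fun y => ∑ i, v i * partialDeriv i q y) (x + t • v) :=
    funext fun t => (hline q hq t).deriv
  have hs : Smooth fun y => ∑ i, v i * partialDeriv i q y :=
    ContDiff.sum fun i _ => contDiff_const.mul (hq.partialDeriv i)
  have h2 : 0 ≤ deriv (deriv fun s : ℝ => q (x + s • v)) 0 :=
    (monotoneOn_univ.1 hmono).deriv_nonneg
  rw [hd, (hline _ hs 0).deriv] at h2
  simp only [zero_smul, add_zero] at h2
  refine h2.trans_eq (Finset.sum_congr rfl fun i _ => ?_)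
  congr 1
  rw [partialDeriv_sum _ fun j _ => contDiff_const.mul (hq.partialDeriv j)]
  refine Finset.sum_congr rfl fun j _ => ?_
  rw [partialDeriv_const_mul (hq.partialDeriv j), hess_apply]

end Score

section Limits

variable {n : ℕ}

theorem integrable_of_tendsto_of_integral_le {α : Type*} [MeasurableSpace α] {μ : Measure α}
    {u : ℕ → α → ℝ} {v : α → ℝ} {b : ℕ → ℝ} {L : ℝ} (hu : ∀ m, Integrable (u m) μ)
    (hu0 : ∀ m x, 0 ≤ u m x) (hlim : ∀ x, Tendsto (fun m => u m x) atTop (𝓝 (v x)))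
    (hb : ∀ m, ∫ x, u m x ∂μ ≤ b m) (hbL : Tendsto b atTop (𝓝 L)) :
    Integrable v μ ∧ ∫ x, v x ∂μ ≤ L := by
  have hv0 : ∀ x, 0 ≤ v x := fun x => ge_of_tendsto' (hlim x) fun m => hu0 m x
  have hvm : AEStronglyMeasurable v μ :=
    aestronglyMeasurable_of_tendsto_ae atTop (fun m => (hu m).aestronglyMeasurable)
      (Eventually.of_forall hlim)
  have hfat : ∫⁻ x, ENNReal.ofReal (v x) ∂μ ≤ ENNReal.ofReal L := by
    calc ∫⁻ x, ENNReal.ofReal (v x) ∂μ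
        = ∫⁻ x, liminf (fun m => ENNReal.ofReal (u m x)) atTop ∂μ := by
          refine lintegral_congr fun x => ?_
          exact ((ENNReal.continuous_ofReal.tendsto _).comp (hlim x)).liminf_eq.symm
      _ ≤ liminf (fun m => ∫⁻ x, ENNReal.ofReal (u m x) ∂μ) atTop :=
          lintegral_liminf_le' fun m => (hu m).aestronglyMeasurable.aemeasurable.ennreal_ofReal
      _ ≤ liminf (fun m => ENNReal.ofReal (b m)) atTop := by
          refine liminf_le_liminf (Eventually.of_forall fun m => ?_)
          rw [← ofReal_integral_eq_lintegral_ofReal (hu m) (Eventually.of_forall (hu0 m))]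
          exact ENNReal.ofReal_le_ofReal (hb m)
      _ = ENNReal.ofReal L :=
          ((ENNReal.continuous_ofReal.tendsto _).comp hbL).liminf_eq
  have hL : 0 ≤ L :=
    ge_of_tendsto' hbL fun m => (integral_nonneg (hu0 m)).trans (hb m)
  refine ⟨⟨hvm, ?_⟩, ?_⟩
  · rw [hasFiniteIntegral_iff_ofReal (Eventually.of_forall hv0)]
    exact hfat.trans_lt ENNReal.ofReal_lt_top
  · rw [integral_eq_lintegral_of_nonneg_ae (Eventually.of_forall hv0) hvm]
    exact ENNReal.toReal_le_of_le_ofReal hL hfat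

theorem tendsto_integral_mul_of_eventually_eq_one {α : Type*} [MeasurableSpace α] {μ : Measure α}
    {χ : ℕ → α → ℝ} {v : α → ℝ} (hv : Integrable v μ)
    (hχm : ∀ m, AEStronglyMeasurable (χ m) μ) (hχ : ∀ m x, 0 ≤ χ m x ∧ χ m x ≤ 1)
    (hχ1 : ∀ x, ∀ᶠ m in atTop, χ m x = 1) :
    Tendsto (fun m => ∫ x, χ m x * v x ∂μ) atTop (𝓝 (∫ x, v x ∂μ)) := by
  refine tendsto_integral_of_dominated_convergence (fun x => |v x|)
    (fun m => (hχm m).mul hv.aestronglyMeasurable) hv.abs (fun m => ?_) ?_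
  · refine Eventually.of_forall fun x => ?_
    rw [norm_mul, Real.norm_eq_abs, Real.norm_eq_abs, abs_of_nonneg (hχ m x).1]
    exact mul_le_of_le_one_left (abs_nonneg _) (hχ m x).2
  · refine Eventually.of_forall fun x => ?_
    refine tendsto_const_nhds.congr' ?_
    filter_upwards [hχ1 x] with m hm
    rw [hm, one_mul]

theorem tendsto_mul_of_eventually_eq_one {α : Type*}
    {χ : ℕ → α → ℝ} (hχ1 : ∀ x, ∀ᶠ m in atTop, χ m x = 1) (v : α → ℝ) (x : α) :
    Tendsto (fun m => χ m x * v x) atTop (𝓝 (v x)) := by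
  refine tendsto_const_nhds.congr' ?_
  filter_upwards [hχ1 x] with m hm
  rw [hm, one_mul]

theorem integrable_of_tendsto_integral_mul {α : Type*} [MeasurableSpace α] {μ : Measure α}
    {χ : ℕ → α → ℝ} {v : α → ℝ} {b : ℕ → ℝ} {L : ℝ} (hv0 : ∀ x, 0 ≤ v x)
    (hχm : ∀ m, AEStronglyMeasurable (χ m) μ) (hχ : ∀ m x, 0 ≤ χ m x ∧ χ m x ≤ 1)
    (hχ1 : ∀ x, ∀ᶠ m in atTop, χ m x = 1) (hint : ∀ m, Integrable (fun x => χ m x * v x) μ)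
    (hb : ∀ m, ∫ x, χ m x * v x ∂μ = b m) (hbL : Tendsto b atTop (𝓝 L)) :
    Integrable v μ ∧ ∫ x, v x ∂μ = L := by
  have h := integrable_of_tendsto_of_integral_le hint
    (fun m x => mul_nonneg (hχ m x).1 (hv0 x)) (tendsto_mul_of_eventually_eq_one hχ1 v)
    (fun m => (hb m).le) hbL
  refine ⟨h.1, ?_⟩
  refine tendsto_nhds_unique (tendsto_integral_mul_of_eventually_eq_one h.1 hχm hχ hχ1) ?_
  simpa only [hb] using hbL

/-- A sequence of smooth cutoff functions `χₘ ↑ 1` with gradients of order `1 / m`. -/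
structure IsCutoffSeq (K : ℝ) (χ : ℕ → (Fin n → ℝ) → ℝ) : Prop where
  nonneg_const : 0 ≤ K
  smooth : ∀ m, Smooth (χ m)
  compact : ∀ m, HasCompactSupport (χ m)
  mem_Icc : ∀ m x, 0 ≤ χ m x ∧ χ m x ≤ 1
  eventually_one : ∀ x, ∀ᶠ m in atTop, χ m x = 1
  partialDeriv_le : ∀ m i x, |partialDeriv i (χ m) x| ≤ K / (m + 1)
  radial_le : ∀ m x, |∑ i, partialDeriv i (χ m) x * x i| ≤ K

theorem exists_isCutoffSeq (n : ℕ) :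
    ∃ (K : ℝ) (χ : ℕ → (Fin n → ℝ) → ℝ), IsCutoffSeq K χ := by
  obtain ⟨B⟩ : Nonempty (ContDiffBump (0 : Fin n → ℝ)) := inferInstance
  have hBs : Smooth (fun x => B x) := B.contDiff
  have hBc : HasCompactSupport (fun x => B x) := B.hasCompactSupport
  have hcoord : ∀ i : Fin n, Smooth fun y : Fin n → ℝ => y i := fun i => contDiff_apply ℝ ℝ i
  have h1 : ∀ i : Fin n, ∃ K, ∀ x, ‖partialDeriv i (fun x => B x) x‖ ≤ K := fun i =>
    (hBc.partialDeriv i).exists_bound_of_continuous (hBs.partialDeriv i).continuous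
  choose K hK using h1
  have h2 : ∃ K, ∀ x : Fin n → ℝ, ‖∑ i, partialDeriv i (fun x => B x) x * x i‖ ≤ K := by
    refine HasCompactSupport.exists_bound_of_continuous ?_ ?_
    · refine HasCompactSupport.intro hBc fun x hx => Finset.sum_eq_zero fun i _ => ?_
      have : partialDeriv i (fun x => B x) x = 0 := by
        rw [partialDeriv, image_eq_zero_of_notMem_tsupport
          (fun h => hx (tsupport_fderiv_subset ℝ h))]
        rfl
      rw [this, zero_mul]
    · exact continuous_finsetSum _ fun i _ =>
        ((hBs.partialDeriv i).mul (hcoord i)).continuous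
  obtain ⟨K', hK'⟩ := h2
  have hK0 : ∀ i, 0 ≤ K i := fun i => (norm_nonneg _).trans (hK i 0)
  have hK'0 : 0 ≤ K' := (norm_nonneg _).trans (hK' 0)
  have hKs : ∀ i, K i ≤ ∑ i, K i := fun i =>
    Finset.single_le_sum (fun i _ => hK0 i) (Finset.mem_univ i)
  have hKs0 : 0 ≤ ∑ i, K i := Finset.sum_nonneg fun i _ => hK0 i
  have hscale : ∀ m : ℕ, Smooth fun x : Fin n → ℝ => ((m : ℝ) + 1)⁻¹ • x :=
    fun m => contDiff_id.const_smul _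
  have hderiv : ∀ (m : ℕ) (i : Fin n) (x : Fin n → ℝ),
      partialDeriv i (fun x => B (((m : ℝ) + 1)⁻¹ • x)) x
        = ((m : ℝ) + 1)⁻¹ * partialDeriv i (fun x => B x) (((m : ℝ) + 1)⁻¹ • x) := by
    intro m i x
    rw [partialDeriv_comp (F := fun x => B x) hBs (hscale m)]
    simp only [Pi.smul_apply, smul_eq_mul]
    simp_rw [partialDeriv_const_mul (hcoord _), partialDeriv_coord, Matrix.one_apply]
    simp [mul_comm]
  refine ⟨∑ i, K i + K', fun m x => B (((m : ℝ) + 1)⁻¹ • x), by positivity, fun m => ?_,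
    fun m => ?_, fun m x => ⟨B.nonneg, B.le_one⟩, fun x => ?_, fun m i x => ?_, fun m x => ?_⟩
  · exact hBs.comp (hscale m)
  · have hm : ((m : ℝ) + 1)⁻¹ ≠ 0 := by positivity
    exact hBc.comp_homeomorph (Homeomorph.smulOfNeZero _ hm)
  · have hlim : Tendsto (fun m : ℕ => ((m : ℝ) + 1)⁻¹ • x) atTop (𝓝 0) := by
      have := (tendsto_one_div_add_atTop_nhds_zero_nat (𝕜 := ℝ)).smul_const x
      simpa using this
    exact hlim.eventually B.eventuallyEq_one
  · rw [hderiv, abs_mul, abs_of_nonneg (by positivity : (0 : ℝ) ≤ ((m : ℝ) + 1)⁻¹),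
      mul_comm, div_eq_mul_inv]
    gcongr
    exact (hK i _).trans ((hKs i).trans (by linarith))
  · have : ∑ i, partialDeriv i (fun x => B (((m : ℝ) + 1)⁻¹ • x)) x * x i
        = ∑ i, partialDeriv i (fun x => B x) (((m : ℝ) + 1)⁻¹ • x)
            * (((m : ℝ) + 1)⁻¹ • x) i := by
      refine Finset.sum_congr rfl fun i _ => ?_
      rw [hderiv, Pi.smul_apply, smul_eq_mul]
      ring
    rw [this]
    exact (hK' _).trans (by linarith)

end Limits

section Resolvent

variable {n : ℕ}

/-- The map `x ↦ x + ∇u(x)`. -/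
noncomputable def idAddGrad (u : (Fin n → ℝ) → ℝ) (x : Fin n → ℝ) : Fin n → ℝ :=
  x + grad u x

/-- The matrix `I + Hess u(x)`. -/
noncomputable def idAddHess (u : (Fin n → ℝ) → ℝ) (x : Fin n → ℝ) :
    Matrix (Fin n) (Fin n) ℝ :=
  1 + hess u x

/-- The third derivatives `∂ₖ(I + Hess u)(x)`. -/
noncomputable def thirdDeriv (u : (Fin n → ℝ) → ℝ) (k : Fin n) (x : Fin n → ℝ) :
    Matrix (Fin n) (Fin n) ℝ :=
  Matrix.of fun i j => partialDeriv k (fun y => idAddHess u y i j) x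

/-- The regularized inverse `(δ I + I + Hess u(x))⁻¹`. -/
noncomputable def invHess (δ : ℝ) (u : (Fin n → ℝ) → ℝ) (x : Fin n → ℝ) :
    Matrix (Fin n) (Fin n) ℝ :=
  (δ • 1 + idAddHess u x)⁻¹

variable {u : (Fin n → ℝ) → ℝ}

theorem smooth_coord (i : Fin n) : Smooth fun y : Fin n → ℝ => y i := contDiff_apply ℝ ℝ i

theorem Smooth.idAddGrad_apply (hu : Smooth u) (i : Fin n) :
    Smooth fun x => idAddGrad u x i :=
  (smooth_coord i).add (hu.partialDeriv i)

theorem Smooth.idAddGrad (hu : Smooth u) : Smooth (idAddGrad u) :=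
  contDiff_pi.2 fun i => hu.idAddGrad_apply i

theorem Smooth.idAddHess (hu : Smooth u) (i j : Fin n) :
    Smooth fun x => idAddHess u x i j :=
  contDiff_const.add ((hu.partialDeriv j).partialDeriv i)

theorem idAddHess_symm (hu : Smooth u) (x : Fin n → ℝ) (i j : Fin n) :
    idAddHess u x i j = idAddHess u x j i := by
  simp only [_root_.idAddHess, Matrix.add_apply, hess_apply]
  rw [partialDeriv_comm hu, Matrix.one_apply, Matrix.one_apply]
  simp [eq_comm]

theorem idAddHess_transpose (hu : Smooth u) (x : Fin n → ℝ) :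
    (idAddHess u x).transpose = idAddHess u x :=
  Matrix.ext fun i j => idAddHess_symm hu x j i

theorem partialDeriv_idAddGrad (hu : Smooth u) (k i : Fin n) (x : Fin n → ℝ) :
    partialDeriv k (fun y => idAddGrad u y i) x = idAddHess u x i k := by
  have h : (fun y => idAddGrad u y i) = fun y => y i + partialDeriv i u y := rfl
  rw [h, partialDeriv_add (smooth_coord i) (hu.partialDeriv i), partialDeriv_coord,
    partialDeriv_comm hu]
  rfl

theorem thirdDeriv_apply (hu : Smooth u) (k i j : Fin n) (x : Fin n → ℝ) :
    thirdDeriv u k x i j = partialDeriv k (partialDeriv i (partialDeriv j u)) x := by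
  have h : (fun y => idAddHess u y i j)
      = fun y => (1 : Matrix (Fin n) (Fin n) ℝ) i j + partialDeriv i (partialDeriv j u) y := rfl
  rw [thirdDeriv, Matrix.of_apply, h,
    partialDeriv_add contDiff_const ((hu.partialDeriv j).partialDeriv i), partialDeriv_const,
    zero_add]

theorem thirdDeriv_swap (hu : Smooth u) (k i j : Fin n) (x : Fin n → ℝ) :
    thirdDeriv u k x i j = thirdDeriv u i x k j := by
  rw [thirdDeriv_apply hu, thirdDeriv_apply hu, partialDeriv_comm (hu.partialDeriv j)]

theorem thirdDeriv_symm (hu : Smooth u) (k i j : Fin n) (x : Fin n → ℝ) :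
    thirdDeriv u k x i j = thirdDeriv u k x j i := by
  rw [thirdDeriv, Matrix.of_apply, Matrix.of_apply]
  simp_rw [idAddHess_symm hu _ i j]

theorem Smooth.det {M : (Fin n → ℝ) → Matrix (Fin n) (Fin n) ℝ}
    (hM : ∀ i j, Smooth fun x => M x i j) : Smooth fun x => (M x).det := by
  simp only [Matrix.det_apply']
  exact ContDiff.sum fun σ _ => contDiff_const.mul (contDiff_prod fun i _ => hM _ _)

theorem Smooth.matrix_inv {M : (Fin n → ℝ) → Matrix (Fin n) (Fin n) ℝ}
    (hM : ∀ i j, Smooth fun x => M x i j) (hinv : ∀ x, IsUnit (M x)) (i j : Fin n) :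
    Smooth fun x => (M x)⁻¹ i j := by
  have hdet : ∀ x, (M x).det ≠ 0 := fun x =>
    ((Matrix.isUnit_iff_isUnit_det _).1 (hinv x)).ne_zero
  have hadj : Smooth fun x => (M x).adjugate i j := by
    simp only [Matrix.adjugate_apply]
    refine Smooth.det fun a b => ?_
    by_cases h : a = j
    · subst h
      simpa using (contDiff_const : Smooth fun _ : Fin n → ℝ => (Pi.single i (1 : ℝ) : Fin n → ℝ) b)
    · simpa [Matrix.updateRow_ne h] using hM a b
  have : (fun x => (M x)⁻¹ i j) = fun x => ((M x).det)⁻¹ * (M x).adjugate i j := by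
    ext x
    rw [Matrix.inv_def, Matrix.smul_apply, Ring.inverse_eq_inv', smul_eq_mul]
  rw [this]
  exact ((Smooth.det hM).inv hdet).mul hadj

theorem Smooth.invHess {δ : ℝ} (hu : Smooth u)
    (hinv : ∀ x, IsUnit (δ • 1 + _root_.idAddHess u x)) (i j : Fin n) :
    Smooth fun x => invHess δ u x i j :=
  Smooth.matrix_inv (fun i j => contDiff_const.add (hu.idAddHess i j)) hinv i j

theorem partialDeriv_invHess {δ : ℝ} (hu : Smooth u)
    (hinv : ∀ x, IsUnit (δ • 1 + _root_.idAddHess u x)) (k i j : Fin n) (x : Fin n → ℝ) :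
    partialDeriv k (fun y => invHess δ u y i j) x
      = -(invHess δ u x * thirdDeriv u k x * invHess δ u x) i j := by
  set M : (Fin n → ℝ) → Matrix (Fin n) (Fin n) ℝ := fun x => δ • 1 + idAddHess u x with hM
  have hMs : ∀ i j, Smooth fun y => M y i j := fun i j =>
    contDiff_const.add (hu.idAddHess i j)
  have hdet : ∀ y, IsUnit (M y).det := fun y => (Matrix.isUnit_iff_isUnit_det _).1 (hinv y)
  have hdM : ∀ a b, partialDeriv k (fun y => M y a b) x = thirdDeriv u k x a b := by
    intro a b
    have h : (fun y => M y a b)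
        = fun y => (δ • (1 : Matrix (Fin n) (Fin n) ℝ)) a b + idAddHess u y a b := rfl
    rw [h, partialDeriv_add contDiff_const (hu.idAddHess a b), partialDeriv_const, zero_add]
    rfl
  set D : Matrix (Fin n) (Fin n) ℝ :=
    Matrix.of fun a b => partialDeriv k (fun y => _root_.invHess δ u y a b) x with hD
  have hprod : D * M x = -(_root_.invHess δ u x * thirdDeriv u k x) := by
    ext a b
    have h1 : (fun y => ∑ l, _root_.invHess δ u y a l * M y l b)
        = fun _ => (1 : Matrix (Fin n) (Fin n) ℝ) a b := by
      ext y
      rw [← Matrix.mul_apply, _root_.invHess, Matrix.nonsing_inv_mul _ (hdet y)]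
    have h2 := partialDeriv_const k ((1 : Matrix (Fin n) (Fin n) ℝ) a b) x
    rw [← h1, partialDeriv_sum _ fun l _ => (hu.invHess hinv a l).mul (hMs l b)] at h2
    simp_rw [partialDeriv_mul (hu.invHess hinv a _) (hMs _ b), hdM] at h2
    rw [Finset.sum_add_distrib] at h2
    rw [Matrix.mul_apply, Matrix.neg_apply, Matrix.mul_apply]
    simp only [hD, Matrix.of_apply]
    linarith
  have : D = -(_root_.invHess δ u x * thirdDeriv u k x * _root_.invHess δ u x) := by
    calc D = D * M x * (M x)⁻¹ := by rw [Matrix.mul_assoc, Matrix.mul_nonsing_inv _ (hdet x), mul_one]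
      _ = _ := by rw [hprod, Matrix.neg_mul]; rfl
  exact congrFun (congrFun this i) j

end Resolvent

section MongeMap

variable {n : ℕ}

/-- The analytic data of the problem: `id + ∇φ` transports `ρ` to `ν`, with smooth left inverse
`id + ∇ψ`, and `I + ∇f`, `I + ∇g` are the scores of `ρ`, `ν`. -/
structure MongeMap (c : ℝ) (f g φ ψ : (Fin n → ℝ) → ℝ) (ρ ν : Measure (Fin n → ℝ)) : Prop where
  pos : 0 < c
  smooth_f : Smooth f
  smooth_g : Smooth g
  smooth_φ : Smooth φ
  smooth_ψ : Smooth ψ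
  prob : IsProbabilityMeasure ρ
  score_ρ : IsScore ρ (idAddGrad f)
  score_ν : IsScore ν (idAddGrad g)
  map_eq : Measure.map (idAddGrad φ) ρ = ν
  left_inv : ∀ x, idAddGrad ψ (idAddGrad φ x) = x
  hess_f : ∀ x, (idAddHess f x - c • 1).PosSemidef
  hess_φ : ∀ x, (idAddHess φ x).PosDef
  grad_f : Integrable (fun x => ∑ i, grad f x i ^ 2) ρ
  grad_g : Integrable (fun x => ∑ i, grad g (idAddGrad φ x) i ^ 2) ρ
  grad_φ : Integrable (fun x => ∑ i, grad φ x i ^ 2) ρ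

namespace MongeMap

variable {c : ℝ} {f g φ ψ : (Fin n → ℝ) → ℝ} {ρ ν : Measure (Fin n → ℝ)}

theorem posDef_smul_add (D : MongeMap c f g φ ψ ρ ν) {δ : ℝ} (hδ : 0 ≤ δ) (x : Fin n → ℝ) :
    (δ • 1 + idAddHess φ x).PosDef :=
  Matrix.PosDef.posSemidef_add (Matrix.PosSemidef.one.smul hδ) (D.hess_φ x)

theorem isUnit_smul_add (D : MongeMap c f g φ ψ ρ ν) {δ : ℝ} (hδ : 0 ≤ δ) (x : Fin n → ℝ) :
    IsUnit (δ • 1 + idAddHess φ x) :=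
  (D.posDef_smul_add hδ x).isUnit

theorem smooth_invHess (D : MongeMap c f g φ ψ ρ ν) {δ : ℝ} (hδ : 0 ≤ δ) (i j : Fin n) :
    Smooth fun x => invHess δ φ x i j :=
  D.smooth_φ.invHess (D.isUnit_smul_add hδ) i j

theorem hess_ψ (D : MongeMap c f g φ ψ ρ ν) (x : Fin n → ℝ) :
    idAddHess ψ (idAddGrad φ x) = invHess 0 φ x := by
  have hT := D.smooth_φ.idAddGrad
  have h : idAddHess ψ (idAddGrad φ x) * idAddHess φ x = 1 := by
    ext i k
    have h1 := partialDeriv_comp (D.smooth_ψ.idAddGrad_apply i) hT k x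
    simp only [D.left_inv, partialDeriv_coord, partialDeriv_idAddGrad D.smooth_ψ,
      partialDeriv_idAddGrad D.smooth_φ] at h1
    rw [h1, Matrix.mul_apply]
  rw [invHess, zero_smul, zero_add]
  exact (Matrix.inv_eq_left_inv h).symm

theorem eq_zero_off_image (D : MongeMap c f g φ ψ ρ ν) {κ : (Fin n → ℝ) → ℝ} {x : Fin n → ℝ}
    (hx : x ∉ idAddGrad ψ '' tsupport κ) :
    idAddGrad φ x ∉ tsupport κ := fun h => hx ⟨_, h, D.left_inv x⟩

theorem hasCompactSupport_comp (D : MongeMap c f g φ ψ ρ ν) {κ : (Fin n → ℝ) → ℝ}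
    (hκ : HasCompactSupport κ) : HasCompactSupport fun x => κ (idAddGrad φ x) :=
  HasCompactSupport.intro (hκ.image D.smooth_ψ.idAddGrad.continuous) fun _ hx =>
    image_eq_zero_of_notMem_tsupport (D.eq_zero_off_image hx)

theorem integral_score_comp (D : MongeMap c f g φ ψ ρ ν) {κ : (Fin n → ℝ) → ℝ}
    (hκ : Smooth κ) (hκc : HasCompactSupport κ) {Z : (Fin n → ℝ) → ℝ} (hZ : Smooth Z)
    (i : Fin n) :
    ∫ x, κ (idAddGrad φ x) * idAddGrad g (idAddGrad φ x) i * Z x ∂ρ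
      = ∫ x, (partialDeriv i κ (idAddGrad φ x) * Z x
          + κ (idAddGrad φ x) * ∑ k, partialDeriv k Z x * invHess 0 φ x k i) ∂ρ := by
  have hS := D.smooth_ψ.idAddGrad
  have hT := D.smooth_φ.idAddGrad
  have hZS : Smooth fun y => Z (idAddGrad ψ y) := hZ.comp hS
  have hF : Smooth fun y => κ y * Z (idAddGrad ψ y) := hκ.mul hZS
  have hmap : ∀ u : (Fin n → ℝ) → ℝ, Continuous u →
      ∫ y, u y ∂ν = ∫ x, u (idAddGrad φ x) ∂ρ := by
    intro u hu
    rw [← D.map_eq, integral_map hT.continuous.measurable.aemeasurable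
      hu.aestronglyMeasurable]
  have h := D.score_ν i _ hF hκc.mul_right
  rw [hmap _ (hF.partialDeriv i).continuous,
    hmap _ (hF.mul (D.smooth_g.idAddGrad_apply i)).continuous] at h
  simp only [D.left_inv] at h
  calc _ = ∫ x, κ (idAddGrad φ x) * Z x * idAddGrad g (idAddGrad φ x) i ∂ρ :=
        integral_congr_ae (Eventually.of_forall fun x => by ring)
    _ = _ := h.symm
    _ = _ := by
        refine integral_congr_ae (Eventually.of_forall fun x => ?_)
        simp only
        rw [partialDeriv_mul hκ hZS, partialDeriv_comp hZ hS]
        simp only [D.left_inv, partialDeriv_idAddGrad D.smooth_ψ, D.hess_ψ]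

end MongeMap

end MongeMap

theorem Matrix.PosSemidef.trace_mul_nonneg {n : ℕ} {A B : Matrix (Fin n) (Fin n) ℝ}
    (hA : A.PosSemidef) (hB : B.PosSemidef) : 0 ≤ (A * B).trace := by
  obtain ⟨m, v, rfl⟩ := Matrix.posSemidef_iff_eq_sum_vecMulVec.1 hB
  rw [Matrix.mul_sum, Matrix.trace_sum]
  refine Finset.sum_nonneg fun i _ => ?_
  rw [Matrix.mul_vecMulVec, Matrix.trace_vecMulVec, dotProduct_comm]
  exact hA.dotProduct_mulVec_nonneg _

theorem tendsto_integral_of_abs_le {α : Type*} [MeasurableSpace α] {μ : Measure α}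
    {v : ℕ → α → ℝ} {w : α → ℝ} {K : ℝ} (hw : Integrable w μ)
    (hv : ∀ m x, |v m x| ≤ K / (m + 1) * w x) :
    Tendsto (fun m => ∫ x, v m x ∂μ) atTop (𝓝 0) := by
  have hlim : Tendsto (fun m : ℕ => K / ((m : ℝ) + 1) * ∫ x, w x ∂μ) atTop (𝓝 0) := by
    have h := (tendsto_one_div_add_atTop_nhds_zero_nat (𝕜 := ℝ)).const_mul K
    have h' := h.mul_const (∫ x, w x ∂μ)
    simpa [div_eq_mul_inv] using h'
  refine squeeze_zero_norm (fun m => ?_) hlim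
  rw [← integral_const_mul]
  exact norm_integral_le_of_norm_le (hw.const_mul _) (Eventually.of_forall (hv m))

namespace MongeMap

variable {n : ℕ} {c : ℝ} {f g φ ψ : (Fin n → ℝ) → ℝ} {ρ ν : Measure (Fin n → ℝ)}

theorem integrable (D : MongeMap c f g φ ψ ρ ν) {u : (Fin n → ℝ) → ℝ} (hu : Continuous u)
    (hc : HasCompactSupport u) : Integrable u ρ :=
  have := D.prob
  hu.integrable_of_hasCompactSupport hc

theorem integral_divergence (D : MongeMap c f g φ ψ ρ ν) {Z : Fin n → (Fin n → ℝ) → ℝ}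
    (hZ : ∀ k, Smooth (Z k)) (hZc : ∀ k, HasCompactSupport (Z k)) :
    ∫ x, ∑ k, partialDeriv k (Z k) x ∂ρ = ∫ x, ∑ k, Z k x * idAddGrad f x k ∂ρ := by
  rw [integral_finsetSum _ fun k _ =>
      D.integrable ((hZ k).partialDeriv k).continuous ((hZc k).partialDeriv k),
    integral_finsetSum _ fun k _ =>
      D.integrable ((hZ k).mul (D.smooth_f.idAddGrad_apply k)).continuous (hZc k).mul_right]
  exact Finset.sum_congr rfl fun k _ => D.score_ρ k _ (hZ k) (hZc k)

theorem integral_score_comp_sum (D : MongeMap c f g φ ψ ρ ν) {κ : (Fin n → ℝ) → ℝ}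
    (hκ : Smooth κ) (hκc : HasCompactSupport κ) {Z : Fin n → (Fin n → ℝ) → ℝ}
    (hZ : ∀ i, Smooth (Z i)) :
    ∫ x, ∑ i, κ (idAddGrad φ x) * idAddGrad g (idAddGrad φ x) i * Z i x ∂ρ
      = ∫ x, (∑ i, partialDeriv i κ (idAddGrad φ x) * Z i x
          + κ (idAddGrad φ x) * ∑ i, ∑ k, partialDeriv k (Z i) x * invHess 0 φ x k i) ∂ρ := by
  have hT := D.smooth_φ.idAddGrad
  have hκT : Smooth fun x => κ (idAddGrad φ x) := hκ.comp hT
  have hκTc := D.hasCompactSupport_comp hκc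
  have hW : ∀ i, Smooth fun x => idAddGrad g (idAddGrad φ x) i := fun i =>
    (D.smooth_g.idAddGrad_apply i).comp hT
  have h1 : ∀ i, Integrable (fun x =>
      κ (idAddGrad φ x) * idAddGrad g (idAddGrad φ x) i * Z i x) ρ := fun i =>
    D.integrable ((hκT.mul (hW i)).mul (hZ i)).continuous hκTc.mul_right.mul_right
  have h2 : ∀ i, Integrable (fun x => partialDeriv i κ (idAddGrad φ x) * Z i x
      + κ (idAddGrad φ x) * ∑ k, partialDeriv k (Z i) x * invHess 0 φ x k i) ρ := fun i =>
    (D.integrable (((hκ.partialDeriv i).comp hT).mul (hZ i)).continuous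
      (D.hasCompactSupport_comp (hκc.partialDeriv i)).mul_right).add
    (D.integrable (hκT.mul (ContDiff.sum fun k _ => ((hZ i).partialDeriv k).mul
      (D.smooth_invHess le_rfl k i))).continuous hκTc.mul_right)
  calc _ = ∑ i, ∫ x, κ (idAddGrad φ x) * idAddGrad g (idAddGrad φ x) i * Z i x ∂ρ :=
        integral_finsetSum _ fun i _ => h1 i
    _ = ∑ i, ∫ x, (partialDeriv i κ (idAddGrad φ x) * Z i x
          + κ (idAddGrad φ x) * ∑ k, partialDeriv k (Z i) x * invHess 0 φ x k i) ∂ρ :=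
        Finset.sum_congr rfl fun i _ => D.integral_score_comp hκ hκc (hZ i) i
    _ = ∫ x, ∑ i, (partialDeriv i κ (idAddGrad φ x) * Z i x
          + κ (idAddGrad φ x) * ∑ k, partialDeriv k (Z i) x * invHess 0 φ x k i) ∂ρ :=
        (integral_finsetSum _ fun i _ => h2 i).symm
    _ = _ := by
        refine integral_congr_ae (Eventually.of_forall fun x => ?_)
        simp only
        rw [Finset.sum_add_distrib, ← Finset.mul_sum]

theorem memLp_of_sum_sq {u : (Fin n → ℝ) → Fin n → ℝ} (hu : ∀ i, Continuous fun x => u x i)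
    (h : Integrable (fun x => ∑ i, u x i ^ 2) ρ) (i : Fin n) :
    MemLp (fun x => u x i) 2 ρ := by
  rw [memLp_two_iff_integrable_sq (hu i).aestronglyMeasurable]
  refine h.mono' ((hu i).pow 2).aestronglyMeasurable (Eventually.of_forall fun x => ?_)
  rw [Real.norm_of_nonneg (sq_nonneg _)]
  exact Finset.single_le_sum (f := fun i => u x i ^ 2) (fun i _ => sq_nonneg _)
    (Finset.mem_univ i)

theorem memLp_coord (D : MongeMap c f g φ ψ ρ ν) (i : Fin n) :
    MemLp (fun x => x i) 2 ρ := by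
  obtain ⟨K, χ, hχ⟩ := exists_isCutoffSeq n
  have := D.prob
  refine memLp_of_sum_sq (u := fun x => x) (fun i => continuous_apply i) ?_ i
  have hsq : Smooth fun x : Fin n → ℝ => ∑ i, x i ^ 2 :=
    ContDiff.sum fun i _ => (smooth_coord i).pow 2
  have hint : ∀ m, Integrable (fun x => χ m x * ∑ i, x i ^ 2) ρ := fun m =>
    D.integrable ((hχ.smooth m).mul hsq).continuous (hχ.compact m).mul_right
  refine (integrable_of_tendsto_of_integral_le (L := 2 * (n + K) + ∫ x, ∑ i, grad f x i ^ 2 ∂ρ)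
    hint (fun m x => mul_nonneg (hχ.mem_Icc m x).1 (Finset.sum_nonneg fun i _ => sq_nonneg _))
    (tendsto_mul_of_eventually_eq_one hχ.eventually_one _) (fun m => ?_)
    tendsto_const_nhds).1
  have hZ : ∀ k, Smooth fun x => χ m x * x k := fun k => (hχ.smooth m).mul (smooth_coord k)
  have hZc : ∀ k : Fin n, HasCompactSupport fun x => χ m x * x k := fun k =>
    (hχ.compact m).mul_right
  have hdiv := D.integral_divergence hZ hZc
  have h1 : ∫ x, ∑ k, partialDeriv k (fun x => χ m x * x k) x ∂ρ ≤ n + K := by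
    have : ∫ x, ∑ k, partialDeriv k (fun x => χ m x * x k) x ∂ρ ≤ ∫ _, (n + K : ℝ) ∂ρ := by
      refine integral_mono (integrable_finsetSum _ fun k _ =>
        D.integrable ((hZ k).partialDeriv k).continuous ((hZc k).partialDeriv k))
        (integrable_const _) fun x => ?_
      simp_rw [partialDeriv_mul (hχ.smooth m) (smooth_coord _), partialDeriv_coord,
        Matrix.one_apply_eq]
      rw [Finset.sum_add_distrib, add_comm]
      refine add_le_add ?_ ((le_abs_self _).trans (hχ.radial_le m x))
      simpa using mul_le_of_le_one_right (Nat.cast_nonneg n) (hχ.mem_Icc m x).2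
    simpa using this
  have h2 : ∫ x, χ m x * ∑ i, x i ^ 2 ∂ρ
      ≤ ∫ x, (2 * ∑ k, χ m x * x k * idAddGrad f x k + ∑ i, grad f x i ^ 2) ∂ρ := by
    have hi : Integrable (fun x => 2 * ∑ k, χ m x * x k * idAddGrad f x k) ρ :=
      (integrable_finsetSum _ fun k _ =>
        D.integrable ((hZ k).mul (D.smooth_f.idAddGrad_apply k)).continuous
          (hZc k).mul_right).const_mul 2
    refine integral_mono (hint m) (hi.add D.grad_f) fun x => ?_
    have hx := hχ.mem_Icc m x
    simp only [Finset.mul_sum]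
    rw [← Finset.sum_add_distrib]
    refine Finset.sum_le_sum fun k _ => ?_
    simp only [idAddGrad, Pi.add_apply]
    nlinarith [mul_nonneg hx.1 (sq_nonneg (x k + grad f x k)),
      mul_nonneg (sub_nonneg.2 hx.2) (sq_nonneg (grad f x k))]
  have h3 : ∫ x, (2 * ∑ k, χ m x * x k * idAddGrad f x k + ∑ i, grad f x i ^ 2) ∂ρ
      = 2 * ∫ x, ∑ k, χ m x * x k * idAddGrad f x k ∂ρ + ∫ x, ∑ i, grad f x i ^ 2 ∂ρ := by
    rw [integral_add ((integrable_finsetSum _ fun k _ =>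
        D.integrable ((hZ k).mul (D.smooth_f.idAddGrad_apply k)).continuous
          (hZc k).mul_right).const_mul 2) D.grad_f, integral_const_mul]
  rw [h3, ← hdiv] at h2
  linarith

theorem memLp_idAddGrad_f (D : MongeMap c f g φ ψ ρ ν) (i : Fin n) :
    MemLp (fun x => idAddGrad f x i) 2 ρ :=
  (D.memLp_coord i).add
    (memLp_of_sum_sq (fun i => (D.smooth_f.partialDeriv i).continuous) D.grad_f i)

theorem memLp_idAddGrad_φ (D : MongeMap c f g φ ψ ρ ν) (i : Fin n) :
    MemLp (fun x => idAddGrad φ x i) 2 ρ :=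
  (D.memLp_coord i).add
    (memLp_of_sum_sq (fun i => (D.smooth_φ.partialDeriv i).continuous) D.grad_φ i)

theorem memLp_idAddGrad_g (D : MongeMap c f g φ ψ ρ ν) (i : Fin n) :
    MemLp (fun x => idAddGrad g (idAddGrad φ x) i) 2 ρ :=
  (D.memLp_idAddGrad_φ i).add
    (memLp_of_sum_sq (u := fun x => grad g (idAddGrad φ x))
      (fun i => ((D.smooth_g.partialDeriv i).continuous.comp
        D.smooth_φ.idAddGrad.continuous)) D.grad_g i)

theorem integrable_trace_hess_φ (D : MongeMap c f g φ ψ ρ ν) :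
    Integrable (fun x => (idAddHess φ x).trace) ρ := by
  obtain ⟨K, χ, hχ⟩ := exists_isCutoffSeq n
  have := D.prob
  have hT := D.smooth_φ.idAddGrad_apply
  have hV := D.smooth_f.idAddGrad_apply
  have htr : Smooth fun x => (idAddHess φ x).trace :=
    ContDiff.sum fun i _ => D.smooth_φ.idAddHess i i
  have hint : ∀ m, Integrable (fun x => χ m x * (idAddHess φ x).trace) ρ := fun m =>
    D.integrable ((hχ.smooth m).mul htr).continuous (hχ.compact m).mul_right
  have hTV : ∀ k, Integrable (fun x => idAddGrad φ x k * idAddGrad f x k) ρ := fun k =>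
    (D.memLp_idAddGrad_φ k).integrable_mul (D.memLp_idAddGrad_f k)
  have hT1 : ∀ k, Integrable (fun x => idAddGrad φ x k) ρ := fun k =>
    (D.memLp_idAddGrad_φ k).integrable (by norm_num)
  have hB : Integrable (fun x => ∑ k, (|idAddGrad φ x k * idAddGrad f x k|
      + K * |idAddGrad φ x k|)) ρ :=
    integrable_finsetSum _ fun k _ => (hTV k).abs.add ((hT1 k).abs.const_mul K)
  refine (integrable_of_tendsto_of_integral_le hint
    (fun m x => mul_nonneg (hχ.mem_Icc m x).1 (D.hess_φ x).posSemidef.trace_nonneg)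
    (tendsto_mul_of_eventually_eq_one hχ.eventually_one _) (fun m => ?_)
    (tendsto_const_nhds (x := ∫ x, ∑ k, (|idAddGrad φ x k * idAddGrad f x k|
      + K * |idAddGrad φ x k|) ∂ρ))).1
  have hZ : ∀ k, Smooth fun x => χ m x * idAddGrad φ x k := fun k => (hχ.smooth m).mul (hT k)
  have hZc : ∀ k : Fin n, HasCompactSupport fun x => χ m x * idAddGrad φ x k := fun k =>
    (hχ.compact m).mul_right
  have hdiv := D.integral_divergence hZ hZc
  have hi1 : Integrable (fun x => ∑ k, χ m x * idAddGrad φ x k * idAddGrad f x k) ρ :=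
    integrable_finsetSum _ fun k _ => D.integrable ((hZ k).mul (hV k)).continuous
      (hZc k).mul_right
  have hi2 : Integrable (fun x => ∑ k, partialDeriv k (χ m) x * idAddGrad φ x k) ρ :=
    integrable_finsetSum _ fun k _ => D.integrable
      (((hχ.smooth m).partialDeriv k).mul (hT k)).continuous
      ((hχ.compact m).partialDeriv k).mul_right
  have hexp : ∀ x, ∑ k, partialDeriv k (fun x => χ m x * idAddGrad φ x k) x
      = ∑ k, partialDeriv k (χ m) x * idAddGrad φ x k + χ m x * (idAddHess φ x).trace := by
    intro x
    simp_rw [partialDeriv_mul (hχ.smooth m) (hT _), partialDeriv_idAddGrad D.smooth_φ]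
    rw [Finset.sum_add_distrib, Matrix.trace, Finset.mul_sum]
    rfl
  simp_rw [hexp] at hdiv
  rw [integral_add hi2 (hint m)] at hdiv
  have : ∫ x, χ m x * (idAddHess φ x).trace ∂ρ
      = ∫ x, (∑ k, χ m x * idAddGrad φ x k * idAddGrad f x k
          - ∑ k, partialDeriv k (χ m) x * idAddGrad φ x k) ∂ρ := by
    rw [integral_sub hi1 hi2]
    linarith
  rw [this]
  refine integral_mono (hi1.sub hi2) hB fun x => ?_
  simp only
  rw [← Finset.sum_sub_distrib]
  refine Finset.sum_le_sum fun k _ => ?_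
  have hx := hχ.mem_Icc m x
  have h1 : χ m x * idAddGrad φ x k * idAddGrad f x k
      ≤ |idAddGrad φ x k * idAddGrad f x k| := by
    rw [mul_assoc]
    refine (le_abs_self _).trans ?_
    rw [abs_mul, abs_of_nonneg hx.1]
    exact mul_le_of_le_one_left (abs_nonneg _) hx.2
  have h2 : -(partialDeriv k (χ m) x * idAddGrad φ x k) ≤ K * |idAddGrad φ x k| := by
    refine (neg_le_abs _).trans ?_
    rw [abs_mul]
    refine mul_le_mul_of_nonneg_right ((hχ.partialDeriv_le m k x).trans ?_) (abs_nonneg _)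
    exact div_le_self hχ.nonneg_const (by linarith [(Nat.cast_nonneg m : (0 : ℝ) ≤ m)])
  linarith

theorem integral_trace_hess_f (D : MongeMap c f g φ ψ ρ ν) :
    Integrable (fun x => (idAddHess f x).trace) ρ ∧
      ∫ x, (idAddHess f x).trace ∂ρ = ∫ x, ∑ k, idAddGrad f x k ^ 2 ∂ρ := by
  obtain ⟨K, χ, hχ⟩ := exists_isCutoffSeq n
  have := D.prob
  have hV := D.smooth_f.idAddGrad_apply
  have htr : Smooth fun x => (idAddHess f x).trace :=
    ContDiff.sum fun i _ => D.smooth_f.idAddHess i i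
  have hint : ∀ m, Integrable (fun x => χ m x * (idAddHess f x).trace) ρ := fun m =>
    D.integrable ((hχ.smooth m).mul htr).continuous (hχ.compact m).mul_right
  have hV1 : ∀ k, Integrable (fun x => idAddGrad f x k) ρ := fun k =>
    (D.memLp_idAddGrad_f k).integrable (by norm_num)
  have hV2 : Integrable (fun x => ∑ k, idAddGrad f x k ^ 2) ρ :=
    integrable_finsetSum _ fun k _ => (D.memLp_idAddGrad_f k).integrable_sq
  have hpsd : ∀ x, (idAddHess f x).PosSemidef := fun x => by
    simpa using (D.hess_f x).add (Matrix.PosSemidef.one.smul D.pos.le)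
  have hi2 : ∀ m, Integrable (fun x => ∑ k, partialDeriv k (χ m) x * idAddGrad f x k) ρ :=
    fun m => integrable_finsetSum _ fun k _ => D.integrable
      (((hχ.smooth m).partialDeriv k).mul (hV k)).continuous
      ((hχ.compact m).partialDeriv k).mul_right
  have hi1 : ∀ m, Integrable (fun x => χ m x * ∑ k, idAddGrad f x k ^ 2) ρ := fun m =>
    D.integrable ((hχ.smooth m).mul (ContDiff.sum fun k _ => (hV k).pow 2)).continuous
      (hχ.compact m).mul_right
  have hlim1 := tendsto_integral_mul_of_eventually_eq_one hV2
    (fun m => (hχ.smooth m).continuous.aestronglyMeasurable) hχ.mem_Icc hχ.eventually_one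
  have hlim2 := tendsto_integral_of_abs_le (K := K)
    (v := fun m x => ∑ k, partialDeriv k (χ m) x * idAddGrad f x k)
    (integrable_finsetSum Finset.univ fun k _ => (hV1 k).abs) (fun m x => by
      rw [Finset.mul_sum]
      refine (Finset.abs_sum_le_sum_abs _ _).trans (Finset.sum_le_sum fun k _ => ?_)
      rw [abs_mul]
      exact mul_le_mul_of_nonneg_right (hχ.partialDeriv_le m k x) (abs_nonneg _))
  refine integrable_of_tendsto_integral_mul (fun x => (hpsd x).trace_nonneg)
    (fun m => (hχ.smooth m).continuous.aestronglyMeasurable) hχ.mem_Icc hχ.eventually_one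
    hint (fun m => ?_) (by simpa using hlim1.sub hlim2)
  have hZ : ∀ k, Smooth fun x => χ m x * idAddGrad f x k := fun k => (hχ.smooth m).mul (hV k)
  have hZc : ∀ k : Fin n, HasCompactSupport fun x => χ m x * idAddGrad f x k := fun k =>
    (hχ.compact m).mul_right
  have hdiv := D.integral_divergence hZ hZc
  have hexp : ∀ x, ∑ k, partialDeriv k (fun x => χ m x * idAddGrad f x k) x
      = ∑ k, partialDeriv k (χ m) x * idAddGrad f x k + χ m x * (idAddHess f x).trace := by
    intro x
    simp_rw [partialDeriv_mul (hχ.smooth m) (hV _), partialDeriv_idAddGrad D.smooth_f]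
    rw [Finset.sum_add_distrib, Matrix.trace, Finset.mul_sum]
    rfl
  have hexp2 : ∀ x, ∑ k, χ m x * idAddGrad f x k * idAddGrad f x k
      = χ m x * ∑ k, idAddGrad f x k ^ 2 := fun x => by
    rw [Finset.mul_sum]
    exact Finset.sum_congr rfl fun k _ => by ring
  simp_rw [hexp, hexp2] at hdiv
  rw [integral_add (hi2 m) (hint m)] at hdiv
  linarith

theorem integral_trace_hess_f_mul_inv (D : MongeMap c f g φ ψ ρ ν) :
    Integrable (fun x => (idAddHess f x * invHess 0 φ x).trace) ρ ∧
      ∫ x, (idAddHess f x * invHess 0 φ x).trace ∂ρ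
        = ∫ x, ∑ k, idAddGrad g (idAddGrad φ x) k * idAddGrad f x k ∂ρ := by
  obtain ⟨K, χ, hχ⟩ := exists_isCutoffSeq n
  have := D.prob
  have hTs := D.smooth_φ.idAddGrad
  have hV := D.smooth_f.idAddGrad_apply
  have hW : ∀ k, Smooth fun x => idAddGrad g (idAddGrad φ x) k := fun k =>
    (D.smooth_g.idAddGrad_apply k).comp hTs
  have hχT : ∀ m, Smooth fun x => χ m (idAddGrad φ x) := fun m => (hχ.smooth m).comp hTs
  have hχTd : ∀ m k, Smooth fun x => partialDeriv k (χ m) (idAddGrad φ x) := fun m k =>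
    ((hχ.smooth m).partialDeriv k).comp hTs
  have hχTc : ∀ m, HasCompactSupport fun x => χ m (idAddGrad φ x) := fun m =>
    D.hasCompactSupport_comp (hχ.compact m)
  have hP := D.smooth_invHess le_rfl
  have htr : Smooth fun x => (idAddHess f x * invHess 0 φ x).trace := by
    simp only [Matrix.trace, Matrix.diag, Matrix.mul_apply]
    exact ContDiff.sum fun i _ => ContDiff.sum fun j _ =>
      (D.smooth_f.idAddHess i j).mul (hP j i)
  have hint : ∀ m, Integrable (fun x => χ m (idAddGrad φ x)
      * (idAddHess f x * invHess 0 φ x).trace) ρ := fun m =>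
    D.integrable ((hχT m).mul htr).continuous (hχTc m).mul_right
  have hV1 : ∀ k, Integrable (fun x => idAddGrad f x k) ρ := fun k =>
    (D.memLp_idAddGrad_f k).integrable (by norm_num)
  have hWV : Integrable (fun x => ∑ k, idAddGrad g (idAddGrad φ x) k * idAddGrad f x k) ρ :=
    integrable_finsetSum _ fun k _ => (D.memLp_idAddGrad_g k).integrable_mul
      (D.memLp_idAddGrad_f k)
  have hpsd : ∀ x, (idAddHess f x).PosSemidef := fun x => by
    simpa using (D.hess_f x).add (Matrix.PosSemidef.one.smul D.pos.le)
  have hi2 : ∀ m k, Integrable (fun x => partialDeriv k (χ m) (idAddGrad φ x)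
      * idAddGrad f x k) ρ := fun m k => D.integrable
      ((hχTd m k).mul (hV k)).continuous
      (D.hasCompactSupport_comp ((hχ.compact m).partialDeriv k)).mul_right
  have hlim1 := tendsto_integral_mul_of_eventually_eq_one hWV
    (fun m => (hχT m).continuous.aestronglyMeasurable) (fun m x => hχ.mem_Icc m _)
    (fun x => hχ.eventually_one _)
  have hlim2 := tendsto_integral_of_abs_le (K := K)
    (v := fun m x => ∑ k, partialDeriv k (χ m) (idAddGrad φ x) * idAddGrad f x k)
    (integrable_finsetSum Finset.univ fun k _ => (hV1 k).abs) (fun m x => by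
      rw [Finset.mul_sum]
      refine (Finset.abs_sum_le_sum_abs _ _).trans (Finset.sum_le_sum fun k _ => ?_)
      rw [abs_mul]
      exact mul_le_mul_of_nonneg_right (hχ.partialDeriv_le m k _) (abs_nonneg _))
  refine integrable_of_tendsto_integral_mul
    (fun x => (hpsd x).trace_mul_nonneg (D.posDef_smul_add le_rfl x).inv.posSemidef)
    (fun m => (hχT m).continuous.aestronglyMeasurable) (fun m x => hχ.mem_Icc m _)
    (fun x => hχ.eventually_one _) hint (fun m => ?_) (by simpa using hlim1.sub hlim2)
  have hsum := D.integral_score_comp_sum (hχ.smooth m) (hχ.compact m) hV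
  have e1 : ∀ x, ∑ k, χ m (idAddGrad φ x) * idAddGrad g (idAddGrad φ x) k * idAddGrad f x k
      = χ m (idAddGrad φ x) * ∑ k, idAddGrad g (idAddGrad φ x) k * idAddGrad f x k := fun x => by
    rw [Finset.mul_sum]
    exact Finset.sum_congr rfl fun k _ => by ring
  have e2 : ∀ x, ∑ k, ∑ l, partialDeriv l (fun x => idAddGrad f x k) x * invHess 0 φ x l k
      = (idAddHess f x * invHess 0 φ x).trace := fun x => by
    simp_rw [partialDeriv_idAddGrad D.smooth_f]
    rfl
  simp_rw [e1, e2] at hsum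
  rw [integral_add (integrable_finsetSum _ fun k _ => hi2 m k) (hint m)] at hsum
  linarith

end MongeMap

section Rotation

variable {n : ℕ}

open Matrix

/-- The components of the tensor `t` in the frame given by the columns of `U`. -/
def rotTensor (U : Matrix (Fin n) (Fin n) ℝ) (t : Fin n → Fin n → Fin n → ℝ) (a b c : Fin n) : ℝ :=
  ∑ i, U i a * ∑ j, U j b * ∑ k, U k c * t i j k

theorem sum_rot_mul_rot {U : Matrix (Fin n) (Fin n) ℝ} (hU : U * Uᵀ = 1) (x y : Fin n → ℝ) :
    ∑ a, (∑ i, U i a * x i) * ∑ i, U i a * y i = ∑ i, x i * y i := by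
  have h : (Uᵀ *ᵥ x) ⬝ᵥ (Uᵀ *ᵥ y) = x ⬝ᵥ y := by
    rw [Matrix.dotProduct_mulVec, ← Matrix.mulVec_transpose, Matrix.transpose_transpose,
      Matrix.mulVec_mulVec, hU, Matrix.one_mulVec]
  exact h

theorem sum_rotTensor_mul_rotTensor {U : Matrix (Fin n) (Fin n) ℝ} (hU : U * Uᵀ = 1)
    (t s : Fin n → Fin n → Fin n → ℝ) :
    ∑ a, ∑ b, ∑ c, rotTensor U t a b c * rotTensor U s a b c
      = ∑ i, ∑ j, ∑ k, t i j k * s i j k := by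
  simp only [rotTensor]
  calc _ = ∑ b, ∑ c, ∑ a, (∑ i, U i a * ∑ j, U j b * ∑ k, U k c * t i j k)
        * (∑ i, U i a * ∑ j, U j b * ∑ k, U k c * s i j k) := by
        rw [Finset.sum_comm]
        exact Finset.sum_congr rfl fun b _ => Finset.sum_comm
    _ = ∑ b, ∑ c, ∑ i, (∑ j, U j b * ∑ k, U k c * t i j k)
        * (∑ j, U j b * ∑ k, U k c * s i j k) := by
        simp_rw [sum_rot_mul_rot hU]
    _ = ∑ i, ∑ c, ∑ b, (∑ j, U j b * ∑ k, U k c * t i j k)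
        * (∑ j, U j b * ∑ k, U k c * s i j k) := by
        rw [Finset.sum_comm]
        simp_rw [Finset.sum_comm (s := (Finset.univ : Finset (Fin n)))
          (t := (Finset.univ : Finset (Fin n))) (f := fun b i => (∑ j, U j b * ∑ k, U k _ * t i j k)
          * (∑ j, U j b * ∑ k, U k _ * s i j k))]
        rw [Finset.sum_comm]
    _ = ∑ i, ∑ c, ∑ j, (∑ k, U k c * t i j k) * ∑ k, U k c * s i j k := by
        simp_rw [sum_rot_mul_rot hU]
    _ = ∑ i, ∑ j, ∑ c, (∑ k, U k c * t i j k) * ∑ k, U k c * s i j k :=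
        Finset.sum_congr rfl fun i _ => Finset.sum_comm
    _ = _ := by simp_rw [sum_rot_mul_rot hU]

theorem transpose_mul_mul_apply (U X : Matrix (Fin n) (Fin n) ℝ) (a b : Fin n) :
    (Uᵀ * X * U) a b = ∑ i, U i a * ∑ j, U j b * X i j := by
  rw [Matrix.mul_assoc, Matrix.mul_apply]
  refine Finset.sum_congr rfl fun i _ => ?_
  rw [Matrix.transpose_apply, Matrix.mul_apply]
  simp_rw [mul_comm]

theorem rotTensor_eq_sum_third (U : Matrix (Fin n) (Fin n) ℝ)
    (X : Fin n → Matrix (Fin n) (Fin n) ℝ) (a b c : Fin n) :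
    rotTensor U (fun i j k => X k i j) a b c = ∑ k, U k c * (Uᵀ * X k * U) a b := by
  simp_rw [transpose_mul_mul_apply, rotTensor, Finset.mul_sum]
  symm
  rw [Finset.sum_comm]
  refine Finset.sum_congr rfl fun i _ => ?_
  rw [Finset.sum_comm]
  refine Finset.sum_congr rfl fun j _ => Finset.sum_congr rfl fun k _ => ?_
  ring

theorem rotTensor_eq_sum_second (U : Matrix (Fin n) (Fin n) ℝ)
    (X : Fin n → Matrix (Fin n) (Fin n) ℝ) (a b c : Fin n) :
    rotTensor U (fun i j k => X j i k) a b c = ∑ j, U j b * (Uᵀ * X j * U) a c := by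
  simp_rw [transpose_mul_mul_apply, rotTensor, Finset.mul_sum]
  rw [Finset.sum_comm]
  refine Finset.sum_congr rfl fun j _ => Finset.sum_congr rfl fun i _ =>
    Finset.sum_congr rfl fun k _ => ?_
  ring

theorem transpose_mul_conj_diagonal {U : Matrix (Fin n) (Fin n) ℝ} (hU' : Uᵀ * U = 1)
    (d : Fin n → ℝ) (X : Matrix (Fin n) (Fin n) ℝ) (a b : Fin n) :
    (Uᵀ * (U * diagonal d * Uᵀ * X * (U * diagonal d * Uᵀ)) * U) a b
      = d a * d b * (Uᵀ * X * U) a b := by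
  have : Uᵀ * (U * diagonal d * Uᵀ * X * (U * diagonal d * Uᵀ)) * U
      = diagonal d * (Uᵀ * X * U) * diagonal d := by
    calc _ = (Uᵀ * U) * (diagonal d * (Uᵀ * X * U) * diagonal d) * (Uᵀ * U) := by
          simp only [Matrix.mul_assoc]
      _ = _ := by rw [hU', Matrix.one_mul, Matrix.mul_one]
  rw [this, Matrix.mul_diagonal, Matrix.diagonal_mul]
  ring

theorem rotTensor_smul_one (U : Matrix (Fin n) (Fin n) ℝ) (hU' : Uᵀ * U = 1)
    (x : Fin n → ℝ) (a b c : Fin n) :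
    rotTensor U (fun i j k => x i * (1 : Matrix (Fin n) (Fin n) ℝ) j k) a b c
      = (∑ i, U i a * x i) * (1 : Matrix (Fin n) (Fin n) ℝ) b c := by
  have hinner : ∀ i j, ∑ k, U k c * (x i * (1 : Matrix (Fin n) (Fin n) ℝ) j k)
      = x i * U j c := fun i j => by
    rw [Finset.sum_eq_single j (fun k _ h => by simp [Matrix.one_apply_ne h.symm]) (by simp)]
    simp [mul_comm]
  have hone : ∑ j, U j b * U j c = (1 : Matrix (Fin n) (Fin n) ℝ) b c := by
    rw [← hU', Matrix.mul_apply]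
    rfl
  simp only [rotTensor, hinner, Finset.sum_mul]
  refine Finset.sum_congr rfl fun i _ => ?_
  rw [← hone, mul_assoc]
  congr 1
  rw [Finset.mul_sum]
  exact Finset.sum_congr rfl fun j _ => by ring

theorem rotTensor_mul (U M : Matrix (Fin n) (Fin n) ℝ)
    (w : Fin n → ℝ) (a b c : Fin n) :
    rotTensor U (fun i j k => M i j * w k) a b c
      = (Uᵀ * M * U) a b * ∑ k, U k c * w k := by
  rw [transpose_mul_mul_apply, rotTensor, Finset.sum_mul]
  refine Finset.sum_congr rfl fun i _ => ?_
  rw [mul_assoc, Finset.sum_mul]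
  congr 1
  refine Finset.sum_congr rfl fun j _ => ?_
  rw [mul_assoc]
  congr 1
  rw [Finset.mul_sum]
  exact Finset.sum_congr rfl fun k _ => by ring

theorem Matrix.PosDef.exists_diagonalization {A : Matrix (Fin n) (Fin n) ℝ} (hA : A.PosDef) :
    ∃ (U : Matrix (Fin n) (Fin n) ℝ) (d : Fin n → ℝ), U * Uᵀ = 1 ∧ Uᵀ * U = 1 ∧
      (∀ i, 0 < d i) ∧ A = U * diagonal d * Uᵀ := by
  refine ⟨hA.1.eigenvectorUnitary, hA.1.eigenvalues, ?_, ?_, hA.eigenvalues_pos, ?_⟩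
  · exact Unitary.coe_mul_star_self hA.1.eigenvectorUnitary
  · exact Unitary.coe_star_mul_self hA.1.eigenvectorUnitary
  · conv_lhs => rw [hA.1.spectral_theorem]
    rfl

end Rotation

section Estimate

variable {n : ℕ}

open Matrix

theorem sum_rot_mulVec {U : Matrix (Fin n) (Fin n) ℝ} (hU' : Uᵀ * U = 1) (d x : Fin n → ℝ)
    (a : Fin n) :
    ∑ i, U i a * ((U * diagonal d * Uᵀ) *ᵥ x) i = d a * ∑ i, U i a * x i := by
  have h : Uᵀ *ᵥ ((U * diagonal d * Uᵀ) *ᵥ x) = diagonal d *ᵥ (Uᵀ *ᵥ x) := by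
    rw [Matrix.mulVec_mulVec, Matrix.mul_assoc U, ← Matrix.mul_assoc, hU', Matrix.one_mul,
      Matrix.mulVec_mulVec]
  have h' := congrFun h a
  rw [Matrix.mulVec_diagonal] at h'
  exact h'

theorem conj_diagonal_inv {U : Matrix (Fin n) (Fin n) ℝ} (hU : U * Uᵀ = 1) (hU' : Uᵀ * U = 1)
    {d : Fin n → ℝ} {δ : ℝ} (hd : ∀ i, δ + d i ≠ 0) :
    (δ • 1 + U * diagonal d * Uᵀ)⁻¹ = U * diagonal (fun i => (δ + d i)⁻¹) * Uᵀ := by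
  refine Matrix.inv_eq_right_inv ?_
  have h1 : δ • 1 + U * diagonal d * Uᵀ = U * diagonal (fun i => δ + d i) * Uᵀ := by
    rw [← hU]
    have : (diagonal fun i => δ + d i) = δ • (1 : Matrix (Fin n) (Fin n) ℝ) + diagonal d := by
      ext i j
      by_cases h : i = j
      · subst h; simp
      · simp [h]
    rw [this, Matrix.mul_add, Matrix.add_mul]
    simp
  rw [h1]
  calc _ = U * (diagonal (fun i => δ + d i) * (Uᵀ * U) * diagonal (fun i => (δ + d i)⁻¹)) * Uᵀ := by
        simp only [Matrix.mul_assoc]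
    _ = 1 := by
        rw [hU', Matrix.mul_one, Matrix.diagonal_mul_diagonal]
        simp [hd, hU]

/-- The entrywise inequality behind `cutoff_quadratic_form_ge`. -/
theorem frame_entry_ge {δ a a' a'' κ φ γ γ'' s t : ℝ} (hδ : 0 < δ) (ha : 0 < a) (ha' : 0 < a')
    (ha'' : 0 < a'') (hs : s = 0 ∨ s = 1 ∧ a' = a'') (ht : t = 0 ∨ t = 1 ∧ a' = a) :
    -(8 * γ ^ 2 * s + 8 / δ * (a'' * γ'' ^ 2) * t)
      ≤ κ ^ 2 * ((2 * (a⁻¹ * a'⁻¹ * φ) - (δ + a)⁻¹ * (δ + a')⁻¹ * φ)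
          * ((δ + a)⁻¹ * (δ + a'')⁻¹ * φ))
        + 2 * κ * ((2 - (δ + a)⁻¹ * a) * γ * s * ((δ + a)⁻¹ * (δ + a'')⁻¹ * φ)
          - (2 * a⁻¹ - (δ + a)⁻¹) * t * (a'' * γ'') * ((δ + a)⁻¹ * (δ + a'')⁻¹ * φ)) := by
  set p := a⁻¹ with hp
  set p' := a'⁻¹ with hp'
  set q := (δ + a)⁻¹ with hq
  set q' := (δ + a')⁻¹ with hq'
  set q'' := (δ + a'')⁻¹ with hq''
  have hp0 : 0 < p := inv_pos.2 ha
  have hp'0 : 0 < p' := inv_pos.2 ha'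
  have hq0 : 0 < q := inv_pos.2 (by linarith)
  have hq'0 : 0 < q' := inv_pos.2 (by linarith)
  have hq''0 : 0 < q'' := inv_pos.2 (by linarith)
  have hqp : q ≤ p := inv_anti₀ ha (by linarith)
  have hqp' : q' ≤ p' := inv_anti₀ ha' (by linarith)
  have hqδ : q ≤ δ⁻¹ := inv_anti₀ hδ (by linarith)
  have hqa : q * a ≤ 1 := by
    rw [hq, inv_mul_le_one₀ (by linarith)]; linarith
  have hqa'' : q'' * a'' ≤ 1 := by
    rw [hq'', inv_mul_le_one₀ (by linarith)]; linarith
  have hqa0 : 0 ≤ q * a := by positivity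
  have hapa : p * a = 1 := inv_mul_cancel₀ ha.ne'
  set e := κ * φ with he
  have hquad : p * p' * (q * q'') * e ^ 2 ≤ κ ^ 2 * ((2 * (p * p' * φ) - q * q' * φ) * (q * q'' * φ)) := by
    have h1 : q * q' ≤ p * p' := mul_le_mul hqp hqp' hq'0.le hp0.le
    have h2 : 0 ≤ (p * p' - q * q') * ((q * q'') * e ^ 2) :=
      mul_nonneg (sub_nonneg.2 h1) (by positivity)
    rw [he] at h2 ⊢
    linarith
  have hA : -(8 * γ ^ 2 * s) ≤ 1 / 2 * (p * p' * (q * q'') * e ^ 2)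
      + 2 * e * ((2 - q * a) * γ * s * (q * q'')) := by
    rcases hs with rfl | ⟨rfl, h⟩
    · have : 0 ≤ p * p' * (q * q'') * e ^ 2 := by positivity
      linarith
    · have hqp'' : q'' ≤ p' := by
        rw [hp', h]; exact inv_anti₀ ha'' (by linarith)
      have h1 : q * q'' ≤ p * p' := mul_le_mul hqp hqp'' hq''0.le hp0.le
      have h2 : ((2 - q * a) * γ) ^ 2 ≤ 4 * γ ^ 2 := by
        rw [mul_pow]
        refine mul_le_mul_of_nonneg_right ?_ (sq_nonneg _)
        nlinarith
      have h3 : (q * q'') * (q * q'') * e ^ 2 ≤ p * p' * (q * q'') * e ^ 2 := by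
        gcongr
      nlinarith [sq_nonneg (q * q'' * e + 2 * ((2 - q * a) * γ))]
  have hB : -(8 / δ * (a'' * γ'' ^ 2) * t) ≤ 1 / 2 * (p * p' * (q * q'') * e ^ 2)
      - 2 * e * ((2 * p - q) * t * (a'' * γ'') * (q * q'')) := by
    rcases ht with rfl | ⟨rfl, h⟩
    · have : 0 ≤ p * p' * (q * q'') * e ^ 2 := by positivity
      linarith
    · have hpp : p' = p := by rw [hp', hp, h]
      rw [hpp]
      have hm : (2 * p - q) ^ 2 ≤ (2 * p) ^ 2 := by
        refine pow_le_pow_left₀ (by linarith) (by linarith) 2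
      set y := a'' * γ'' with hy
      have h1 : 0 ≤ (q * q'') * (p * e - 2 * ((2 * p - q) * a * y)) ^ 2 := by positivity
      have h2 : (2 * p - q) * a * p = 2 * p - q := by rw [mul_assoc, mul_comm a, hapa, mul_one]
      have h3 : ((2 * p - q) * a) ^ 2 ≤ 4 := by
        have : (2 * p - q) * a = 2 - q * a := by linear_combination 2 * hapa
        rw [this]; nlinarith
      have h4 : (q * q'') * y ^ 2 ≤ δ⁻¹ * (a'' * γ'' ^ 2) := by
        have h5 : q'' * y ^ 2 ≤ a'' * γ'' ^ 2 := by
          have : q'' * y ^ 2 = (q'' * a'') * (a'' * γ'' ^ 2) := by rw [hy]; ring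
          rw [this]
          exact mul_le_of_le_one_left (by positivity) hqa''
        rw [mul_assoc]
        exact mul_le_mul hqδ h5 (by positivity) (by positivity)
      have h6 : (q * q'') * y ^ 2 * ((2 * p - q) * a) ^ 2 ≤ δ⁻¹ * (a'' * γ'' ^ 2) * 4 :=
        mul_le_mul h4 h3 (sq_nonneg _) (by positivity)
      have h7 : (q * q'') * (p * e - 2 * ((2 * p - q) * a * y)) ^ 2
          = p * p * (q * q'') * e ^ 2 - 4 * e * ((2 * p - q) * 1 * y * (q * q''))
            + 4 * ((q * q'') * y ^ 2 * ((2 * p - q) * a) ^ 2) := by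
        linear_combination (-4 * (q * q'') * e * y) * h2
      rw [div_eq_mul_inv]
      linarith
  calc _ ≤ p * p' * (q * q'') * e ^ 2 + 2 * e * ((2 - q * a) * γ * s * (q * q''))
        - 2 * e * ((2 * p - q) * t * (a'' * γ'') * (q * q'')) := by linarith
    _ ≤ _ := by
        rw [he] at hquad ⊢
        linarith

/-- Lower bound for the error terms created by the cutoff, uniformly in the third derivatives. -/
theorem cutoff_quadratic_form_ge {A N P : Matrix (Fin n) (Fin n) ℝ} (hA : A.PosDef) {δ : ℝ}
    (hδ : 0 < δ) (hN : N = ((δ : ℝ) • (1 : Matrix (Fin n) (Fin n) ℝ) + A)⁻¹)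
    (hP : P = ((0 : ℝ) • (1 : Matrix (Fin n) (Fin n) ℝ) + A)⁻¹)
    {Φ : Fin n → Matrix (Fin n) (Fin n) ℝ} (h1 : ∀ k i j, Φ k i j = Φ i k j)
    (h2 : ∀ k i j, Φ k i j = Φ k j i) {γ v w b : Fin n → ℝ} {κ ε : ℝ} (hκ0 : 0 ≤ κ) (hκ1 : κ ≤ 1)
    (hε : 0 < ε) (hγ : ∀ i, |γ i| ≤ ε) (hw : w = A *ᵥ γ) (hb : b = (2 : ℝ) • γ - N *ᵥ w) :
    -(8 * n * (n * ε ^ 2) + 8 * n / δ * (A.trace * (n * ε ^ 2))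
        + 2 / δ * (n * ε + ε * ∑ i, v i ^ 2))
      ≤ κ ^ 2 * (∑ i, ∑ j, ∑ k,
          (2 * (P * Φ k * P) i j - (N * Φ k * N) i j) * (N * Φ j * N) i k)
        + 2 * κ * (∑ i, b i * (N *ᵥ v) i + ∑ i, b i * ∑ k, (N * Φ k * N) i k
          - ∑ i, ∑ j, ∑ k, ((2 : ℝ) • P - N) i j * w k * (N * Φ j * N) i k) := by
  obtain ⟨U, d, hU, hU', hd, hAU⟩ := hA.exists_diagonalization
  have hNU : N = U * diagonal (fun i => (δ + d i)⁻¹) * Uᵀ := by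
    rw [hN, hAU, conj_diagonal_inv hU hU' fun i => by have := hd i; positivity]
  have hPU : P = U * diagonal (fun i => (d i)⁻¹) * Uᵀ := by
    rw [hP, hAU, conj_diagonal_inv hU hU' fun i => by have := hd i; positivity]
    simp
  set φ : Fin n → Fin n → Fin n → ℝ := rotTensor U fun i j k => Φ j i k with hφ
  have hφ' : rotTensor U (fun i j k => Φ k i j) = φ := by
    rw [hφ]
    congr 1
    ext i j k
    rw [h2 k i j, h1 k j i, h2 j k i]
  set r : (Fin n → ℝ) → Fin n → ℝ := fun x a => ∑ i, U i a * x i with hr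
  have hX3 : ∀ a b c, rotTensor U (fun i j k => (N * Φ k * N) i j) a b c
      = (δ + d a)⁻¹ * (δ + d b)⁻¹ * φ a b c := fun a b c => by
    rw [rotTensor_eq_sum_third, hNU, ← hφ', rotTensor_eq_sum_third, Finset.mul_sum]
    exact Finset.sum_congr rfl fun k _ => by rw [transpose_mul_conj_diagonal hU']; ring
  have hY3 : ∀ a b c, rotTensor U (fun i j k => (P * Φ k * P) i j) a b c
      = (d a)⁻¹ * (d b)⁻¹ * φ a b c := fun a b c => by
    rw [rotTensor_eq_sum_third, hPU, ← hφ', rotTensor_eq_sum_third, Finset.mul_sum]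
    exact Finset.sum_congr rfl fun k _ => by rw [transpose_mul_conj_diagonal hU']; ring
  have hX2 : ∀ a b c, rotTensor U (fun i j k => (N * Φ j * N) i k) a b c
      = (δ + d a)⁻¹ * (δ + d c)⁻¹ * φ a b c := fun a b c => by
    rw [rotTensor_eq_sum_second, hNU, hφ, rotTensor_eq_sum_second, Finset.mul_sum]
    exact Finset.sum_congr rfl fun k _ => by rw [transpose_mul_conj_diagonal hU']; ring
  have hwr : ∀ a, r w a = d a * r γ a := fun a => by
    rw [hw, hAU]; exact sum_rot_mulVec hU' d γ a
  have hbr : ∀ a, r b a = (2 - (δ + d a)⁻¹ * d a) * r γ a := fun a => by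
    have e1 : r (N *ᵥ w) a = (δ + d a)⁻¹ * r w a := by
      rw [hNU]; exact sum_rot_mulVec hU' _ w a
    have e2 : r b a = 2 * r γ a - r (N *ᵥ w) a := by
      rw [hb]
      simp only [hr, Pi.sub_apply, Pi.smul_apply, smul_eq_mul]
      rw [Finset.mul_sum, ← Finset.sum_sub_distrib]
      exact Finset.sum_congr rfl fun i _ => by ring
    rw [e2, e1, hwr]
    ring
  have hMr : ∀ a b, (Uᵀ * ((2 : ℝ) • P - N) * U) a b
      = (2 * (d a)⁻¹ - (δ + d a)⁻¹) * (1 : Matrix (Fin n) (Fin n) ℝ) a b := fun a b => by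
    have e : Uᵀ * ((2 : ℝ) • P - N) * U
        = diagonal (fun i => 2 * (d i)⁻¹ - (δ + d i)⁻¹) := by
      have e1 : ∀ q : Fin n → ℝ, Uᵀ * (U * diagonal q * Uᵀ) * U = diagonal q := fun q => by
        calc _ = (Uᵀ * U) * diagonal q * (Uᵀ * U) := by simp only [Matrix.mul_assoc]
          _ = _ := by rw [hU', Matrix.one_mul, Matrix.mul_one]
      have e2 : (2 : ℝ) • P = P + P := two_smul ℝ P
      rw [e2, Matrix.mul_sub, Matrix.sub_mul, Matrix.mul_add, Matrix.add_mul, hPU, hNU, e1, e1,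
        Matrix.diagonal_add, Matrix.diagonal_sub]
      congr 1
      ext i
      ring
    rw [e, Matrix.diagonal_apply, Matrix.one_apply]
    split_ifs <;> simp
  have hquad : ∑ i, ∑ j, ∑ k, (2 * (P * Φ k * P) i j - (N * Φ k * N) i j) * (N * Φ j * N) i k
      = ∑ a, ∑ b, ∑ c, (2 * ((d a)⁻¹ * (d b)⁻¹ * φ a b c)
          - (δ + d a)⁻¹ * (δ + d b)⁻¹ * φ a b c) * ((δ + d a)⁻¹ * (δ + d c)⁻¹ * φ a b c) := by
    have e1 := sum_rotTensor_mul_rotTensor hU (fun i j k => (P * Φ k * P) i j)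
      fun i j k => (N * Φ j * N) i k
    have e2 := sum_rotTensor_mul_rotTensor hU (fun i j k => (N * Φ k * N) i j)
      fun i j k => (N * Φ j * N) i k
    simp only [hX2, hY3, hX3] at e1 e2
    simp only [sub_mul, mul_assoc (2 : ℝ), Finset.sum_sub_distrib, ← Finset.mul_sum]
    rw [e1, e2]
  have hlin1 : ∑ i, b i * ∑ k, (N * Φ k * N) i k
      = ∑ a, ∑ b', ∑ c, r b a * (1 : Matrix (Fin n) (Fin n) ℝ) b' c
          * ((δ + d a)⁻¹ * (δ + d c)⁻¹ * φ a b' c) := by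
    have e1 := sum_rotTensor_mul_rotTensor hU
      (fun i j k => b i * (1 : Matrix (Fin n) (Fin n) ℝ) j k) fun i j k => (N * Φ j * N) i k
    simp only [hX2, rotTensor_smul_one U hU'] at e1
    rw [show ∑ a, ∑ b', ∑ c, r b a * (1 : Matrix (Fin n) (Fin n) ℝ) b' c
          * ((δ + d a)⁻¹ * (δ + d c)⁻¹ * φ a b' c) = _ from e1]
    refine Finset.sum_congr rfl fun i _ => ?_
    rw [Finset.mul_sum]
    refine Finset.sum_congr rfl fun j _ => ?_
    simp [Matrix.one_apply]
  have hlin2 : ∑ i, ∑ j, ∑ k, ((2 : ℝ) • P - N) i j * w k * (N * Φ j * N) i k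
      = ∑ a, ∑ b', ∑ c, (2 * (d a)⁻¹ - (δ + d a)⁻¹) * (1 : Matrix (Fin n) (Fin n) ℝ) a b' * r w c
          * ((δ + d a)⁻¹ * (δ + d c)⁻¹ * φ a b' c) := by
    have e1 := sum_rotTensor_mul_rotTensor hU
      (fun i j k => ((2 : ℝ) • P - N) i j * w k) fun i j k => (N * Φ j * N) i k
    simp only [hX2, rotTensor_mul, hMr] at e1
    exact e1.symm
  have hvec : ∑ i, b i * (N *ᵥ v) i = ∑ a, r b a * ((δ + d a)⁻¹ * r v a) := by
    rw [← sum_rot_mul_rot hU]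
    refine Finset.sum_congr rfl fun a _ => ?_
    rw [hNU, sum_rot_mulVec hU']
  have hγr : ∑ a, r γ a ^ 2 ≤ n * ε ^ 2 := by
    have e1 := sum_rot_mul_rot hU γ γ
    simp only [← pow_two] at e1
    rw [show ∑ a, r γ a ^ 2 = _ from e1]
    refine (Finset.sum_le_sum fun i _ => sq_le_sq' (abs_le.1 (hγ i)).1 (abs_le.1 (hγ i)).2).trans ?_
    simp
  have hvr : ∑ a, r v a ^ 2 = ∑ i, v i ^ 2 := by
    have e1 := sum_rot_mul_rot hU v v
    simpa only [← pow_two] using e1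
  have htr : A.trace = ∑ a, d a := by
    rw [hAU, Matrix.mul_assoc, Matrix.trace_mul_comm, Matrix.mul_assoc, hU', Matrix.mul_one,
      Matrix.trace_diagonal]
  have hpart1 : -(8 * n * (n * ε ^ 2) + 8 * n / δ * (A.trace * (n * ε ^ 2)))
      ≤ ∑ a, ∑ b', ∑ c, -(8 * r γ a ^ 2 * (1 : Matrix (Fin n) (Fin n) ℝ) b' c
          + 8 / δ * (d c * r γ c ^ 2) * (1 : Matrix (Fin n) (Fin n) ℝ) a b') := by
    have e1 : ∑ a, ∑ b' : Fin n, ∑ c, 8 * r γ a ^ 2 * (1 : Matrix (Fin n) (Fin n) ℝ) b' c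
        = 8 * n * ∑ a, r γ a ^ 2 := by
      simp only [Matrix.one_apply, mul_ite, mul_one, mul_zero, Finset.sum_ite_eq,
        Finset.mem_univ, if_true, Finset.sum_const, Finset.card_univ, Fintype.card_fin,
        nsmul_eq_mul]
      rw [Finset.mul_sum]
      refine Finset.sum_congr rfl fun a _ => ?_
      ring
    have e2 : ∑ a : Fin n, ∑ b', ∑ c, 8 / δ * (d c * r γ c ^ 2)
          * (1 : Matrix (Fin n) (Fin n) ℝ) a b'
        = 8 * n / δ * ∑ c, d c * r γ c ^ 2 := by
      have k : ∀ a : Fin n, ∑ b', ∑ c, 8 / δ * (d c * r γ c ^ 2)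
          * (1 : Matrix (Fin n) (Fin n) ℝ) a b' = 8 / δ * ∑ c, d c * r γ c ^ 2 := fun a => by
        rw [Finset.sum_comm, Finset.mul_sum]
        exact Finset.sum_congr rfl fun c _ => by simp [Matrix.one_apply]
      rw [Finset.sum_congr rfl fun a _ => k a, Finset.sum_const, Finset.card_univ,
        Fintype.card_fin, nsmul_eq_mul]
      ring
    simp only [Finset.sum_neg_distrib, Finset.sum_add_distrib]
    rw [e1, e2]
    have e3 : ∑ c, d c * r γ c ^ 2 ≤ A.trace * (n * ε ^ 2) := by
      rw [htr, Finset.sum_mul]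
      refine Finset.sum_le_sum fun c _ => mul_le_mul_of_nonneg_left ?_ (hd c).le
      exact (Finset.single_le_sum (f := fun a => r γ a ^ 2) (fun a _ => sq_nonneg _)
        (Finset.mem_univ c)).trans hγr
    have e4 : 8 * (n : ℝ) * ∑ a, r γ a ^ 2 ≤ 8 * n * (n * ε ^ 2) := by gcongr
    have e5 : 8 * (n : ℝ) / δ * ∑ c, d c * r γ c ^ 2
      ≤ 8 * n / δ * (A.trace * (n * ε ^ 2)) := by gcongr
    linarith
  have hpart2 : -(2 / δ * (n * ε + ε * ∑ i, v i ^ 2))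
      ≤ 2 * κ * ∑ a, r b a * ((δ + d a)⁻¹ * r v a) := by
    have e1 : ∀ a, -(2 / δ * (r γ a ^ 2 / ε + ε * r v a ^ 2))
        ≤ 2 * κ * (r b a * ((δ + d a)⁻¹ * r v a)) := by
      intro a
      have hda := hd a
      have k0 : 0 ≤ (δ + d a)⁻¹ := by positivity
      have k1 : (δ + d a)⁻¹ ≤ δ⁻¹ := inv_anti₀ hδ (by linarith)
      have k2 : (δ + d a)⁻¹ * d a ≤ 1 := by
        rw [inv_mul_le_one₀ (by linarith)]; linarith
      have k3 : 0 ≤ (δ + d a)⁻¹ * d a := by positivity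
      have k4 : |r b a| ≤ 2 * |r γ a| := by
        rw [hbr, abs_mul, abs_of_nonneg (by linarith)]
        gcongr
        linarith
      have k5 : |2 * κ * (r b a * ((δ + d a)⁻¹ * r v a))|
          ≤ 2 * 1 * (2 * |r γ a| * (δ⁻¹ * |r v a|)) := by
        simp only [abs_mul, abs_of_nonneg hκ0, abs_of_nonneg k0, abs_two]
        gcongr
      have k6 : 2 * |r γ a| * |r v a| ≤ r γ a ^ 2 / ε + ε * r v a ^ 2 := by
        rw [← sq_abs (r γ a), ← sq_abs (r v a), div_add' _ _ _ hε.ne', le_div_iff₀ hε]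
        nlinarith [sq_nonneg (|r γ a| - ε * |r v a|)]
      have k7 : 2 * 1 * (2 * |r γ a| * (δ⁻¹ * |r v a|))
          ≤ 2 / δ * (r γ a ^ 2 / ε + ε * r v a ^ 2) := by
        calc _ = 2 / δ * (2 * |r γ a| * |r v a|) := by ring
          _ ≤ _ := by gcongr
      linarith [neg_abs_le (2 * κ * (r b a * ((δ + d a)⁻¹ * r v a)))]
    rw [Finset.mul_sum _ _ (2 * κ)]
    refine le_trans ?_ (Finset.sum_le_sum fun a _ => e1 a)
    rw [Finset.sum_neg_distrib, ← Finset.mul_sum, Finset.sum_add_distrib, ← Finset.sum_div,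
      ← Finset.mul_sum, hvr]
    have e2 : (∑ a, r γ a ^ 2) / ε ≤ n * ε := by
      rw [div_le_iff₀ hε]
      linarith
    gcongr
  have hpart3 : ∑ a, ∑ b', ∑ c, -(8 * r γ a ^ 2 * (1 : Matrix (Fin n) (Fin n) ℝ) b' c
          + 8 / δ * (d c * r γ c ^ 2) * (1 : Matrix (Fin n) (Fin n) ℝ) a b')
      ≤ ∑ a, ∑ b', ∑ c, (κ ^ 2 * ((2 * ((d a)⁻¹ * (d b')⁻¹ * φ a b' c)
          - (δ + d a)⁻¹ * (δ + d b')⁻¹ * φ a b' c) * ((δ + d a)⁻¹ * (δ + d c)⁻¹ * φ a b' c))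
        + 2 * κ * (r b a * (1 : Matrix (Fin n) (Fin n) ℝ) b' c
          * ((δ + d a)⁻¹ * (δ + d c)⁻¹ * φ a b' c)
          - (2 * (d a)⁻¹ - (δ + d a)⁻¹) * (1 : Matrix (Fin n) (Fin n) ℝ) a b' * r w c
          * ((δ + d a)⁻¹ * (δ + d c)⁻¹ * φ a b' c))) := by
    refine Finset.sum_le_sum fun a _ => Finset.sum_le_sum fun b' _ =>
      Finset.sum_le_sum fun c _ => ?_
    rw [hbr, hwr]
    refine frame_entry_ge hδ (hd a) (hd b') (hd c) ?_ ?_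
    · by_cases h : b' = c
      · exact Or.inr ⟨by rw [h, Matrix.one_apply_eq], by rw [h]⟩
      · exact Or.inl (Matrix.one_apply_ne h)
    · by_cases h : a = b'
      · exact Or.inr ⟨by rw [h, Matrix.one_apply_eq], by rw [h]⟩
      · exact Or.inl (Matrix.one_apply_ne h)
  rw [hquad, hlin1, hlin2, hvec]
  refine (add_le_add (hpart1.trans hpart3) hpart2).trans_eq' (by ring) |>.trans_eq ?_
  simp only [Finset.sum_add_distrib, ← Finset.mul_sum, Finset.sum_sub_distrib]
  ring

end Estimate

section Comparison

variable {n : ℕ}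

/-- Completing the square in the quantity `κ² |W|²`. -/
theorem sq_add_divergences_eq {κ : ℝ} {γ w b V W Z : Fin n → ℝ}
    {N P M H : Fin n → Fin n → ℝ} {dN dM : Fin n → Fin n → Fin n → ℝ} {dZ : Fin n → Fin n → ℝ}
    {ddN : Fin n → Fin n → Fin n → Fin n → ℝ} (hb : ∀ i, b i = 2 * γ i - ∑ k, N i k * w k)
    (hZ : ∀ i, Z i = ∑ k, (V k * N i k - dN k i k))
    (hdZ : ∀ j i, dZ j i = ∑ k, (H k j * N i k + V k * dN j i k - ddN k j i k))
    (hM : ∀ i j, M i j = 2 * P j i - N i j) :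
    κ * (κ * ∑ i, (W i - Z i) ^ 2)
      = κ * (κ * ∑ i, W i ^ 2)
        - κ * (κ * ∑ i, ∑ j, ∑ k, M i j * H k j * N i k
          + κ * ∑ i, ∑ j, ∑ k, dM k i j * dN j i k
          + 2 * (∑ i, b i * Z i + ∑ i, ∑ j, ∑ k, M i j * w k * dN j i k))
        - 2 * (κ * (κ * ∑ i, W i * Z i)
          - κ * (2 * ∑ i, γ i * Z i + κ * ∑ i, ∑ k, dZ k i * P k i))
        + (κ * (κ * ∑ k, ∑ i, N i k * Z i * V k)
          - κ * (2 * ∑ k, ∑ i, w k * N i k * Z i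
            + κ * ∑ k, ∑ i, (dN k i k * Z i + N i k * dZ k i)))
        - (κ * (κ * ∑ k, ∑ i, ∑ j, M i j * dN j i k * V k)
          - κ * (2 * ∑ k, ∑ i, ∑ j, w k * M i j * dN j i k
            + κ * ∑ k, ∑ i, ∑ j, (dM k i j * dN j i k + M i j * ddN k j i k))) := by
  have swap : ∀ u : Fin n → Fin n → Fin n → ℝ,
      ∑ k, ∑ i, ∑ j, u k i j = ∑ i, ∑ j, ∑ k, u k i j := fun u => by
    rw [Finset.sum_comm]
    exact Finset.sum_congr rfl fun i _ => Finset.sum_comm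
  have ha : ∑ k, ∑ i, N i k * Z i * V k - ∑ k, ∑ i, dN k i k * Z i = ∑ i, Z i ^ 2 := by
    rw [Finset.sum_comm, Finset.sum_comm (f := fun k i => dN k i k * Z i),
      ← Finset.sum_sub_distrib]
    refine Finset.sum_congr rfl fun i _ => ?_
    rw [← Finset.sum_sub_distrib, pow_two]
    nth_rewrite 3 [hZ i]
    rw [Finset.sum_mul]
    exact Finset.sum_congr rfl fun k _ => by ring
  have hb' : 2 * ∑ i, ∑ k, dZ k i * P k i - ∑ k, ∑ i, N i k * dZ k i
      = ∑ i, ∑ j, M i j * dZ j i := by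
    rw [Finset.sum_comm (f := fun k i => N i k * dZ k i), Finset.mul_sum,
      ← Finset.sum_sub_distrib]
    refine Finset.sum_congr rfl fun i _ => ?_
    rw [Finset.mul_sum, ← Finset.sum_sub_distrib]
    exact Finset.sum_congr rfl fun k _ => by rw [hM]; ring
  have hc : ∑ i, ∑ j, M i j * dZ j i = ∑ i, ∑ j, ∑ k, M i j * H k j * N i k
      + ∑ k, ∑ i, ∑ j, M i j * dN j i k * V k - ∑ k, ∑ i, ∑ j, M i j * ddN k j i k := by
    rw [swap fun k i j => M i j * dN j i k * V k, swap fun k i j => M i j * ddN k j i k]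
    simp only [← Finset.sum_add_distrib, ← Finset.sum_sub_distrib]
    refine Finset.sum_congr rfl fun i _ => Finset.sum_congr rfl fun j _ => ?_
    rw [hdZ, Finset.mul_sum]
    exact Finset.sum_congr rfl fun k _ => by ring
  have hd : ∑ i, b i * Z i = 2 * ∑ i, γ i * Z i - ∑ k, ∑ i, w k * N i k * Z i := by
    rw [Finset.sum_comm, Finset.mul_sum, ← Finset.sum_sub_distrib]
    refine Finset.sum_congr rfl fun i _ => ?_
    rw [hb, sub_mul, Finset.sum_mul, mul_assoc]
    congr 1
    exact Finset.sum_congr rfl fun k _ => by ring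
  have he : ∑ i, (W i - Z i) ^ 2 = ∑ i, W i ^ 2 - 2 * ∑ i, W i * Z i + ∑ i, Z i ^ 2 := by
    rw [Finset.mul_sum, ← Finset.sum_sub_distrib, ← Finset.sum_add_distrib]
    exact Finset.sum_congr rfl fun i _ => by ring
  have hf : ∑ k, ∑ i, ∑ j, w k * M i j * dN j i k = ∑ i, ∑ j, ∑ k, M i j * w k * dN j i k := by
    rw [swap]
    simp only [mul_comm (w _)]
  rw [hf, swap fun k i j => dM k i j * dN j i k + M i j * ddN k j i k]
  rw [swap fun k i j => M i j * ddN k j i k] at hc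
  simp only [Finset.sum_add_distrib]
  linear_combination κ ^ 2 * he - κ ^ 2 * ha - κ ^ 2 * hb' - κ ^ 2 * hc + 2 * κ * hd

theorem integral_comb {α : Type*} [MeasurableSpace α] {μ : Measure α}
    {f₁ f₂ f₃ f₄ f₅ f₆ f₇ f₈ : α → ℝ} (h₁ : Integrable f₁ μ) (h₂ : Integrable f₂ μ)
    (h₃ : Integrable f₃ μ) (h₄ : Integrable f₄ μ) (h₅ : Integrable f₅ μ) (h₆ : Integrable f₆ μ)
    (h₇ : Integrable f₇ μ) (h₈ : Integrable f₈ μ) :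
    ∫ x, (f₁ x - f₂ x - 2 * (f₃ x - f₄ x) + (f₅ x - f₆ x) - (f₇ x - f₈ x)) ∂μ
      = ∫ x, f₁ x ∂μ - ∫ x, f₂ x ∂μ - 2 * (∫ x, f₃ x ∂μ - ∫ x, f₄ x ∂μ)
        + (∫ x, f₅ x ∂μ - ∫ x, f₆ x ∂μ) - (∫ x, f₇ x ∂μ - ∫ x, f₈ x ∂μ) := by
  have h₁₂ : Integrable (fun x => f₁ x - f₂ x) μ := h₁.sub h₂
  have h₃₄ : Integrable (fun x => 2 * (f₃ x - f₄ x)) μ := (h₃.sub h₄).const_mul 2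
  have h₅₆ : Integrable (fun x => f₅ x - f₆ x) μ := h₅.sub h₆
  have h₇₈ : Integrable (fun x => f₇ x - f₈ x) μ := h₇.sub h₈
  have h₁₄ : Integrable (fun x => f₁ x - f₂ x - 2 * (f₃ x - f₄ x)) μ := h₁₂.sub h₃₄
  have h₁₆ : Integrable (fun x => f₁ x - f₂ x - 2 * (f₃ x - f₄ x) + (f₅ x - f₆ x)) μ :=
    h₁₄.add h₅₆
  rw [integral_sub h₁₆ h₇₈, integral_add h₁₄ h₅₆, integral_sub h₁₂ h₃₄, integral_const_mul,
    integral_sub h₁ h₂, integral_sub h₃ h₄, integral_sub h₅ h₆, integral_sub h₇ h₈]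

/-- The integrated form of `sq_add_divergences_eq`. -/
theorem integral_le_of_divergences {ρ : Measure (Fin n → ℝ)} {κ : (Fin n → ℝ) → ℝ}
    (hI : ∀ u : (Fin n → ℝ) → ℝ, Continuous u → Integrable (fun x => κ x * u x) ρ)
    (hκ : Continuous κ)
    {γ w b V W Z : (Fin n → ℝ) → Fin n → ℝ}
    {N P M H : (Fin n → ℝ) → Fin n → Fin n → ℝ} {dN dM : (Fin n → ℝ) → Fin n → Fin n → Fin n → ℝ}
    {dZ : (Fin n → ℝ) → Fin n → Fin n → ℝ}
    {ddN : (Fin n → ℝ) → Fin n → Fin n → Fin n → Fin n → ℝ}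
    (cγ : ∀ i, Continuous fun x => γ x i) (cw : ∀ i, Continuous fun x => w x i)
    (cb : ∀ i, Continuous fun x => b x i) (cV : ∀ i, Continuous fun x => V x i)
    (cW : ∀ i, Continuous fun x => W x i) (cZ : ∀ i, Continuous fun x => Z x i)
    (cN : ∀ i j, Continuous fun x => N x i j) (cP : ∀ i j, Continuous fun x => P x i j)
    (cM : ∀ i j, Continuous fun x => M x i j) (cH : ∀ i j, Continuous fun x => H x i j)
    (cdN : ∀ i j k, Continuous fun x => dN x i j k)
    (cdM : ∀ i j k, Continuous fun x => dM x i j k)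
    (cdZ : ∀ i j, Continuous fun x => dZ x i j)
    (cddN : ∀ i j k l, Continuous fun x => ddN x i j k l)
    (hb : ∀ x i, b x i = 2 * γ x i - ∑ k, N x i k * w x k)
    (hZ : ∀ x i, Z x i = ∑ k, (V x k * N x i k - dN x k i k))
    (hdZ : ∀ x j i, dZ x j i
      = ∑ k, (H x k j * N x i k + V x k * dN x j i k - ddN x k j i k))
    (hM : ∀ x i j, M x i j = 2 * P x j i - N x i j)
    (h1 : ∫ x, κ x * (κ x * ∑ i, W x i * Z x i) ∂ρ
      = ∫ x, κ x * (2 * ∑ i, γ x i * Z x i + κ x * ∑ i, ∑ k, dZ x k i * P x k i) ∂ρ)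
    (h2 : ∫ x, κ x * (κ x * ∑ k, ∑ i, N x i k * Z x i * V x k) ∂ρ
      = ∫ x, κ x * (2 * ∑ k, ∑ i, w x k * N x i k * Z x i
            + κ x * ∑ k, ∑ i, (dN x k i k * Z x i + N x i k * dZ x k i)) ∂ρ)
    (h3 : ∫ x, κ x * (κ x * ∑ k, ∑ i, ∑ j, M x i j * dN x j i k * V x k) ∂ρ
      = ∫ x, κ x * (2 * ∑ k, ∑ i, ∑ j, w x k * M x i j * dN x j i k
            + κ x * ∑ k, ∑ i, ∑ j, (dM x k i j * dN x j i k + M x i j * ddN x k j i k)) ∂ρ) :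
    ∫ x, κ x * (κ x * ∑ i, ∑ j, ∑ k, M x i j * H x k j * N x i k
          + κ x * ∑ i, ∑ j, ∑ k, dM x k i j * dN x j i k
          + 2 * (∑ i, b x i * Z x i + ∑ i, ∑ j, ∑ k, M x i j * w x k * dN x j i k)) ∂ρ
      ≤ ∫ x, κ x * (κ x * ∑ i, W x i ^ 2) ∂ρ := by
  have h0 : 0 ≤ ∫ x, κ x * (κ x * ∑ i, (W x i - Z x i) ^ 2) ∂ρ := by
    refine integral_nonneg fun x => ?_
    simp only [Pi.zero_apply]
    rw [← mul_assoc]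
    exact mul_nonneg (mul_self_nonneg _) (Finset.sum_nonneg fun i _ => sq_nonneg _)
  simp_rw [fun x => sq_add_divergences_eq (κ := κ x) (W := W x) (dM := dM x) (hb x) (hZ x) (hdZ x)
    (hM x)] at h0
  have i1 := hI (fun x => κ x * ∑ i, W x i ^ 2) (by fun_prop)
  have i2 := hI (fun x => κ x * ∑ i, ∑ j, ∑ k, M x i j * H x k j * N x i k
          + κ x * ∑ i, ∑ j, ∑ k, dM x k i j * dN x j i k
          + 2 * (∑ i, b x i * Z x i + ∑ i, ∑ j, ∑ k, M x i j * w x k * dN x j i k)) (by fun_prop)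
  have i3 := hI (fun x => κ x * ∑ i, W x i * Z x i) (by fun_prop)
  have i4 := hI (fun x => 2 * ∑ i, γ x i * Z x i + κ x * ∑ i, ∑ k, dZ x k i * P x k i)
    (by fun_prop)
  have i5 := hI (fun x => κ x * ∑ k, ∑ i, N x i k * Z x i * V x k) (by fun_prop)
  have i6 := hI (fun x => 2 * ∑ k, ∑ i, w x k * N x i k * Z x i
            + κ x * ∑ k, ∑ i, (dN x k i k * Z x i + N x i k * dZ x k i)) (by fun_prop)
  have i7 := hI (fun x => κ x * ∑ k, ∑ i, ∑ j, M x i j * dN x j i k * V x k) (by fun_prop)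
  have i8 := hI (fun x => 2 * ∑ k, ∑ i, ∑ j, w x k * M x i j * dN x j i k
            + κ x * ∑ k, ∑ i, ∑ j, (dM x k i j * dN x j i k + M x i j * ddN x k j i k))
    (by fun_prop)
  rw [integral_comb i1 i2 i3 i4 i5 i6 i7 i8, h1, h2, h3] at h0
  linarith

end Comparison

section CutoffEstimate

variable {n : ℕ}

theorem invHess_symm {u : (Fin n → ℝ) → ℝ} (hu : Smooth u) (δ : ℝ) (x : Fin n → ℝ)
    (i j : Fin n) : invHess δ u x i j = invHess δ u x j i := by
  have h : (invHess δ u x).transpose = invHess δ u x := by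
    rw [invHess, Matrix.transpose_nonsing_inv, Matrix.transpose_add, idAddHess_transpose hu,
      Matrix.transpose_smul, Matrix.transpose_one]
  exact congrFun (congrFun h.symm i) j

namespace MongeMap

variable {c : ℝ} {f g φ ψ : (Fin n → ℝ) → ℝ} {ρ ν : Measure (Fin n → ℝ)}

open Matrix in
/-- Integrations by parts against a squared cutoff `κ² = χ(Tx)²`. -/
theorem integral_cutoff_trace_le (D : MongeMap c f g φ ψ ρ ν) {δ ε : ℝ} (hδ : 0 < δ)
    {χ : (Fin n → ℝ) → ℝ} (hχ : Smooth χ) (hχc : HasCompactSupport χ)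
    (h01 : ∀ y, 0 ≤ χ y ∧ χ y ≤ 1) (hε : 0 < ε) (hχε : ∀ i y, |partialDeriv i χ y| ≤ ε) :
    Integrable (fun x => χ (idAddGrad φ x) ^ 2
        * (idAddHess f x * (((2 : ℝ) • invHess 0 φ x - invHess δ φ x) * invHess δ φ x)).trace) ρ ∧
    ∫ x, χ (idAddGrad φ x) ^ 2
        * (idAddHess f x * (((2 : ℝ) • invHess 0 φ x - invHess δ φ x) * invHess δ φ x)).trace ∂ρ
      ≤ ∫ x, χ (idAddGrad φ x) ^ 2 * ∑ i, idAddGrad g (idAddGrad φ x) i ^ 2 ∂ρ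
        + ∫ x, (8 * n * (n * ε ^ 2) + 8 * n / δ * ((idAddHess φ x).trace * (n * ε ^ 2))
          + 2 / δ * (n * ε + ε * ∑ i, idAddGrad f x i ^ 2)) ∂ρ := by
  have := D.prob
  have hT := D.smooth_φ.idAddGrad
  have sN := D.smooth_invHess hδ.le
  have sP := D.smooth_invHess le_rfl
  have sV := D.smooth_f.idAddGrad_apply
  have sH := D.smooth_f.idAddHess
  have sA := D.smooth_φ.idAddHess
  have sW : ∀ k, Smooth fun x => idAddGrad g (idAddGrad φ x) k := fun k =>
    (D.smooth_g.idAddGrad_apply k).comp hT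
  set κ : (Fin n → ℝ) → ℝ := fun x => χ (idAddGrad φ x) with hκ
  set γ : (Fin n → ℝ) → Fin n → ℝ := fun x i => partialDeriv i χ (idAddGrad φ x) with hγ
  set N : (Fin n → ℝ) → Matrix (Fin n) (Fin n) ℝ := invHess δ φ with hN
  set P : (Fin n → ℝ) → Matrix (Fin n) (Fin n) ℝ := invHess 0 φ with hP
  set w : (Fin n → ℝ) → Fin n → ℝ := fun x k => partialDeriv k κ x with hw
  set M : (Fin n → ℝ) → Matrix (Fin n) (Fin n) ℝ := fun x => (2 : ℝ) • P x - N x with hM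
  set dN : (Fin n → ℝ) → Fin n → Fin n → Fin n → ℝ :=
    fun x k i j => partialDeriv k (fun y => N y i j) x with hdN
  set dM : (Fin n → ℝ) → Fin n → Fin n → Fin n → ℝ :=
    fun x k i j => partialDeriv k (fun y => M y i j) x with hdM
  set Z : (Fin n → ℝ) → Fin n → ℝ :=
    fun x i => ∑ k, (idAddGrad f x k * N x i k - dN x k i k) with hZ
  set b : (Fin n → ℝ) → Fin n → ℝ := fun x => (2 : ℝ) • γ x - N x *ᵥ w x with hb
  have sκ : Smooth κ := hχ.comp hT
  have sκc : HasCompactSupport κ := D.hasCompactSupport_comp hχc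
  have sγ : ∀ i, Smooth fun x => γ x i := fun i => (hχ.partialDeriv i).comp hT
  have sw : ∀ i, Smooth fun x => w x i := fun i => sκ.partialDeriv i
  have sM : ∀ i j, Smooth fun x => M x i j := fun i j => (contDiff_const.mul (sP i j)).sub (sN i j)
  have sdN : ∀ k i j, Smooth fun x => dN x k i j := fun k i j => (sN i j).partialDeriv k
  have sdM : ∀ k i j, Smooth fun x => dM x k i j := fun k i j => (sM i j).partialDeriv k
  have sZ' : ∀ i k, Smooth fun x => idAddGrad f x k * N x i k - dN x k i k := fun i k =>
    ((sV k).mul (sN i k)).sub (sdN k i k)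
  have sZ : ∀ i, Smooth fun x => Z x i := fun i => ContDiff.sum fun k _ => sZ' i k
  have sdZ : ∀ k i, Smooth fun x => partialDeriv k (fun y => Z y i) x := fun k i =>
    (sZ i).partialDeriv k
  have sddN : ∀ k j i l, Smooth fun x => partialDeriv k (fun y => dN y j i l) x := fun k j i l =>
    (sdN j i l).partialDeriv k
  have hwγ : ∀ x, w x = idAddHess φ x *ᵥ γ x := fun x => by
    ext k
    simp only [hw, hκ]
    rw [partialDeriv_comp hχ hT]
    simp only [partialDeriv_idAddGrad D.smooth_φ]
    exact Finset.sum_congr rfl fun i _ => by rw [idAddHess_symm D.smooth_φ, mul_comm]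
  have hbi : ∀ x i, b x i = 2 * γ x i - ∑ k, N x i k * w x k := fun x i => rfl
  have cb : ∀ i, Continuous fun x => b x i := fun i => by
    simp only [hbi]
    exact (continuous_const.mul (sγ i).continuous).sub
      (continuous_finsetSum _ fun k _ => (sN i k).continuous.mul (sw k).continuous)
  have key := integral_le_of_divergences (ρ := ρ) (κ := κ)
    (fun u hu => D.integrable (sκ.continuous.mul hu) sκc.mul_right) sκ.continuous
    (γ := γ) (w := w) (b := b) (V := idAddGrad f) (W := fun x => idAddGrad g (idAddGrad φ x))
    (Z := Z) (N := N) (P := P) (M := M) (H := idAddHess f) (dN := dN) (dM := dM)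
    (dZ := fun x k i => partialDeriv k (fun y => Z y i) x)
    (ddN := fun x k j i l => partialDeriv k (fun y => dN y j i l) x)
    (fun i => (sγ i).continuous) (fun i => (sw i).continuous) cb
    (fun i => (sV i).continuous) (fun i => (sW i).continuous) (fun i => (sZ i).continuous)
    (fun i j => (sN i j).continuous) (fun i j => (sP i j).continuous)
    (fun i j => (sM i j).continuous) (fun i j => (sH i j).continuous)
    (fun i j k => (sdN i j k).continuous) (fun i j k => (sdM i j k).continuous)
    (fun i j => (sdZ i j).continuous) (fun i j k l => (sddN i j k l).continuous)
    hbi (fun x i => rfl) ?_ ?_ ?_ ?_ ?_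
  · have hdN' : ∀ x k i j, dN x k i j = -(N x * thirdDeriv φ k x * N x) i j := fun x k i j =>
      partialDeriv_invHess D.smooth_φ (D.isUnit_smul_add hδ.le) k i j x
    have hdM' : ∀ x k i j, dM x k i j
        = -(2 * (P x * thirdDeriv φ k x * P x) i j - (N x * thirdDeriv φ k x * N x) i j) := by
      intro x k i j
      have h : (fun y => M y i j) = fun y => 2 * P y i j - N y i j := rfl
      simp only [hdM]
      rw [h, partialDeriv_sub (contDiff_const.mul (sP i j)) (sN i j),
        partialDeriv_const_mul (sP i j),
        partialDeriv_invHess D.smooth_φ (D.isUnit_smul_add hδ.le),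
        partialDeriv_invHess D.smooth_φ (D.isUnit_smul_add le_rfl)]
      ring
    have htr : ∀ x, (idAddHess f x * (M x * N x)).trace
        = ∑ i, ∑ j, ∑ k, M x i j * idAddHess f x k j * N x i k := by
      intro x
      have hMs : ∀ i j, M x i j = M x j i := fun i j => by
        simp only [hM, hN, hP, Matrix.sub_apply, Matrix.smul_apply]
        rw [invHess_symm D.smooth_φ 0 x i j, invHess_symm D.smooth_φ δ x i j]
      rw [Finset.sum_congr rfl fun i _ => Finset.sum_comm, Finset.sum_comm]
      refine Finset.sum_congr rfl fun k _ => ?_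
      rw [Finset.sum_comm, Matrix.diag_apply, Matrix.mul_apply]
      refine Finset.sum_congr rfl fun j _ => ?_
      rw [Matrix.mul_apply, Finset.mul_sum]
      exact Finset.sum_congr rfl fun i _ => by rw [hMs i j]; ring
    set E : (Fin n → ℝ) → ℝ := fun x =>
      8 * n * (n * ε ^ 2) + 8 * n / δ * ((idAddHess φ x).trace * (n * ε ^ 2))
          + 2 / δ * (n * ε + ε * ∑ i, idAddGrad f x i ^ 2) with hE
    have hEi : Integrable E ρ := by
      have hV : Integrable (fun x => ∑ i, idAddGrad f x i ^ 2) ρ :=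
        integrable_finsetSum _ fun i _ => (D.memLp_idAddGrad_f i).integrable_sq
      exact ((integrable_const _).add ((D.integrable_trace_hess_φ.mul_const _).const_mul _)).add
        (((integrable_const _).add (hV.const_mul _)).const_mul _)
    have hpt : ∀ x, κ x ^ 2 * (idAddHess f x * (M x * N x)).trace
        ≤ κ x * (κ x * ∑ i, ∑ j, ∑ k, M x i j * idAddHess f x k j * N x i k
          + κ x * ∑ i, ∑ j, ∑ k, dM x k i j * dN x j i k
          + 2 * (∑ i, b x i * Z x i + ∑ i, ∑ j, ∑ k, M x i j * w x k * dN x j i k)) + E x := by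
      intro x
      have q := cutoff_quadratic_form_ge (D.hess_φ x) hδ (N := N x) (P := P x) rfl rfl
        (Φ := fun k => thirdDeriv φ k x) (fun k i j => thirdDeriv_swap D.smooth_φ k i j x)
        (fun k i j => thirdDeriv_symm D.smooth_φ k i j x) (γ := γ x) (v := idAddGrad f x)
        (w := w x) (b := b x) (κ := κ x) (ε := ε) (h01 _).1 (h01 _).2 hε
        (fun i => hχε i _) (hwγ x) rfl
      have e1 : ∑ i, ∑ j, ∑ k, dM x k i j * dN x j i k
          = ∑ i, ∑ j, ∑ k, (2 * (P x * thirdDeriv φ k x * P x) i j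
            - (N x * thirdDeriv φ k x * N x) i j) * (N x * thirdDeriv φ j x * N x) i k := by
        simp only [hdN', hdM', neg_mul_neg]
      have e2 : ∑ i, b x i * Z x i = ∑ i, b x i * (N x *ᵥ idAddGrad f x) i
          + ∑ i, b x i * ∑ k, (N x * thirdDeriv φ k x * N x) i k := by
        rw [← Finset.sum_add_distrib]
        refine Finset.sum_congr rfl fun i _ => ?_
        simp only [hZ, hdN', sub_neg_eq_add]
        rw [← mul_add, Finset.sum_add_distrib]
        congr 2
        exact Finset.sum_congr rfl fun k _ => mul_comm _ _
      have e3 : ∑ i, ∑ j, ∑ k, M x i j * w x k * dN x j i k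
          = -∑ i, ∑ j, ∑ k, M x i j * w x k * (N x * thirdDeriv φ j x * N x) i k := by
        simp only [hdN', mul_neg, Finset.sum_neg_distrib]
      rw [e1, e2, e3, ← htr]
      simp only [hE]
      linarith
    have cMN : ∀ i j, Continuous fun x => (M x * N x) i j := fun i j => by
      simp only [Matrix.mul_apply]
      exact continuous_finsetSum _ fun k _ => (sM i k).continuous.mul (sN k j).continuous
    have ctr : Continuous fun x => (idAddHess f x * (M x * N x)).trace := by
      simp only [Matrix.trace, Matrix.diag_apply, Matrix.mul_apply (M := idAddHess f _)]
      exact continuous_finsetSum _ fun i _ => continuous_finsetSum _ fun j _ =>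
        (sH i j).continuous.mul (cMN j i)
    have csq : HasCompactSupport fun x => κ x ^ 2 := by
      simp only [pow_two]
      exact sκc.mul_right
    have iL : Integrable (fun x => κ x ^ 2 * (idAddHess f x * (M x * N x)).trace) ρ :=
      D.integrable ((sκ.continuous.pow 2).mul ctr) csq.mul_right
    have cR : Continuous fun x =>
        κ x * ∑ i, ∑ j, ∑ k, M x i j * idAddHess f x k j * N x i k
          + κ x * ∑ i, ∑ j, ∑ k, dM x k i j * dN x j i k
          + 2 * (∑ i, b x i * Z x i + ∑ i, ∑ j, ∑ k, M x i j * w x k * dN x j i k) := by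
      have c1 := sκ.continuous
      have c2 := fun i j => (sM i j).continuous
      have c3 := fun i j => (sH i j).continuous
      have c4 := fun i j => (sN i j).continuous
      have c5 := fun i j k => (sdM i j k).continuous
      have c6 := fun i j k => (sdN i j k).continuous
      have c7 := fun i => (sZ i).continuous
      have c8 := fun i => (sw i).continuous
      clear_value κ M N dM dN Z w b
      fun_prop
    have iR := D.integrable (sκ.continuous.mul cR) sκc.mul_right
    refine ⟨iL, (integral_mono iL (iR.add hEi) hpt).trans ?_⟩
    rw [integral_add' iR hEi]
    refine add_le_add (key.trans_eq (integral_congr_ae (Eventually.of_forall fun x => ?_))) le_rfl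
    simp only [pow_two, mul_assoc]
    rfl
  · intro x j i
    simp only [hZ]
    rw [partialDeriv_sum _ fun k _ => sZ' i k]
    refine Finset.sum_congr rfl fun k _ => ?_
    rw [partialDeriv_sub ((sV k).mul (sN i k)) (sdN k i k), partialDeriv_mul (sV k) (sN i k),
      partialDeriv_idAddGrad D.smooth_f]
    congr 1
    exact partialDeriv_comm (sN i k) j k x
  · intro x i j
    rw [hP, invHess_symm D.smooth_φ 0 x j i]
    rfl
  · have h := D.integral_score_comp_sum (hχ.mul hχ) hχc.mul_right sZ
    refine Eq.trans (integral_congr_ae (Eventually.of_forall fun x => ?_))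
      (h.trans (integral_congr_ae (Eventually.of_forall fun x => ?_)))
    · simp only [Finset.mul_sum]
      exact Finset.sum_congr rfl fun i _ => by ring
    · simp only [partialDeriv_mul hχ hχ, mul_add, Finset.mul_sum]
      congr 1
      · exact Finset.sum_congr rfl fun i _ => by ring
      · exact Finset.sum_congr rfl fun i _ => Finset.sum_congr rfl fun k _ => by ring
  · have sS : ∀ k, Smooth fun x => ∑ i, N x i k * Z x i := fun k =>
      ContDiff.sum fun i _ => (sN i k).mul (sZ i)
    have h := D.integral_divergence (Z := fun k x => κ x * (κ x * ∑ i, N x i k * Z x i))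
      (fun k => sκ.mul (sκ.mul (sS k))) fun k => sκc.mul_right
    refine Eq.trans (integral_congr_ae (Eventually.of_forall fun x => ?_))
      (h.symm.trans (integral_congr_ae (Eventually.of_forall fun x => ?_)))
    · simp only [Finset.mul_sum, Finset.sum_mul]
      exact Finset.sum_congr rfl fun k _ => Finset.sum_congr rfl fun i _ => by ring
    · simp only [Finset.mul_sum, ← Finset.sum_add_distrib]
      refine Finset.sum_congr rfl fun k _ => ?_
      simp only [← Finset.mul_sum]
      rw [partialDeriv_mul sκ (sκ.mul (sS k)), partialDeriv_mul sκ (sS k),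
        partialDeriv_sum _ fun i _ => (sN i k).mul (sZ i)]
      simp only [partialDeriv_mul (sN _ k) (sZ _), Finset.mul_sum, ← Finset.sum_add_distrib]
      exact Finset.sum_congr rfl fun i _ => by ring
  · have sS' : ∀ k i, Smooth fun x => ∑ j, M x i j * dN x j i k := fun k i =>
      ContDiff.sum fun j _ => (sM i j).mul (sdN j i k)
    have sS : ∀ k, Smooth fun x => ∑ i, ∑ j, M x i j * dN x j i k := fun k =>
      ContDiff.sum fun i _ => sS' k i
    have h := D.integral_divergence
      (Z := fun k x => κ x * (κ x * ∑ i, ∑ j, M x i j * dN x j i k))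
      (fun k => sκ.mul (sκ.mul (sS k))) fun k => sκc.mul_right
    refine Eq.trans (integral_congr_ae (Eventually.of_forall fun x => ?_))
      (h.symm.trans (integral_congr_ae (Eventually.of_forall fun x => ?_)))
    · simp only [Finset.mul_sum, Finset.sum_mul]
      exact Finset.sum_congr rfl fun k _ => Finset.sum_congr rfl fun i _ =>
        Finset.sum_congr rfl fun j _ => by ring
    · simp only [Finset.mul_sum, ← Finset.sum_add_distrib]
      refine Finset.sum_congr rfl fun k _ => ?_
      simp only [← Finset.mul_sum]
      rw [partialDeriv_mul sκ (sκ.mul (sS k)), partialDeriv_mul sκ (sS k),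
        partialDeriv_sum _ fun i _ => sS' k i]
      simp only [partialDeriv_sum _ fun j _ => (sM _ j).mul (sdN j _ k),
        partialDeriv_mul (sM _ _) (sdN _ _ k), Finset.mul_sum, ← Finset.sum_add_distrib]
      exact Finset.sum_congr rfl fun i _ => Finset.sum_congr rfl fun j _ => by ring

end MongeMap

end CutoffEstimate

section TraceEstimate

variable {n : ℕ}

theorem tendsto_inv_smul_one_add {A : Matrix (Fin n) (Fin n) ℝ} (hA : IsUnit A) :
    Tendsto (fun t : ℝ => (t • 1 + A)⁻¹) (𝓝 0) (𝓝 (((0 : ℝ) • 1 + A)⁻¹)) := by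
  have h : Continuous fun t : ℝ => t • (1 : Matrix (Fin n) (Fin n) ℝ) + A := by fun_prop
  have hdet : ((0 : ℝ) • (1 : Matrix (Fin n) (Fin n) ℝ) + A).det ≠ 0 := by
    rw [zero_smul, zero_add]
    exact ((Matrix.isUnit_iff_isUnit_det _).1 hA).ne_zero
  simp only [Matrix.inv_def, Ring.inverse_eq_inv']
  exact ((h.matrix_det.tendsto 0).inv₀ hdet).smul (h.matrix_adjugate.tendsto 0)

theorem inv_sub_inv_smul_one_add {A : Matrix (Fin n) (Fin n) ℝ} {δ : ℝ}
    (hA : IsUnit ((0 : ℝ) • 1 + A)) (hδ : IsUnit (δ • 1 + A)) :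
    ((0 : ℝ) • 1 + A)⁻¹ - (δ • 1 + A)⁻¹ = δ • ((δ • 1 + A)⁻¹ * ((0 : ℝ) • 1 + A)⁻¹) := by
  rw [Matrix.isUnit_iff_isUnit_det] at hA hδ
  calc _ = (δ • 1 + A)⁻¹ * ((δ • 1 + A) - ((0 : ℝ) • 1 + A)) * ((0 : ℝ) • 1 + A)⁻¹ := by
        rw [Matrix.mul_sub, Matrix.sub_mul, Matrix.nonsing_inv_mul _ hδ, Matrix.mul_assoc,
          Matrix.mul_nonsing_inv _ hA, Matrix.one_mul, Matrix.mul_one]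
    _ = _ := by
        rw [zero_smul, zero_add, add_sub_cancel_right, Matrix.mul_smul, Matrix.mul_one,
          Matrix.smul_mul]

namespace MongeMap

variable {c : ℝ} {f g φ ψ : (Fin n → ℝ) → ℝ} {ρ ν : Measure (Fin n → ℝ)}

theorem posSemidef_idAddHess_f (D : MongeMap c f g φ ψ ρ ν) (x : Fin n → ℝ) :
    (idAddHess f x).PosSemidef := by
  have h := (D.hess_f x).add ((Matrix.PosSemidef.one (n := Fin n) (R := ℝ)).smul D.pos.le)
  rwa [sub_add_cancel] at h

theorem posDef_invHess (D : MongeMap c f g φ ψ ρ ν) {δ : ℝ} (hδ : 0 ≤ δ) (x : Fin n → ℝ) :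
    (invHess δ φ x).PosDef :=
  (D.posDef_smul_add hδ x).inv

theorem trace_mul_resolvent_nonneg (D : MongeMap c f g φ ψ ρ ν) {δ : ℝ} (hδ : 0 ≤ δ)
    (x : Fin n → ℝ) :
    0 ≤ (idAddHess f x
      * (((2 : ℝ) • invHess 0 φ x - invHess δ φ x) * invHess δ φ x)).trace := by
  set N := invHess δ φ x with hN
  set P := invHess 0 φ x with hP
  have hNd : N.PosDef := D.posDef_invHess hδ x
  have hPd : P.PosDef := D.posDef_invHess le_rfl x
  have hPN : P - N = δ • (N * P) :=
    inv_sub_inv_smul_one_add (D.isUnit_smul_add le_rfl x) (D.isUnit_smul_add hδ x)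
  have e : ((2 : ℝ) • P - N) * N = N * N + (2 * δ) • (N * P * N) := by
    have : (2 : ℝ) • P - N = N + (2 : ℝ) • (P - N) := by module
    rw [this, hPN, Matrix.add_mul, smul_smul, Matrix.smul_mul]
  have h1 : (N * N).PosSemidef := by
    have h := Matrix.posSemidef_conjTranspose_mul_self N
    rwa [hNd.isHermitian.eq] at h
  have h2 : (N * P * N).PosSemidef := by
    have h := hPd.posSemidef.conjTranspose_mul_mul_same N
    rwa [hNd.isHermitian.eq] at h
  rw [e]
  exact (D.posSemidef_idAddHess_f x).trace_mul_nonneg (h1.add (h2.smul (by positivity)))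

theorem integral_trace_mul_resolvent_le (D : MongeMap c f g φ ψ ρ ν) {δ : ℝ} (hδ : 0 < δ) :
    Integrable (fun x => (idAddHess f x
        * (((2 : ℝ) • invHess 0 φ x - invHess δ φ x) * invHess δ φ x)).trace) ρ ∧
      ∫ x, (idAddHess f x
        * (((2 : ℝ) • invHess 0 φ x - invHess δ φ x) * invHess δ φ x)).trace ∂ρ
      ≤ ∫ x, ∑ i, idAddGrad g (idAddGrad φ x) i ^ 2 ∂ρ := by
  obtain ⟨K, χ, hχ⟩ := exists_isCutoffSeq n
  have := D.prob
  have hK := hχ.nonneg_const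
  set ε : ℕ → ℝ := fun m => (K + 1) / (m + 1) with hε
  have hε0 : ∀ m, 0 < ε m := fun m => by positivity
  have hεK : ∀ m, ε m ≤ K + 1 := fun m => by
    refine div_le_self (by positivity) ?_
    linarith [(Nat.cast_nonneg m : (0 : ℝ) ≤ m)]
  have hbound := fun m => D.integral_cutoff_trace_le hδ (hχ.smooth m) (hχ.compact m)
    (hχ.mem_Icc m) (hε0 m) fun i y => (hχ.partialDeriv_le m i y).trans (by
      simp only [hε]
      gcongr
      linarith)
  have hV : Integrable (fun x => ∑ i, idAddGrad f x i ^ 2) ρ :=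
    integrable_finsetSum _ fun i _ => (D.memLp_idAddGrad_f i).integrable_sq
  have hW : Integrable (fun x => ∑ i, idAddGrad g (idAddGrad φ x) i ^ 2) ρ :=
    integrable_finsetSum _ fun i _ => (D.memLp_idAddGrad_g i).integrable_sq
  have hlim := tendsto_integral_of_abs_le (μ := ρ) (K := K + 1)
    (v := fun m x => 8 * n * (n * ε m ^ 2) + 8 * n / δ * ((idAddHess φ x).trace * (n * ε m ^ 2))
          + 2 / δ * (n * ε m + ε m * ∑ i, idAddGrad f x i ^ 2))
    (w := fun x => 8 * n * (n * (K + 1)) + 8 * n / δ * ((idAddHess φ x).trace * (n * (K + 1)))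
          + 2 / δ * (n + ∑ i, idAddGrad f x i ^ 2))
    (((integrable_const _).add ((D.integrable_trace_hess_φ.mul_const _).const_mul _)).add
        (((integrable_const _).add hV).const_mul _)) fun m x => by
      have htr : 0 ≤ (idAddHess φ x).trace := (D.hess_φ x).posSemidef.trace_nonneg
      have hs : 0 ≤ ∑ i, idAddGrad f x i ^ 2 := Finset.sum_nonneg fun i _ => sq_nonneg _
      have h0 := (hε0 m).le
      have hsq : ε m ^ 2 ≤ ε m * (K + 1) := by
        rw [pow_two]
        exact mul_le_mul_of_nonneg_left (hεK m) h0
      rw [abs_of_nonneg (by positivity)]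
      calc _ ≤ 8 * n * (n * (ε m * (K + 1)))
            + 8 * n / δ * ((idAddHess φ x).trace * (n * (ε m * (K + 1))))
            + 2 / δ * (n * ε m + ε m * ∑ i, idAddGrad f x i ^ 2) := by gcongr
        _ = _ := by simp only [hε]; ring
  refine integrable_of_tendsto_of_integral_le (fun m => (hbound m).1)
    (fun m x => mul_nonneg (sq_nonneg _) (D.trace_mul_resolvent_nonneg hδ.le x)) (fun x => ?_)
    (fun m => (hbound m).2.trans (add_le_add_left (integral_mono_of_nonneg
      (Eventually.of_forall fun x => ?_) hW (Eventually.of_forall fun x => ?_)) _)) ?_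
  · refine tendsto_mul_of_eventually_eq_one (χ := fun m x => χ m (idAddGrad φ x) ^ 2)
      (fun x => ?_)
      (fun x => (idAddHess f x
        * (((2 : ℝ) • invHess 0 φ x - invHess δ φ x) * invHess δ φ x)).trace) x
    filter_upwards [hχ.eventually_one (idAddGrad φ x)] with m hm
    rw [hm, one_pow]
  · exact mul_nonneg (sq_nonneg _) (Finset.sum_nonneg fun i _ => sq_nonneg _)
  · refine mul_le_of_le_one_left (Finset.sum_nonneg fun i _ => sq_nonneg _) ?_
    exact pow_le_one₀ (hχ.mem_Icc m _).1 (hχ.mem_Icc m _).2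
  · simpa using hlim.const_add (∫ x, ∑ i, idAddGrad g (idAddGrad φ x) i ^ 2 ∂ρ)

theorem integral_trace_mul_sq_le (D : MongeMap c f g φ ψ ρ ν) :
    Integrable (fun x => (idAddHess f x * (invHess 0 φ x * invHess 0 φ x)).trace) ρ ∧
      ∫ x, (idAddHess f x * (invHess 0 φ x * invHess 0 φ x)).trace ∂ρ
      ≤ ∫ x, ∑ i, idAddGrad g (idAddGrad φ x) i ^ 2 ∂ρ := by
  have hδ : ∀ m : ℕ, (0 : ℝ) < 1 / ((m : ℝ) + 1) := fun m => by positivity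
  refine integrable_of_tendsto_of_integral_le
    (fun m : ℕ => (D.integral_trace_mul_resolvent_le (hδ m)).1)
    (fun m x => D.trace_mul_resolvent_nonneg (hδ m).le x) (fun x => ?_)
    (fun m => (D.integral_trace_mul_resolvent_le (hδ m)).2) tendsto_const_nhds
  have hN : Tendsto (fun m : ℕ => invHess (1 / ((m : ℝ) + 1)) φ x) atTop
      (𝓝 (invHess 0 φ x)) :=
    (tendsto_inv_smul_one_add (D.hess_φ x).isUnit).comp tendsto_one_div_add_atTop_nhds_zero_nat
  have hcont : Continuous fun X : Matrix (Fin n) (Fin n) ℝ =>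
      (idAddHess f x * (((2 : ℝ) • invHess 0 φ x - X) * X)).trace := by fun_prop
  have h := (hcont.tendsto _).comp hN
  rwa [show (2 : ℝ) • invHess 0 φ x - invHess 0 φ x = invHess 0 φ x by module] at h

/-- The estimate for the Hessian of `ψ` along the transport map. -/
theorem integral_trace_mul_sub_one_sq_le (D : MongeMap c f g φ ψ ρ ν) :
    Integrable (fun x => (idAddHess f x
        * ((invHess 0 φ x - 1) * (invHess 0 φ x - 1))).trace) ρ ∧
      ∫ x, (idAddHess f x * ((invHess 0 φ x - 1) * (invHess 0 φ x - 1))).trace ∂ρ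
      ≤ 3 * (∫ x, ∑ i, grad φ x i ^ 2 ∂ρ + ∫ x, ∑ i, grad g (idAddGrad φ x) i ^ 2 ∂ρ
        + ∫ x, ∑ i, grad f x i ^ 2 ∂ρ) := by
  have := D.prob
  obtain ⟨i1, h1⟩ := D.integral_trace_mul_sq_le
  obtain ⟨i2, h2⟩ := D.integral_trace_hess_f_mul_inv
  obtain ⟨i3, h3⟩ := D.integral_trace_hess_f
  have e : ∀ x, (idAddHess f x * ((invHess 0 φ x - 1) * (invHess 0 φ x - 1))).trace
      = (idAddHess f x * (invHess 0 φ x * invHess 0 φ x)).trace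
        - 2 * (idAddHess f x * invHess 0 φ x).trace + (idAddHess f x).trace := fun x => by
    have : idAddHess f x * ((invHess 0 φ x - 1) * (invHess 0 φ x - 1))
        = idAddHess f x * (invHess 0 φ x * invHess 0 φ x)
          - (2 : ℝ) • (idAddHess f x * invHess 0 φ x) + idAddHess f x := by
      rw [two_smul]
      noncomm_ring
    rw [this, Matrix.trace_add, Matrix.trace_sub, Matrix.trace_smul, smul_eq_mul]
  simp only [e]
  refine ⟨(i1.sub (i2.const_mul 2)).add i3, ?_⟩
  have hV := D.memLp_idAddGrad_f
  have hW := D.memLp_idAddGrad_g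
  have iV : Integrable (fun x => ∑ i, idAddGrad f x i ^ 2) ρ :=
    integrable_finsetSum _ fun i _ => (hV i).integrable_sq
  have iW : Integrable (fun x => ∑ i, idAddGrad g (idAddGrad φ x) i ^ 2) ρ :=
    integrable_finsetSum _ fun i _ => (hW i).integrable_sq
  have iWV : Integrable (fun x => ∑ i, idAddGrad g (idAddGrad φ x) i * idAddGrad f x i) ρ :=
    integrable_finsetSum _ fun i _ => (hW i).integrable_mul (hV i)
  have i12 : Integrable (fun x => (idAddHess f x * (invHess 0 φ x * invHess 0 φ x)).trace
      - 2 * (idAddHess f x * invHess 0 φ x).trace) ρ := i1.sub (i2.const_mul 2)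
  have iWWV : Integrable (fun x => ∑ i, idAddGrad g (idAddGrad φ x) i ^ 2
      - 2 * ∑ i, idAddGrad g (idAddGrad φ x) i * idAddGrad f x i) ρ := iW.sub (iWV.const_mul 2)
  rw [integral_add i12 i3, integral_sub i1 (i2.const_mul 2), integral_const_mul, h2, h3]
  calc _ ≤ ∫ x, ∑ i, idAddGrad g (idAddGrad φ x) i ^ 2 ∂ρ
        - 2 * ∫ x, ∑ i, idAddGrad g (idAddGrad φ x) i * idAddGrad f x i ∂ρ
        + ∫ x, ∑ i, idAddGrad f x i ^ 2 ∂ρ := by gcongr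
    _ = ∫ x, (∑ i, idAddGrad g (idAddGrad φ x) i ^ 2
        - 2 * ∑ i, idAddGrad g (idAddGrad φ x) i * idAddGrad f x i
        + ∑ i, idAddGrad f x i ^ 2) ∂ρ := by
        rw [integral_add iWWV iV, integral_sub iW (iWV.const_mul 2), integral_const_mul]
    _ ≤ ∫ x, 3 * (∑ i, grad φ x i ^ 2 + ∑ i, grad g (idAddGrad φ x) i ^ 2
        + ∑ i, grad f x i ^ 2) ∂ρ := by
        refine integral_mono (iWWV.add iV)
          (((D.grad_φ.add D.grad_g).add D.grad_f).const_mul 3) fun x => ?_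
        simp only [Finset.mul_sum, ← Finset.sum_add_distrib, ← Finset.sum_sub_distrib]
        refine Finset.sum_le_sum fun i _ => ?_
        simp only [idAddGrad, Pi.add_apply]
        nlinarith [sq_nonneg (grad φ x i - grad g (x + grad φ x) i),
          sq_nonneg (grad φ x i + grad f x i),
          sq_nonneg (grad g (x + grad φ x) i + grad f x i)]
    _ = _ := by
        have iφg : Integrable (fun x => ∑ i, grad φ x i ^ 2
          + ∑ i, grad g (idAddGrad φ x) i ^ 2) ρ := D.grad_φ.add D.grad_g
        rw [integral_const_mul, integral_add iφg D.grad_f, integral_add D.grad_φ D.grad_g]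

theorem sum_hess_sq_le_trace (D : MongeMap c f g φ ψ ρ ν) (x : Fin n → ℝ) :
    c * ∑ i, ∑ j, hess ψ (idAddGrad φ x) i j ^ 2
      ≤ (idAddHess f x * ((invHess 0 φ x - 1) * (invHess 0 φ x - 1))).trace := by
  have hψ : hess ψ (idAddGrad φ x) = invHess 0 φ x - 1 := by
    rw [← D.hess_ψ, idAddHess, add_sub_cancel_left]
  set Q := invHess 0 φ x - 1 with hQ
  have hQs : Q.conjTranspose = Q :=
    ((D.posDef_invHess le_rfl x).isHermitian.sub Matrix.isHermitian_one).eq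
  have hsq : (Q * Q).PosSemidef := by
    have h := Matrix.posSemidef_conjTranspose_mul_self Q
    rwa [hQs] at h
  have h := (D.hess_f x).trace_mul_nonneg hsq
  rw [Matrix.sub_mul, Matrix.trace_sub, Matrix.smul_mul, Matrix.trace_smul, Matrix.one_mul,
    smul_eq_mul] at h
  have hF : (Q * Q).trace = ∑ i, ∑ j, hess ψ (idAddGrad φ x) i j ^ 2 := by
    rw [hψ, Matrix.trace]
    refine Finset.sum_congr rfl fun i _ => ?_
    rw [Matrix.diag_apply, Matrix.mul_apply]
    refine Finset.sum_congr rfl fun j _ => ?_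
    have : Q j i = Q i j := congrFun (congrFun hQs i) j
    rw [this, pow_two]
  rw [← hF]
  linarith

end MongeMap

end TraceEstimate

section Construction

variable {n : ℕ}

theorem partialDeriv_const_mul_sq_norm (a : ℝ) (k : Fin n) (x : Fin n → ℝ) :
    partialDeriv k (fun y => a * ∑ i, y i ^ 2) x = 2 * a * x k := by
  rw [partialDeriv_const_mul (ContDiff.sum fun i _ => (smooth_coord i).pow 2),
    partialDeriv_sq_norm]
  ring

theorem hess_add_sq_norm {u : (Fin n → ℝ) → ℝ} (hu : Smooth u) (a : ℝ) (x : Fin n → ℝ) :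
    hess (fun y => u y + a * ∑ i, y i ^ 2) x = hess u x + (2 * a) • 1 := by
  have hq : Smooth fun y : Fin n → ℝ => a * ∑ i, y i ^ 2 :=
    contDiff_const.mul (ContDiff.sum fun i _ => (smooth_coord i).pow 2)
  ext i j
  have h : partialDeriv j (fun y => u y + a * ∑ i, y i ^ 2)
      = fun y => partialDeriv j u y + 2 * a * y j := by
    funext y
    rw [partialDeriv_add hu hq, partialDeriv_const_mul_sq_norm]
  rw [hess_apply, h, partialDeriv_add (hu.partialDeriv j)
    (contDiff_const.mul (smooth_coord j)), partialDeriv_const_mul (smooth_coord j),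
    partialDeriv_coord, Matrix.add_apply, Matrix.smul_apply, hess_apply, Matrix.one_apply,
    Matrix.one_apply, smul_eq_mul]
  simp [eq_comm]

theorem ConvexOn.posSemidef_hess {q : (Fin n → ℝ) → ℝ} (hq : Smooth q)
    (hconv : ConvexOn ℝ Set.univ q) (x : Fin n → ℝ) : (hess q x).PosSemidef := by
  refine Matrix.PosSemidef.of_dotProduct_mulVec_nonneg (Matrix.ext fun i j => ?_) fun v => ?_
  · rw [Matrix.conjTranspose_apply, star_trivial, hess_apply, hess_apply, partialDeriv_comm hq]
  · have h := hconv.sum_hess_nonneg hq x v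
    simpa [dotProduct, Matrix.mulVec, mul_comm, mul_left_comm] using h

theorem ConvexOn.posSemidef_hess_add {u : (Fin n → ℝ) → ℝ} (hu : Smooth u) {a : ℝ}
    (hconv : ConvexOn ℝ Set.univ fun x => u x + a * ∑ i, x i ^ 2) (x : Fin n → ℝ) :
    (hess u x + (2 * a) • 1).PosSemidef := by
  rw [← hess_add_sq_norm hu]
  exact hconv.posSemidef_hess
    (hu.add (contDiff_const.mul (ContDiff.sum fun i _ => (smooth_coord i).pow 2))) x

theorem Smooth.continuous_sum_grad_sq {u : (Fin n → ℝ) → ℝ} (hu : Smooth u) :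
    Continuous fun x => ∑ i, grad u x i ^ 2 :=
  continuous_finsetSum _ fun i _ => (hu.partialDeriv i).continuous.pow 2

theorem Smooth.continuous_sum_hess_sq {u : (Fin n → ℝ) → ℝ} (hu : Smooth u) :
    Continuous fun x => ∑ i, ∑ j, hess u x i j ^ 2 :=
  continuous_finsetSum _ fun i _ => continuous_finsetSum _ fun j _ =>
    ((hu.partialDeriv j).partialDeriv i).continuous.pow 2

end Construction

theorem integrable_of_lintegral_ofReal_lt_top {n : ℕ} {μ : Measure (Fin n → ℝ)}
    {F : (Fin n → ℝ) → ℝ} (hF : Continuous F) (h0 : ∀ x, 0 ≤ F x)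
    (h : ∫⁻ x, ENNReal.ofReal (F x) ∂μ < ⊤) : Integrable F μ :=
  ⟨hF.aestronglyMeasurable,
    (hasFiniteIntegral_iff_ofReal (Eventually.of_forall h0)).2 h⟩

/-- Finite-dimensional regularity estimate for the backward Monge
potential (Proposition 3.2): if `f` is `(1−c)`-convex then
`c·∫‖Hess ψ‖_F² dν ≤ 3(∫|∇φ|² dρ + ∫|∇g|² dν + ∫|∇f|² dρ)`. -/
theorem backward_potential_regularity_estimate (n : ℕ) (c : ℝ) (hc : c ∈ Set.Ioo (0 : ℝ) 1)
    (f g φ ψ : (Fin n → ℝ) → ℝ)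
    (hf : ContDiff ℝ (⊤ : ℕ∞) f) (hg : ContDiff ℝ (⊤ : ℕ∞) g)
    (hφ : ContDiff ℝ (⊤ : ℕ∞) φ) (hψ : ContDiff ℝ (⊤ : ℕ∞) ψ)
    (ρ ν : Measure (Fin n → ℝ))
    (hρ : ρ = (stdGaussian n).withDensity fun x => ENNReal.ofReal (Real.exp (-f x)))
    (hν : ν = (stdGaussian n).withDensity fun x => ENNReal.ofReal (Real.exp (-g x)))
    (hρprob : IsProbabilityMeasure ρ) (hνprob : IsProbabilityMeasure ν)
    (hfint : ∫⁻ x, ENNReal.ofReal (∑ i, grad f x i ^ 2) ∂ρ < ⊤)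
    (hgint : ∫⁻ x, ENNReal.ofReal (∑ i, grad g x i ^ 2) ∂ν < ⊤)
    (hfconv : ConvexOn ℝ Set.univ fun x => f x + (1 - c) / 2 * ∑ i, x i ^ 2)
    (hconv : ConvexOn ℝ Set.univ fun x => (∑ i, x i ^ 2) / 2 + φ x)
    (hinv : ∀ x, IsUnit (1 + hess φ x))
    (hpush : Measure.map (fun x => x + grad φ x) ρ = ν)
    (hST : ∀ x, (x + grad φ x) + grad ψ (x + grad φ x) = x)
    (hφint : ∫⁻ x, ENNReal.ofReal (∑ i, grad φ x i ^ 2) ∂ρ < ⊤) :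
    ENNReal.ofReal c * ∫⁻ x, ENNReal.ofReal (∑ i, ∑ j, hess ψ x i j ^ 2) ∂ν
      ≤ 3 * (∫⁻ x, ENNReal.ofReal (∑ i, grad φ x i ^ 2) ∂ρ
          + ∫⁻ x, ENNReal.ofReal (∑ i, grad g x i ^ 2) ∂ν
          + ∫⁻ x, ENNReal.ofReal (∑ i, grad f x i ^ 2) ∂ρ) := by
  have hT : Continuous (idAddGrad φ) := (Smooth.idAddGrad hφ).continuous
  have hpush' : Measure.map (idAddGrad φ) ρ = ν := hpush
  have hmap : ∀ F : (Fin n → ℝ) → ℝ, Continuous F →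
      ∫⁻ x, ENNReal.ofReal (F x) ∂ν = ∫⁻ x, ENNReal.ofReal (F (idAddGrad φ x)) ∂ρ := by
    intro F hF
    rw [← hpush', lintegral_map hF.measurable.ennreal_ofReal hT.measurable]
  have hsq : ∀ v : Fin n → ℝ, 0 ≤ ∑ i, v i ^ 2 := fun v =>
    Finset.sum_nonneg fun i _ => sq_nonneg _
  have hgT := (Smooth.continuous_sum_grad_sq hg).comp hT
  rw [hmap _ (Smooth.continuous_sum_grad_sq hg)] at hgint ⊢
  rw [hmap _ (Smooth.continuous_sum_hess_sq hψ)]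
  have D : MongeMap c f g φ ψ ρ ν :=
    { pos := hc.1
      smooth_f := hf
      smooth_g := hg
      smooth_φ := hφ
      smooth_ψ := hψ
      prob := hρprob
      score_ρ := hρ ▸ isScore_gibbs hf
      score_ν := hν ▸ isScore_gibbs hg
      map_eq := hpush'
      left_inv := hST
      hess_f := fun x => by
        convert hfconv.posSemidef_hess_add hf x using 1
        rw [idAddHess, mul_div_cancel₀ _ (two_ne_zero' ℝ), sub_smul, one_smul]
        abel
      hess_φ := fun x => by
        have h : (idAddHess φ x).PosSemidef := by
          have hconv' : ConvexOn ℝ Set.univ fun x => φ x + 1 / 2 * ∑ i, x i ^ 2 := by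
            convert hconv using 2
            ring
          convert hconv'.posSemidef_hess_add hφ x using 1
          rw [idAddHess, mul_one_div_cancel (two_ne_zero' ℝ), one_smul, add_comm]
        exact h.posDef_iff_isUnit.2 (hinv x)
      grad_f := integrable_of_lintegral_ofReal_lt_top
        (Smooth.continuous_sum_grad_sq hf) (fun x => hsq _) hfint
      grad_g := integrable_of_lintegral_ofReal_lt_top hgT (fun x => hsq _) hgint
      grad_φ := integrable_of_lintegral_ofReal_lt_top
        (Smooth.continuous_sum_grad_sq hφ) (fun x => hsq _) hφint }
  obtain ⟨hint, hle⟩ := D.integral_trace_mul_sub_one_sq_le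
  have h0 : ∀ x, 0 ≤ (idAddHess f x * ((invHess 0 φ x - 1) * (invHess 0 φ x - 1))).trace :=
    fun x => (mul_nonneg hc.1.le (Finset.sum_nonneg fun i _ => hsq _)).trans
      (D.sum_hess_sq_le_trace x)
  rw [← lintegral_const_mul' _ _ ENNReal.ofReal_ne_top,
    ← ofReal_integral_eq_lintegral_ofReal D.grad_φ (Eventually.of_forall fun x => hsq _),
    ← ofReal_integral_eq_lintegral_ofReal D.grad_g (Eventually.of_forall fun x => hsq _),
    ← ofReal_integral_eq_lintegral_ofReal D.grad_f (Eventually.of_forall fun x => hsq _),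
    ← ENNReal.ofReal_add (integral_nonneg fun x => hsq _) (integral_nonneg fun x => hsq _),
    ← ENNReal.ofReal_add (add_nonneg (integral_nonneg fun x => hsq _)
      (integral_nonneg fun x => hsq _)) (integral_nonneg fun x => hsq _),
    ← ENNReal.ofReal_ofNat 3, ← ENNReal.ofReal_mul (by norm_num)]
  refine le_trans (lintegral_mono fun x => ?_) ((ofReal_integral_eq_lintegral_ofReal hint
    (Eventually.of_forall h0)).symm.trans_le (ENNReal.ofReal_le_ofReal hle))
  rw [← ENNReal.ofReal_mul hc.1.le]
  exact ENNReal.ofReal_le_ofReal (D.sum_hess_sq_le_trace x)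
end

section
/- Let g : ℝ^n → ℝ be a C^∞ function such that ν = e^{−g}·β is a probability measure with ∫|∇g|² dν < ∞, and let ψ : ℝ^n → ℝ be a C^∞ function with compact support. Define the Ornstein–Uhlenbeck operator (Lψ)(x) = ⟨x, ∇ψ(x)⟩ − Δψ(x). Then ∫ (Lψ)² / (1 + |∇ψ|²) dν ≤ ∫|∇g|² dν + 2∫|∇ψ|² dν + 10∫‖Hess ψ‖_F² dν, where ‖·‖_F is the Frobenius (Hilbert–Schmidt) norm. (This is the key a priori estimate in the proof of Lemma 4.6.) -/
open MeasureTheory Real Filter Topology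

section Gradient

variable {n : ℕ} {f h : (Fin n → ℝ) → ℝ}

lemma contDiff_grad_s14 (hf : ContDiff ℝ (⊤ : ℕ∞) f) (i : Fin n) :
    ContDiff ℝ (⊤ : ℕ∞) fun x => grad f x i :=
  (hf.fderiv_right (m := (⊤ : ℕ∞)) (by simp)).clm_apply contDiff_const

lemma HasCompactSupport.grad_apply (hf : HasCompactSupport f) (i : Fin n) :
    HasCompactSupport fun x => grad f x i :=
  hf.fderiv_apply (𝕜 := ℝ) _

lemma grad_fun_add (hf : ContDiff ℝ (⊤ : ℕ∞) f) (hh : ContDiff ℝ (⊤ : ℕ∞) h)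
    (x : Fin n → ℝ) (i : Fin n) :
    grad (fun y => f y + h y) x i = grad f x i + grad h x i := by
  simp [grad, fderiv_fun_add (hf.differentiable (by simp) x) (hh.differentiable (by simp) x)]

lemma grad_fun_sub (hf : ContDiff ℝ (⊤ : ℕ∞) f) (hh : ContDiff ℝ (⊤ : ℕ∞) h)
    (x : Fin n → ℝ) (i : Fin n) :
    grad (fun y => f y - h y) x i = grad f x i - grad h x i := by
  simp [grad, fderiv_fun_sub (hf.differentiable (by simp) x) (hh.differentiable (by simp) x)]

lemma grad_fun_mul (hf : ContDiff ℝ (⊤ : ℕ∞) f) (hh : ContDiff ℝ (⊤ : ℕ∞) h)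
    (x : Fin n → ℝ) (i : Fin n) :
    grad (fun y => f y * h y) x i = grad f x i * h x + f x * grad h x i := by
  simp [grad, fderiv_fun_mul (hf.differentiable (by simp) x) (hh.differentiable (by simp) x)]
  ring

lemma grad_fun_inv (hf : ContDiff ℝ (⊤ : ℕ∞) f) (x : Fin n → ℝ) (hx : f x ≠ 0) (i : Fin n) :
    grad (fun y => (f y)⁻¹) x i = -grad f x i * (f x)⁻¹ ^ 2 := by
  have h := ((hasDerivAt_inv hx).comp_hasFDerivAt x
    (hf.differentiable (by simp) x).hasFDerivAt).fderiv
  have h' : fderiv ℝ (fun y => (f y)⁻¹) x = _ := h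
  simp [grad, h']
  ring

lemma grad_fun_sum {ι : Type*} (s : Finset ι) {F : ι → (Fin n → ℝ) → ℝ}
    (hF : ∀ k, ContDiff ℝ (⊤ : ℕ∞) (F k)) (x : Fin n → ℝ) (i : Fin n) :
    grad (fun y => ∑ k ∈ s, F k y) x i = ∑ k ∈ s, grad (F k) x i := by
  simp [grad, fderiv_fun_sum fun k _ => (hF k).differentiable (by simp) x]

lemma grad_eq_zero_of_notMem {K : Set (Fin n → ℝ)} (hK : IsClosed K)
    (hf : ∀ y ∉ K, f y = 0) {x : Fin n → ℝ} (hx : x ∉ K) (i : Fin n) : grad f x i = 0 := by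
  have : f =ᶠ[𝓝 x] fun _ => 0 := by
    filter_upwards [hK.isOpen_compl.mem_nhds hx] with y hy using hf y hy
  simp [grad, this.fderiv_eq]

lemma grad_const (c : ℝ) (x : Fin n → ℝ) (i : Fin n) : grad (fun _ => c) x i = 0 := by
  simp [grad]

lemma grad_coord (k : Fin n) (x : Fin n → ℝ) (i : Fin n) :
    grad (fun y => y k) x i = if k = i then 1 else 0 := by
  simp [grad, fderiv_apply, Pi.single_apply]

lemma grad_fun_exp (hf : ContDiff ℝ (⊤ : ℕ∞) f) (x : Fin n → ℝ) (i : Fin n) :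
    grad (fun y => Real.exp (f y)) x i = Real.exp (f x) * grad f x i := by
  simp [grad, fderiv_exp (hf.differentiable (by simp) x)]

lemma grad_grad_comm (hf : ContDiff ℝ (⊤ : ℕ∞) f) (x : Fin n → ℝ) (i j : Fin n) :
    grad (fun y => grad f y i) x j = grad (fun y => grad f y j) x i := by
  have hd : DifferentiableAt ℝ (fderiv ℝ f) x :=
    (hf.fderiv_right (m := (⊤ : ℕ∞)) (by simp)).differentiable (by simp) x
  have key (k l : Fin n) : grad (fun y => grad f y k) x l
      = fderiv ℝ (fderiv ℝ f) x (Pi.single l 1) (Pi.single k 1) := by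
    simp only [grad]
    rw [fderiv_clm_apply hd (differentiableAt_const _)]
    simp
  rw [key, key]
  exact ((hf.contDiffAt (x := x)).isSymmSndFDerivAt (by
    simp only [minSmoothness_of_isRCLikeNormedField]
    exact WithTop.coe_le_coe.2 le_top)).eq _ _

end Gradient

section WeightedDivergence

variable {n : ℕ}

lemma integral_weighted_divergence_eq_zero {g : (Fin n → ℝ) → ℝ}
    (hg : ContDiff ℝ (⊤ : ℕ∞) g) {Z : Fin n → (Fin n → ℝ) → ℝ}
    (hZ : ∀ j, ContDiff ℝ (⊤ : ℕ∞) (Z j)) (hZs : ∀ j, HasCompactSupport (Z j)) :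
    ∫ x, (∑ j, (grad (Z j) x j - (x j + grad g x j) * Z j x))
      ∂(stdGaussian n).withDensity (fun x => ENNReal.ofReal (Real.exp (-g x))) = 0 := by
  set c : ℝ := (2 * π) ^ (-(n : ℝ) / 2)
  have hc : 0 ≤ c := by positivity
  set E : (Fin n → ℝ) → ℝ := fun x => -(∑ i, x i ^ 2) / 2
  set ρ : (Fin n → ℝ) → ℝ := fun x => (c * Real.exp (E x)) * Real.exp (-g x) with hρ
  have hE : ContDiff ℝ (⊤ : ℕ∞) E := by fun_prop
  have hρs : ContDiff ℝ (⊤ : ℕ∞) ρ := by fun_prop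
  have hgE (x : Fin n → ℝ) (j : Fin n) : grad E x j = -x j := by
    have : E = fun x => ∑ i, (-1 / 2) * (x i * x i) := by
      ext x; simp only [E, ← Finset.mul_sum, pow_two]; ring
    rw [this, grad_fun_sum _ (fun k => by fun_prop)]
    have (k : Fin n) : grad (fun x : Fin n → ℝ => (-1 / 2) * (x k * x k)) x j
        = if k = j then -x k else 0 := by
      rw [grad_fun_mul (by fun_prop) (by fun_prop), grad_fun_mul (by fun_prop) (by fun_prop),
        grad_const, grad_coord]
      split_ifs <;> ring
    simp [this]
  have hgρ (x : Fin n → ℝ) (j : Fin n) : grad ρ x j = -(x j + grad g x j) * ρ x := by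
    have hneg : grad (fun y => -g y) x j = -grad g x j := by simp [grad]
    rw [hρ, grad_fun_mul (by fun_prop) (by fun_prop), grad_fun_mul (by fun_prop) (by fun_prop),
      grad_fun_exp hE, grad_fun_exp hg.neg, grad_const, hgE, hneg]
    ring
  have hgauss : Measurable fun x : Fin n → ℝ => ENNReal.ofReal (c * Real.exp (E x)) :=
    (Continuous.measurable (by fun_prop)).ennreal_ofReal
  have hgm : Measurable fun x : Fin n → ℝ => ENNReal.ofReal (Real.exp (-g x)) :=
    (Continuous.measurable (by fun_prop)).ennreal_ofReal
  rw [integral_withDensity_eq_integral_toReal_smul hgm (by simp)]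
  change ∫ x, _ ∂(volume.withDensity fun x : Fin n → ℝ => ENNReal.ofReal (c * Real.exp (E x))) = 0
  rw [integral_withDensity_eq_integral_toReal_smul hgauss (by simp)]
  have hint1 (j : Fin n) : Integrable fun x => grad (Z j) x j * ρ x :=
    ((contDiff_grad_s14 (hZ j) j).continuous.mul hρs.continuous).integrable_of_hasCompactSupport
      ((hZs j).grad_apply j).mul_right
  have hint2 (j : Fin n) : Integrable fun x => Z j x * grad ρ x j :=
    ((hZ j).continuous.mul (contDiff_grad_s14 hρs j).continuous).integrable_of_hasCompactSupport
      (hZs j).mul_right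
  have hint3 (j : Fin n) : Integrable fun x => Z j x * ρ x :=
    ((hZ j).continuous.mul hρs.continuous).integrable_of_hasCompactSupport (hZs j).mul_right
  calc _ = ∫ x, ∑ j, (grad (Z j) x j * ρ x + Z j x * grad ρ x j) := by
        refine integral_congr_ae (Eventually.of_forall fun x => ?_)
        simp only [hgρ, smul_eq_mul, ENNReal.toReal_ofReal (Real.exp_nonneg _),
          ENNReal.toReal_ofReal (mul_nonneg hc (Real.exp_nonneg _)), Finset.mul_sum]
        refine Finset.sum_congr rfl fun j _ => ?_
        simp only [hρ]
        ring
    _ = 0 := by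
        rw [integral_finsetSum (f := fun j x => grad (Z j) x j * ρ x + Z j x * grad ρ x j) _
          fun j _ => (hint1 j).add (hint2 j)]
        refine Finset.sum_eq_zero fun j _ => ?_
        rw [integral_add (hint1 j) (hint2 j)]
        have := integral_mul_fderiv_eq_neg_fderiv_mul_of_integrable (hint1 j) (hint2 j) (hint3 j)
          (fun x _ => (hZ j).differentiable (by simp) x)
          (fun x _ => hρs.differentiable (by simp) x)
        simp only [grad] at this ⊢
        rw [this]
        ring

end WeightedDivergence

/-- The vector field `p`, its derivative `H` and the function `g` enter the estimate only through
this pointwise inequality, with `q = H p`, `w = 1 + |p|²` and `u` in place of `Lψ`. -/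
lemma pointwise_ou_estimate {n : ℕ} (G p : Fin n → ℝ) (H : Fin n → Fin n → ℝ) (u : ℝ) :
    u ^ 2 / (1 + ∑ i, p i ^ 2)
      + 2 * ((-u ^ 2 + ∑ i, p i ^ 2 + ∑ i, ∑ j, H i j ^ 2
            - ∑ j, G j * (p j * u + ∑ i, H j i * p i)) * (1 + ∑ i, p i ^ 2)⁻¹
          - ∑ j, (p j * u + ∑ i, H j i * p i) * (2 * ∑ i, p i * H j i)
            * (1 + ∑ i, p i ^ 2)⁻¹ ^ 2)
      ≤ ∑ i, G i ^ 2 + 2 * ∑ i, p i ^ 2 + 10 * ∑ i, ∑ j, H i j ^ 2 := by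
  set q : Fin n → ℝ := fun j => ∑ i, H j i * p i with hq
  have hq' (j : Fin n) : ∑ i, p i * H j i = q j := by simp only [hq, mul_comm]
  simp only [hq']
  change _ + 2 * ((_ - ∑ j, G j * (p j * u + q j)) * _ - ∑ j, (p j * u + q j) * _ * _) ≤ _
  set P := ∑ i, p i ^ 2 with hP
  set S := ∑ i, ∑ j, H i j ^ 2 with hS
  have hP0 : 0 ≤ P := Finset.sum_nonneg fun i _ => sq_nonneg _
  have hS0 : 0 ≤ S := Finset.sum_nonneg fun i _ => Finset.sum_nonneg fun j _ => sq_nonneg _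
  set r := (1 + P)⁻¹ with hr
  have hr0 : 0 < r := by positivity
  have hrP : r * (1 + P) = 1 := inv_mul_cancel₀ (by positivity)
  set Q := ∑ i, q i ^ 2 with hQ
  set a := ∑ i, G i * p i with ha
  set b := ∑ i, G i * q i with hb
  set e := ∑ i, p i * q i with he
  set Γ := ∑ i, G i ^ 2 with hΓ
  have hQ0 : 0 ≤ Q := Finset.sum_nonneg fun i _ => sq_nonneg _
  have e1 : ∑ j, G j * (p j * u + q j) = u * a + b := by
    simp only [ha, hb, Finset.mul_sum, ← Finset.sum_add_distrib]
    exact Finset.sum_congr rfl fun j _ => by ring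
  have e2 : ∑ j, (p j * u + q j) * (2 * q j) * r ^ 2 = (2 * u * e + 2 * Q) * r ^ 2 := by
    simp only [he, hQ, Finset.mul_sum, Finset.sum_mul, add_mul, ← Finset.sum_add_distrib]
    exact Finset.sum_congr rfl fun j _ => by ring
  have cs1 : Q ≤ S * P := by
    rw [hQ, hS, Finset.sum_mul]
    exact Finset.sum_le_sum fun i _ => Finset.sum_mul_sq_le_sq_mul_sq _ _ _
  have norm_sq_add (t : ℝ) : ∑ i, (G i + t * q i) ^ 2 = Γ + 2 * t * b + t ^ 2 * Q := by
    simp only [hΓ, hb, hQ, Finset.mul_sum, ← Finset.sum_add_distrib]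
    exact Finset.sum_congr rfl fun j _ => by ring
  have cs2 : (a + 2 * r * e) ^ 2 ≤ P * (Γ + 2 * (2 * r) * b + (2 * r) ^ 2 * Q) := by
    have e3 : a + 2 * r * e = ∑ i, p i * (G i + 2 * r * q i) := by
      simp only [ha, he, Finset.mul_sum, ← Finset.sum_add_distrib]
      exact Finset.sum_congr rfl fun j _ => by ring
    rw [← norm_sq_add, e3]
    exact Finset.sum_mul_sq_le_sq_mul_sq _ _ _
  have sq0 : 0 ≤ Γ + 2 * (-(2 * P * r - 1)) * b + (-(2 * P * r - 1)) ^ 2 * Q := by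
    rw [← norm_sq_add]
    exact Finset.sum_nonneg fun i _ => sq_nonneg _
  rw [e1, e2, div_eq_mul_inv, ← hr]
  have hPr : P * r = 1 - r := by linarith
  have hr1 : r ≤ 1 := by nlinarith [mul_nonneg hP0 hr0.le]
  have hQr : Q * r ≤ S := by
    calc Q * r ≤ S * P * r := by gcongr
      _ = S * (1 - r) := by rw [mul_assoc, hPr]
      _ ≤ S := by nlinarith
  have m1 := mul_le_mul_of_nonneg_left cs2 hr0.le
  have m2 := mul_nonneg hr0.le sq0
  have m3 := mul_nonneg hr0.le (sq_nonneg (u + (a + 2 * r * e)))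
  have hPe : r * (P * (Γ + 2 * (2 * r) * b + (2 * r) ^ 2 * Q))
      = (1 - r) * (Γ + 2 * (2 * r) * b + (2 * r) ^ 2 * Q) := by rw [← hPr]; ring
  have hk : 2 * P * r - 1 = 1 - 2 * r := by linarith
  rw [hPe] at m1
  rw [hk] at m2
  nlinarith [mul_nonneg hP0 hr0.le, mul_nonneg hS0 hr0.le, mul_nonneg hS0 (sub_nonneg.2 hr1)]

lemma weighted_divergence_ou_field {n : ℕ} (G : Fin n → ℝ) {ψ : (Fin n → ℝ) → ℝ}
    (hψ : ContDiff ℝ (⊤ : ℕ∞) ψ) (x : Fin n → ℝ) :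
    ∑ j, (grad (fun y => (grad ψ y j * ((∑ i, y i * grad ψ y i) - ∑ i, hess ψ y i i)
          + ∑ i, hess ψ y j i * grad ψ y i) * (1 + ∑ i, grad ψ y i ^ 2)⁻¹) x j
        - (x j + G j) * ((grad ψ x j * ((∑ i, x i * grad ψ x i) - ∑ i, hess ψ x i i)
          + ∑ i, hess ψ x j i * grad ψ x i) * (1 + ∑ i, grad ψ x i ^ 2)⁻¹))
      = (-((∑ i, x i * grad ψ x i) - ∑ i, hess ψ x i i) ^ 2 + ∑ i, grad ψ x i ^ 2
            + ∑ i, ∑ j, hess ψ x i j ^ 2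
            - ∑ j, G j * (grad ψ x j * ((∑ i, x i * grad ψ x i) - ∑ i, hess ψ x i i)
              + ∑ i, hess ψ x j i * grad ψ x i)) * (1 + ∑ i, grad ψ x i ^ 2)⁻¹
          - ∑ j, (grad ψ x j * ((∑ i, x i * grad ψ x i) - ∑ i, hess ψ x i i)
              + ∑ i, hess ψ x j i * grad ψ x i) * (2 * ∑ i, grad ψ x i * hess ψ x j i)
            * (1 + ∑ i, grad ψ x i ^ 2)⁻¹ ^ 2 := by
  have hp (i : Fin n) := contDiff_grad_s14 hψ i
  have hH (i j : Fin n) : ContDiff ℝ (⊤ : ℕ∞) fun y => hess ψ y i j := contDiff_grad_s14 (hp j) i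
  have hpd (i j : Fin n) : grad (fun y => grad ψ y i) x j = hess ψ x j i := rfl
  have hw0 (y : Fin n → ℝ) : (1 + ∑ i, grad ψ y i ^ 2) ≠ 0 := by positivity
  have hw : ContDiff ℝ (⊤ : ℕ∞) fun y => 1 + ∑ i, grad ψ y i ^ 2 := by fun_prop
  have hwinv : ContDiff ℝ (⊤ : ℕ∞) fun y => (1 + ∑ i, grad ψ y i ^ 2)⁻¹ := hw.inv hw0
  obtain ⟨u, hu_def⟩ : ∃ u : (Fin n → ℝ) → ℝ,
      ∀ y, (∑ i, y i * grad ψ y i) - ∑ i, hess ψ y i i = u y := ⟨_, fun _ => rfl⟩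
  have hu_fun : u = fun y => (∑ i, y i * grad ψ y i) - ∑ i, hess ψ y i i :=
    funext fun y => (hu_def y).symm
  have hu : ContDiff ℝ (⊤ : ℕ∞) u := by rw [hu_fun]; fun_prop
  simp only [hu_def]
  have hHsymm (i j : Fin n) : hess ψ x i j = hess ψ x j i := grad_grad_comm hψ x j i
  have hTsymm (i j : Fin n) : grad (fun y => hess ψ y j i) x j
      = grad (fun y => hess ψ y j j) x i := by
    have : (fun y => hess ψ y j i) = fun y => hess ψ y i j :=
      funext fun y => grad_grad_comm hψ y i j
    rw [this]
    exact grad_grad_comm (hp j) x i j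
  have hgw (j : Fin n) : grad (fun y => 1 + ∑ i, grad ψ y i ^ 2) x j
      = 2 * ∑ i, grad ψ x i * hess ψ x j i := by
    simp only [pow_two]
    rw [grad_fun_add (by fun_prop) (by fun_prop), grad_const,
      grad_fun_sum _ (fun k => by fun_prop), zero_add, Finset.mul_sum]
    refine Finset.sum_congr rfl fun i _ => ?_
    rw [grad_fun_mul (hp i) (hp i), hpd]
    ring
  have hgu (j : Fin n) : grad u x j = grad ψ x j + ∑ i, x i * hess ψ x j i
      - ∑ i, grad (fun y => hess ψ y i i) x j := by
    rw [hu_fun, grad_fun_sub (by fun_prop) (by fun_prop), grad_fun_sum _ (fun k => by fun_prop),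
      grad_fun_sum _ (fun k => hH k k)]
    congr 1
    simp [grad_fun_mul (contDiff_apply ℝ ℝ _) (hp _), grad_coord, hpd, Finset.sum_add_distrib]
  have hgZ (j : Fin n) : grad (fun y => (grad ψ y j * u y + ∑ i, hess ψ y j i * grad ψ y i)
        * (1 + ∑ i, grad ψ y i ^ 2)⁻¹) x j
      = (hess ψ x j j * u x + grad ψ x j * grad u x j
          + ∑ i, (grad (fun y => hess ψ y j j) x i * grad ψ x i + hess ψ x j i ^ 2))
            * (1 + ∑ i, grad ψ x i ^ 2)⁻¹
        - (grad ψ x j * u x + ∑ i, hess ψ x j i * grad ψ x i)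
          * (2 * ∑ i, grad ψ x i * hess ψ x j i) * (1 + ∑ i, grad ψ x i ^ 2)⁻¹ ^ 2 := by
    rw [grad_fun_mul (by fun_prop) hwinv, grad_fun_inv hw x (hw0 x), hgw,
      grad_fun_add (by fun_prop) (by fun_prop), grad_fun_mul (hp j) hu, hpd,
      grad_fun_sum _ (fun k => (hH j k).mul (hp k))]
    simp only [grad_fun_mul (hH _ _) (hp _), hpd, hTsymm, pow_two (hess ψ x _ _)]
    ring
  simp only [hgZ]
  have main : ∑ j, (hess ψ x j j * u x + grad ψ x j * grad u x j
          + ∑ i, (grad (fun y => hess ψ y j j) x i * grad ψ x i + hess ψ x j i ^ 2)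
          - x j * (grad ψ x j * u x + ∑ i, hess ψ x j i * grad ψ x i))
      = -u x ^ 2 + ∑ i, grad ψ x i ^ 2 + ∑ i, ∑ j, hess ψ x i j ^ 2 := by
    have c1 : ∑ j, ∑ i, grad (fun y => hess ψ y j j) x i * grad ψ x i
        = ∑ j, grad ψ x j * ∑ i, grad (fun y => hess ψ y i i) x j := by
      rw [Finset.sum_comm]
      exact Finset.sum_congr rfl fun j _ => by rw [Finset.mul_sum]; simp only [mul_comm]
    have c2 : ∑ j, x j * ∑ i, hess ψ x j i * grad ψ x i
        = ∑ j, grad ψ x j * ∑ i, x i * hess ψ x j i := by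
      simp only [Finset.mul_sum]
      rw [Finset.sum_comm]
      refine Finset.sum_congr rfl fun j _ => Finset.sum_congr rfl fun i _ => ?_
      rw [hHsymm i j]
      ring
    have c3 : u x ^ 2 = (∑ j, x j * (grad ψ x j * u x)) - ∑ j, hess ψ x j j * u x := by
      rw [pow_two]
      nth_rewrite 1 [← hu_def x]
      rw [sub_mul, Finset.sum_mul, Finset.sum_mul]
      simp only [mul_assoc]
    simp only [hgu, mul_add, mul_sub, Finset.sum_add_distrib, Finset.sum_sub_distrib, c1, c2, c3,
      pow_two (grad ψ x _)]
    ring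
  rw [← main]
  simp only [Finset.sum_mul, sub_mul, ← Finset.sum_sub_distrib]
  refine Finset.sum_congr rfl fun j _ => ?_
  ring

/-- A priori estimate for the Ornstein–Uhlenbeck operator
`(Lψ)(x) = ⟨x, ∇ψ(x)⟩ − Δψ(x)` (key estimate in the proof of Lemma 4.6):
`∫ (Lψ)²/(1 + |∇ψ|²) dν ≤ ∫|∇g|² dν + 2∫|∇ψ|² dν + 10∫‖Hess ψ‖_F² dν`. -/
theorem ou_operator_apriori_estimate (n : ℕ)
    (g ψ : (Fin n → ℝ) → ℝ) (hg : ContDiff ℝ (⊤ : ℕ∞) g) (hψ : ContDiff ℝ (⊤ : ℕ∞) ψ)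
    (hψsupp : HasCompactSupport ψ)
    (ν : Measure (Fin n → ℝ))
    (hν : ν = (stdGaussian n).withDensity fun x => ENNReal.ofReal (Real.exp (-g x)))
    (hprob : IsProbabilityMeasure ν)
    (hgint : Integrable (fun x => ∑ i, grad g x i ^ 2) ν) :
    ∫ x, ((∑ i, x i * grad ψ x i) - ∑ i, hess ψ x i i) ^ 2
        / (1 + ∑ i, grad ψ x i ^ 2) ∂ν
      ≤ ∫ x, (∑ i, grad g x i ^ 2) ∂ν + 2 * ∫ x, (∑ i, grad ψ x i ^ 2) ∂ν
        + 10 * ∫ x, (∑ i, ∑ j, hess ψ x i j ^ 2) ∂ν := by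
  have hp (i : Fin n) := contDiff_grad_s14 hψ i
  have hH (i j : Fin n) : ContDiff ℝ (⊤ : ℕ∞) fun y => hess ψ y i j := contDiff_grad_s14 (hp j) i
  have hK : IsClosed (tsupport ψ) := isClosed_tsupport ψ
  have hw0 (y : Fin n → ℝ) : (1 + ∑ i, grad ψ y i ^ 2) ≠ 0 := by positivity
  have hw : ContDiff ℝ (⊤ : ℕ∞) fun y => (1 + ∑ i, grad ψ y i ^ 2)⁻¹ :=
    ContDiff.inv (by fun_prop) hw0
  have integrable_of {f : (Fin n → ℝ) → ℝ} (hf : Continuous f)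
      (hf0 : ∀ x ∉ tsupport ψ, f x = 0) : Integrable f ν :=
    hf.integrable_of_hasCompactSupport (HasCompactSupport.intro hψsupp hf0)
  have hp0 (x : Fin n → ℝ) (hx : x ∉ tsupport ψ) (i : Fin n) : grad ψ x i = 0 :=
    grad_eq_zero_of_notMem hK (fun _ => image_eq_zero_of_notMem_tsupport) hx i
  have hH0 (x : Fin n → ℝ) (hx : x ∉ tsupport ψ) (i j : Fin n) : hess ψ x i j = 0 :=
    grad_eq_zero_of_notMem hK (fun y hy => hp0 y hy j) hx i
  set Z : Fin n → (Fin n → ℝ) → ℝ := fun j y =>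
    (grad ψ y j * ((∑ i, y i * grad ψ y i) - ∑ i, hess ψ y i i)
      + ∑ i, hess ψ y j i * grad ψ y i) * (1 + ∑ i, grad ψ y i ^ 2)⁻¹ with hZ_def
  have hZ (j : Fin n) : ContDiff ℝ (⊤ : ℕ∞) (Z j) := ContDiff.mul (by fun_prop) hw
  have hZ0 (j : Fin n) (x : Fin n → ℝ) (hx : x ∉ tsupport ψ) : Z j x = 0 := by
    simp [hZ_def, hp0 x hx]
  have hZs (j : Fin n) : HasCompactSupport (Z j) := HasCompactSupport.intro hψsupp (hZ0 j)
  have hgZ0 (j : Fin n) (x : Fin n → ℝ) (hx : x ∉ tsupport ψ) : grad (Z j) x j = 0 :=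
    grad_eq_zero_of_notMem hK (hZ0 j) hx j
  have hdiv := integral_weighted_divergence_eq_zero hg hZ hZs
  rw [← hν] at hdiv
  have iP : Integrable (fun x => ∑ i, grad ψ x i ^ 2) ν :=
    integrable_of (by fun_prop) fun x hx => by simp [hp0 x hx]
  have iS : Integrable (fun x => ∑ i, ∑ j, hess ψ x i j ^ 2) ν :=
    integrable_of (by fun_prop) fun x hx => by simp [hH0 x hx]
  have iu : Integrable (fun x => ((∑ i, x i * grad ψ x i) - ∑ i, hess ψ x i i) ^ 2
      / (1 + ∑ i, grad ψ x i ^ 2)) ν :=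
    integrable_of (Continuous.div (by fun_prop) (by fun_prop) hw0)
      fun x hx => by simp [hp0 x hx, hH0 x hx]
  have iD : Integrable (fun x => ∑ j, (grad (Z j) x j - (x j + grad g x j) * Z j x)) ν :=
    integrable_of (continuous_finsetSum _ fun j _ =>
        (contDiff_grad_s14 (hZ j) j).continuous.sub
          (((continuous_apply j).add (contDiff_grad_s14 hg j).continuous).mul (hZ j).continuous))
      fun x hx => by simp [hgZ0 _ x hx, hZ0 _ x hx]
  have hmono := integral_mono (iu.add (iD.const_mul 2))
    ((hgint.add (iP.const_mul 2)).add (iS.const_mul 10)) fun x => by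
      simp only [Pi.add_apply, hZ_def]
      rw [weighted_divergence_ou_field (grad g x) hψ x]
      exact pointwise_ou_estimate (grad g x) (grad ψ x) (hess ψ x) _
  rw [integral_add' iu (iD.const_mul 2), integral_add' (hgint.add (iP.const_mul 2))
    (iS.const_mul 10), integral_add' hgint (iP.const_mul 2)] at hmono
  simp only [integral_const_mul, hdiv, mul_zero, add_zero] at hmono
  exact hmono
end
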